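/- Let N and k be integers with N > 2 and k ≥ 3. Then the complex dimension of the space S_k(Γ(N)) of cusp forms of weight k for the principal congruence subgroup Γ(N) is given by dim_ℂ S_k(Γ(N)) = ((k-1)/24 - 1/(4N)) · N³ · ∏_{p | N, p prime} (1 - 1/p²). -/

import Mathlib

noncomputable section

open UpperHalfPlane ModularForm SlashInvariantForm SlashInvariantFormClass ModularFormClass
  CuspFormClass MatrixGroups OnePoint Filter EisensteinSeries Asymptotics Derivative
open scoped Topology Manifold Matrix

namespace VVForm

section

/-- A level one cusp form is the discriminant times a form of weight `k - 12`. -/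
lemma exists_eq_discriminant_mul {k : ℤ} {f : ModularForm 𝒮ℒ k} (hf : ModularForm.IsCuspForm f) :
    ∃ g : ModularForm 𝒮ℒ (k - 12), ∀ z, f z = discriminant z * g z := by
  obtain ⟨g, rfl⟩ := hf
  exact ⟨CuspForm.discriminantEquiv g, fun z ↦ by simp⟩

/-- If two points have proportional values of `E₄` and `E₆`, then all level one forms are
proportional at these points. -/
lemma levelOne_apply_eq {τ₁ τ₂ : ℍ} {l : ℂ} (h4 : E₄ τ₂ = l ^ 4 * E₄ τ₁)
    (h6 : E₆ τ₂ = l ^ 6 * E₆ τ₁) (k : ℕ) (f : ModularForm 𝒮ℒ (k : ℤ)) : f τ₂ = l ^ k * f τ₁ := by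
  have hΔ : discriminant τ₂ = l ^ 12 * discriminant τ₁ := by
    rw [discriminant_eq_E₄_cube_sub_E₆_sq, discriminant_eq_E₄_cube_sub_E₆_sq, h4, h6]; ring
  induction k using Nat.strong_induction_on with
  | _ k ih =>
  rcases Nat.even_or_odd k with hk | hk
  swap
  · have := ModularForm.levelOne_odd_weight_eq_zero (by exact_mod_cast hk) f
    simp [this]
  have key : ∀ g : ModularForm 𝒮ℒ (k : ℤ), (qExpansion 1 g).coeff 0 = 1 →
      g τ₂ = l ^ k * g τ₁ → f τ₂ = l ^ k * f τ₁ := by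
    intro g hg hgg
    obtain ⟨r, hr⟩ := exists_eq_discriminant_mul (ModularForm.sub_smul_isCuspForm f g hg)
    have hr' : ∀ z, f z = (qExpansion 1 f).coeff 0 * g z + discriminant z * r z := by
      intro z; rw [← hr z]; simp
    have hrr : discriminant τ₂ * r τ₂ = l ^ k * (discriminant τ₁ * r τ₁) := by
      rcases lt_or_ge k 12 with h12 | h12
      · have := levelOne_neg_weight_eq_zero (by omega) r
        simp [this]
      · have h1 : ((k : ℤ) - 12) = ((k - 12 : ℕ) : ℤ) := by omega
        have := ih (k - 12) (by omega) (ModularForm.mcast h1 r)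
        simp only [ModularForm.coe_mcast] at this
        rw [this, hΔ]
        obtain ⟨j, rfl⟩ := Nat.exists_eq_add_of_le h12
        simp only [Nat.add_sub_cancel_left]
        ring
    rw [hr' τ₂, hr' τ₁, hgg, hrr]; ring
  have e4 := E_qExpansion_coeff_zero (k := 4) (by norm_num) ⟨2, rfl⟩
  have e6 := E_qExpansion_coeff_zero (k := 6) (by norm_num) ⟨3, rfl⟩
  obtain rfl | rfl | rfl | rfl | h8 : k = 0 ∨ k = 2 ∨ k = 4 ∨ k = 6 ∨ 8 ≤ k := by
    rcases hk with ⟨j, rfl⟩; omega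
  · obtain ⟨c, hc⟩ := levelOne_weight_zero_const (f := ModularForm.mcast (b := 0) (by simp) f)
    rw [ModularForm.coe_mcast] at hc
    simp [hc]
  · have : f = 0 := rank_zero_iff_forall_zero.mp ModularForm.levelOne_weight_two_rank_zero f
    simp [this]
  · exact key E₄ e4 h4
  · exact key E₆ e6 h6
  · have h3 : 3 ≤ k - 4 := by omega
    have hk4 : Even (k - 4) := by rcases hk with ⟨j, rfl⟩; exact ⟨j - 2, by omega⟩
    refine key (ModularForm.mcast (by push_cast [show 4 ≤ k by omega]; ring) (E₄.mul (E h3))) ?_ ?_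
    · rw [ModularForm.coe_mcast,
        ModularForm.qExpansion_mul one_pos one_mem_strictPeriods_SL]
      simp [PowerSeries.coeff_mul, e4, E_qExpansion_coeff_zero h3 hk4]
    · have := ih (k - 4) (by omega) (E h3)
      simp only [ModularForm.coe_mcast, ModularForm.coe_mul, Pi.mul_apply, h4, this]
      obtain ⟨j, rfl⟩ := Nat.exists_eq_add_of_le (show 4 ≤ k by omega)
      simp only [Nat.add_sub_cancel_left]
      ring

end

section

/-- The Cesàro means of the powers of a complex number in the closed unit disc. -/
lemma tendsto_mean_pow {y : ℂ} (hy : ‖y‖ ≤ 1) :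
    Tendsto (fun K : ℕ ↦ (K : ℂ)⁻¹ * ∑ k ∈ Finset.range K, y ^ (k + 3)) atTop
      (𝓝 (if y = 1 then 1 else 0)) := by
  split_ifs with h
  · subst h
    refine tendsto_const_nhds.congr' ?_
    filter_upwards [eventually_gt_atTop 0] with K hK
    have : (K : ℂ) ≠ 0 := by exact_mod_cast hK.ne'
    simp [this]
  · have h1 : y - 1 ≠ 0 := sub_ne_zero.mpr h
    have hb : ∀ K : ℕ, ‖(K : ℂ)⁻¹ * ∑ k ∈ Finset.range K, y ^ (k + 3)‖
        ≤ (K : ℝ)⁻¹ * (2 / ‖y - 1‖) := by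
      intro K
      have : ∑ k ∈ Finset.range K, y ^ (k + 3) = y ^ 3 * ((y ^ K - 1) / (y - 1)) := by
        rw [← geom_sum_eq h, Finset.mul_sum]
        exact Finset.sum_congr rfl fun k _ ↦ by ring
      rw [this, norm_mul, norm_inv, Complex.norm_natCast, norm_mul, norm_div]
      gcongr
      calc ‖y ^ 3‖ * (‖y ^ K - 1‖ / ‖y - 1‖) ≤ 1 * (2 / ‖y - 1‖) := by
            gcongr
            · rw [norm_pow]; exact pow_le_one₀ (norm_nonneg _) hy
            · refine (norm_sub_le _ _).trans ?_
              have := pow_le_one₀ (norm_nonneg _) hy (n := K)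
              rw [norm_pow, norm_one]; linarith
        _ = _ := one_mul _
    refine squeeze_zero_norm hb ?_
    simpa using (tendsto_inv_atTop_nhds_zero_nat (𝕜 := ℝ)).mul_const (2 / ‖y - 1‖)

/-- A discrete set of complex numbers with multiplicities is determined by its power sums. -/
lemma eq_zero_of_tsum_mul_pow_eq_zero {ε : ℂ → ℂ} (hε : ∀ x, ε x = 0 ∨ 1 ≤ ‖ε x‖)
    (hs : Summable fun x ↦ ‖ε x‖ * ‖x‖ ^ 3) (h : ∀ k : ℕ, 3 ≤ k → ∑' x, ε x * x ^ k = 0)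
    {x : ℂ} (hx : x ≠ 0) : ε x = 0 := by
  by_contra hne
  have hxpos : 0 < ‖x‖ := norm_pos_iff.mpr hx
  have hfin : {y | ε y ≠ 0 ∧ ‖x‖ ≤ ‖y‖}.Finite := by
    have := hs.tendsto_cofinite_zero.eventually (gt_mem_nhds (show (0 : ℝ) < ‖x‖ ^ 3 by positivity))
    refine (Filter.eventually_cofinite.mp this).subset fun y hy ↦ ?_
    simp only [Set.mem_ofPred_eq, not_lt]
    have h1 := (hε y).resolve_left hy.1
    have h2 : ‖x‖ ^ 3 ≤ ‖y‖ ^ 3 := by gcongr; exact hy.2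
    nlinarith [pow_pos hxpos 3]
  obtain ⟨x₀, ⟨hx₀, hxx₀⟩, hmax⟩ := Set.exists_max_image _ (fun y : ℂ ↦ ‖y‖) hfin ⟨x, hne, le_rfl⟩
  have hx₀pos : 0 < ‖x₀‖ := hxpos.trans_le hxx₀
  have hx₀0 : x₀ ≠ 0 := norm_pos_iff.mp hx₀pos
  have hle : ∀ y, ε y ≠ 0 → ‖y / x₀‖ ≤ 1 := by
    intro y hy
    rw [norm_div, div_le_one hx₀pos]
    rcases le_or_gt ‖x‖ ‖y‖ with h1 | h1
    · exact hmax y ⟨hy, h1⟩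
    · exact h1.le.trans hxx₀
  have hsum : ∀ k : ℕ, 3 ≤ k → Summable fun y ↦ ε y * (y / x₀) ^ k := by
    intro k hk
    refine Summable.of_norm_bounded (hs.mul_right (‖x₀‖ ^ 3)⁻¹) fun y ↦ ?_
    rcases eq_or_ne (ε y) 0 with h0 | h0
    · simp [h0]
    rw [norm_mul, norm_pow, mul_assoc, ← div_eq_mul_inv, ← div_pow, ← norm_div]
    exact mul_le_mul_of_nonneg_left (pow_le_pow_of_le_one (norm_nonneg _) (hle y h0) hk)
      (norm_nonneg _)
  have hzero : ∀ k : ℕ, 3 ≤ k → ∑' y, ε y * (y / x₀) ^ k = 0 := by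
    intro k hk
    have : ∀ y, ε y * (y / x₀) ^ k = ε y * y ^ k * (x₀ ^ k)⁻¹ := fun y ↦ by
      rw [div_pow]; ring
    simp_rw [this, tsum_mul_right, h k hk, zero_mul]
  have key := tendsto_tsum_of_dominated_convergence
    (f := fun (K : ℕ) y ↦ ε y * ((K : ℂ)⁻¹ * ∑ k ∈ Finset.range K, (y / x₀) ^ (k + 3)))
    (g := fun y ↦ ε y * (if y / x₀ = 1 then 1 else 0))
    (bound := fun y ↦ ‖ε y‖ * ‖y‖ ^ 3 * (‖x₀‖ ^ 3)⁻¹) (𝓕 := atTop) (hs.mul_right _) ?_ ?_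
  · have h1 : ∀ K : ℕ, ∑' y, ε y * ((K : ℂ)⁻¹ * ∑ k ∈ Finset.range K, (y / x₀) ^ (k + 3)) = 0 := by
      intro K
      have : ∀ y, ε y * ((K : ℂ)⁻¹ * ∑ k ∈ Finset.range K, (y / x₀) ^ (k + 3))
          = (K : ℂ)⁻¹ * ∑ k ∈ Finset.range K, ε y * (y / x₀) ^ (k + 3) := fun y ↦ by
        rw [← Finset.mul_sum]; ring
      simp_rw [this, tsum_mul_left]
      rw [Summable.tsum_finsetSum fun k _ ↦ hsum _ (by omega)]
      rw [Finset.sum_eq_zero fun k _ ↦ hzero _ (by omega), mul_zero]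
    have h2 : ∑' y, ε y * (if y / x₀ = 1 then (1 : ℂ) else 0) = ε x₀ := by
      rw [tsum_eq_single x₀]
      · simp [div_self hx₀0]
      · intro y hy
        have : y / x₀ ≠ 1 := fun h ↦ hy ((div_eq_one_iff_eq hx₀0).mp h)
        simp [this]
    simp_rw [h1, h2] at key
    exact hx₀ (tendsto_nhds_unique key tendsto_const_nhds)
  · intro y
    rcases eq_or_ne (ε y) 0 with h0 | h0
    · simp [h0]
    · exact (tendsto_mean_pow (hle y h0)).const_mul _
  · refine Eventually.of_forall fun K y ↦ ?_
    rcases eq_or_ne (ε y) 0 with h0 | h0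
    · simp [h0]
    rw [norm_mul, mul_assoc, ← div_eq_mul_inv, ← div_pow, ← norm_div]
    gcongr
    rcases Nat.eq_zero_or_pos K with rfl | hK
    · simp only [Nat.cast_zero, inv_zero, zero_mul, norm_zero]
      positivity
    have hK' : (0 : ℝ) < K := by exact_mod_cast hK
    rw [norm_mul, norm_inv, Complex.norm_natCast, inv_mul_le_iff₀ hK']
    refine (norm_sum_le _ _).trans ((Finset.sum_le_card_nsmul _ _ (‖y / x₀‖ ^ 3) ?_).trans ?_)
    · intro k _
      rw [norm_pow]
      exact pow_le_pow_of_le_one (norm_nonneg _) (hle y h0) (by omega)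
    · simp

end

section

lemma tsum_eisSummand_eq {τ₁ τ₂ : ℍ} {l : ℂ} (h4 : E₄ τ₂ = l ^ 4 * E₄ τ₁)
    (h6 : E₆ τ₂ = l ^ 6 * E₆ τ₁) {k : ℕ} (hk : 3 ≤ k) :
    ∑' v, eisSummand k v τ₂ = l ^ k * ∑' v, eisSummand k v τ₁ := by
  rw [tsum_eisSummand_eq_riemannZeta_mul_eisensteinSeries hk,
    tsum_eisSummand_eq_riemannZeta_mul_eisensteinSeries hk]
  have h := levelOne_apply_eq h4 h6 k (E hk)
  have h1 : ∀ z, eisensteinSeries (N := 1) 0 k z = 2 * E hk z := by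
    intro z
    change _ = 2 * ((1 / 2 : ℂ) • (eisensteinSeries (N := 1) 0 k z))
    simp
  rw [h1, h1, h]; ring

lemma eisSummand_eq_inv_pow (k : ℕ) (v : Fin 2 → ℤ) (z : ℍ) :
    eisSummand k v z = ((v 0 * (z : ℂ) + v 1)⁻¹) ^ k := by
  simp [eisSummand]

lemma lattice_injective (z : ℍ) : Function.Injective fun v : Fin 2 → ℤ ↦ (v 0 * (z : ℂ) + v 1) := by
  intro v w h
  simp only at h
  have him := congrArg Complex.im h
  simp at him
  have h0 : v 0 = w 0 := by
    have := him.resolve_right z.im_ne_zero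
    exact_mod_cast this
  have h1 : v 1 = w 1 := by
    rw [h0] at h
    exact_mod_cast add_left_cancel h
  ext i; fin_cases i <;> assumption

/-- Two lattices with the same power sums are equal. -/
lemma range_eq_of_tsum_eq {τ₁ τ₂ : ℍ} {l : ℂ} (hl : l ≠ 0)
    (h : ∀ k : ℕ, 3 ≤ k → ∑' v, eisSummand k v τ₂ = l ^ k * ∑' v, eisSummand k v τ₁) :
    Set.range (fun v : Fin 2 → ℤ ↦ (v 0 * (τ₂ : ℂ) + v 1)) =
      Set.range (fun v : Fin 2 → ℤ ↦ l⁻¹ * (v 0 * (τ₁ : ℂ) + v 1)) := by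
  classical
  set x₂ : (Fin 2 → ℤ) → ℂ := fun v ↦ (v 0 * (τ₂ : ℂ) + v 1)⁻¹ with hx₂
  set x₁ : (Fin 2 → ℤ) → ℂ := fun v ↦ l * (v 0 * (τ₁ : ℂ) + v 1)⁻¹ with hx₁
  have i₂ : Function.Injective x₂ := inv_injective.comp (lattice_injective τ₂)
  have i₁ : Function.Injective x₁ :=
    (mul_right_injective₀ hl).comp (inv_injective.comp (lattice_injective τ₁))
  have ps : ∀ (y : (Fin 2 → ℤ) → ℂ) (_ : Function.Injective y) (k : ℕ),
      (fun v ↦ y v ^ k) = (fun x ↦ (Set.range y).indicator 1 x * x ^ k) ∘ y := by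
    intro y _ k; ext v; simp
  have sp : ∀ (y : (Fin 2 → ℤ) → ℂ) (k : ℕ), Function.support
      (fun x ↦ (Set.range y).indicator (1 : ℂ → ℂ) x * x ^ k) ⊆ Set.range y := by
    intro y k x hx
    by_contra hne
    exact hx (by simp only [Set.indicator_of_notMem hne, zero_mul])
  have s₂ : ∀ k : ℕ, 3 ≤ k → Summable fun x ↦ (Set.range x₂).indicator (1 : ℂ → ℂ) x * x ^ k := by
    intro k hk
    rw [← i₂.summable_iff (fun x hx ↦ by simp [Set.indicator_of_notMem hx]), ← ps x₂ i₂]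
    simpa only [eisSummand_eq_inv_pow] using summable_eisSummand hk τ₂
  have s₁ : ∀ k : ℕ, 3 ≤ k → Summable fun x ↦ (Set.range x₁).indicator (1 : ℂ → ℂ) x * x ^ k := by
    intro k hk
    rw [← i₁.summable_iff (fun x hx ↦ by simp [Set.indicator_of_notMem hx]), ← ps x₁ i₁]
    have := (summable_eisSummand hk τ₁).mul_left (l ^ k)
    simpa only [eisSummand_eq_inv_pow, ← mul_pow] using this
  have hsum : ∀ k : ℕ, 3 ≤ k → ∑' x, ((Set.range x₂).indicator (1 : ℂ → ℂ) x -
      (Set.range x₁).indicator (1 : ℂ → ℂ) x) * x ^ k = 0 := by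
    intro k hk
    simp_rw [sub_mul]
    rw [(s₂ k hk).tsum_sub (s₁ k hk), ← i₂.tsum_eq (sp x₂ k), ← i₁.tsum_eq (sp x₁ k), sub_eq_zero]
    have := h k hk
    simp only [eisSummand_eq_inv_pow, ← tsum_mul_left, ← mul_pow] at this
    change tsum ((fun x ↦ (Set.range x₂).indicator 1 x * x ^ k) ∘ x₂) =
      tsum ((fun x ↦ (Set.range x₁).indicator 1 x * x ^ k) ∘ x₁)
    rw [← ps x₂ i₂, ← ps x₁ i₁]
    exact this
  have key := fun {x : ℂ} (hx : x ≠ 0) ↦ eq_zero_of_tsum_mul_pow_eq_zero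
    (ε := fun x ↦ (Set.range x₂).indicator (1 : ℂ → ℂ) x - (Set.range x₁).indicator (1 : ℂ → ℂ) x)
    (fun x ↦ by
      by_cases h1 : x ∈ Set.range x₂ <;> by_cases h2 : x ∈ Set.range x₁ <;>
      simp only [Set.indicator_of_mem, Set.indicator_of_notMem, h1, h2, not_false_eq_true] <;> simp)
    (by
      have := ((s₂ 3 le_rfl).sub (s₁ 3 le_rfl)).norm
      simpa only [← sub_mul, norm_mul, norm_pow] using this) hsum hx
  have hmem : ∀ x : ℂ, x ≠ 0 → (x ∈ Set.range x₂ ↔ x ∈ Set.range x₁) := by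
    intro x hx
    have := key hx
    by_cases h1 : x ∈ Set.range x₂ <;> by_cases h2 : x ∈ Set.range x₁ <;>
    simp only [Set.indicator_of_mem, Set.indicator_of_notMem, h1, h2, not_false_eq_true] at this ⊢ <;>
    simp at this
  ext ω
  rcases eq_or_ne ω 0 with rfl | hω
  · exact iff_of_true ⟨0, by simp⟩ ⟨0, by simp⟩
  have e₂ : (ω ∈ Set.range fun v : Fin 2 → ℤ ↦ (v 0 * (τ₂ : ℂ) + v 1)) ↔ ω⁻¹ ∈ Set.range x₂ := by
    simp [x₂]
  have e₁ : (ω ∈ Set.range fun v : Fin 2 → ℤ ↦ l⁻¹ * (v 0 * (τ₁ : ℂ) + v 1)) ↔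
      ω⁻¹ ∈ Set.range x₁ := by
    simp only [Set.mem_range, x₁]
    refine exists_congr fun v ↦ ?_
    rw [← inv_inj (b := ω), mul_inv, inv_inv]
  rw [e₂, e₁, hmem _ (inv_ne_zero hω)]

/-- Equality of lattices up to homothety is equivalence under the modular group. -/
lemma exists_smul_eq_of_range_eq {τ₁ τ₂ : ℍ} {l : ℂ} (hl : l ≠ 0)
    (h : Set.range (fun v : Fin 2 → ℤ ↦ (v 0 * (τ₂ : ℂ) + v 1)) =
      Set.range (fun v : Fin 2 → ℤ ↦ l⁻¹ * (v 0 * (τ₁ : ℂ) + v 1))) :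
    ∃ γ : SL(2, ℤ), γ • τ₁ = τ₂ := by
  obtain ⟨v, hv⟩ : (τ₂ : ℂ) ∈ Set.range (fun v : Fin 2 → ℤ ↦ l⁻¹ * (v 0 * (τ₁ : ℂ) + v 1)) := by
    rw [← h]; exact ⟨![1, 0], by simp⟩
  obtain ⟨w, hw⟩ : (1 : ℂ) ∈ Set.range (fun v : Fin 2 → ℤ ↦ l⁻¹ * (v 0 * (τ₁ : ℂ) + v 1)) := by
    rw [← h]; exact ⟨![0, 1], by simp⟩
  obtain ⟨v', hv'⟩ : l⁻¹ * τ₁ ∈ Set.range (fun v : Fin 2 → ℤ ↦ (v 0 * (τ₂ : ℂ) + v 1)) := by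
    rw [h]; exact ⟨![1, 0], by simp⟩
  obtain ⟨w', hw'⟩ : l⁻¹ ∈ Set.range (fun v : Fin 2 → ℤ ↦ (v 0 * (τ₂ : ℂ) + v 1)) := by
    rw [h]; exact ⟨![0, 1], by simp⟩
  simp only at hv hw hv' hw'
  have inj := lattice_injective τ₂
  have a1 : ![v 0 * v' 0 + v 1 * w' 0, v 0 * v' 1 + v 1 * w' 1] = ![1, 0] := by
    apply inj
    simp only [Matrix.cons_val_zero, Matrix.cons_val_one]
    push_cast
    linear_combination hv + (v 0 : ℂ) * hv' + (v 1 : ℂ) * hw'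
  have a2 : ![w 0 * v' 0 + w 1 * w' 0, w 0 * v' 1 + w 1 * w' 1] = ![0, 1] := by
    apply inj
    simp only [Matrix.cons_val_zero, Matrix.cons_val_one]
    push_cast
    linear_combination hw + (w 0 : ℂ) * hv' + (w 1 : ℂ) * hw'
  have b1 := congrFun a1 0
  have b2 := congrFun a1 1
  have b3 := congrFun a2 0
  have b4 := congrFun a2 1
  simp only [Matrix.cons_val_zero, Matrix.cons_val_one] at b1 b2 b3 b4
  have hdet : (v 0 * w 1 - v 1 * w 0) * (v' 0 * w' 1 - v' 1 * w' 0) = 1 := by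
    linear_combination b1 * w 0 * v' 1 + b1 * w 1 * w' 1 - b2 * w 0 * v' 0 - b2 * w 1 * w' 0 + b4
  set δ := v 0 * w 1 - v 1 * w 0 with hD
  have hden : (w 0 * (τ₁ : ℂ) + w 1) = l := by
    field_simp at hw; linear_combination hw
  have hτ : (τ₂ : ℂ) * (w 0 * (τ₁ : ℂ) + w 1) = v 0 * (τ₁ : ℂ) + v 1 := by
    rw [hden, ← hv]; field_simp
  have him : τ₂.im * Complex.normSq (w 0 * (τ₁ : ℂ) + w 1) = δ * τ₁.im := by
    have h1 : (τ₂ : ℂ) * Complex.normSq (w 0 * (τ₁ : ℂ) + w 1) =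
        (v 0 * (τ₁ : ℂ) + v 1) * (starRingEnd ℂ) (w 0 * (τ₁ : ℂ) + w 1) := by
      rw [← hτ, mul_assoc, Complex.mul_conj]
    have h2 := congrArg Complex.im h1
    simp at h2
    rw [h2, hD]; push_cast; ring
  have hDpos : 0 < δ := by
    have h1 : 0 < Complex.normSq (w 0 * (τ₁ : ℂ) + w 1) := by
      rw [hden]; exact Complex.normSq_pos.mpr hl
    have h2 : (0 : ℝ) < δ * τ₁.im := by rw [← him]; exact mul_pos τ₂.im_pos h1
    have := pos_of_mul_pos_left h2 τ₁.im_pos.le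
    exact_mod_cast this
  have hD1 : δ = 1 := by
    rcases Int.eq_one_or_neg_one_of_mul_eq_one hdet with h1 | h1 <;> omega
  have hden0 : (w 0 * (τ₁ : ℂ) + w 1) ≠ 0 := hden ▸ hl
  obtain ⟨γ, hγ⟩ : ∃ γ : SL(2, ℤ), (γ : Matrix (Fin 2) (Fin 2) ℤ) = !![v 0, v 1; w 0, w 1] :=
    ⟨⟨!![v 0, v 1; w 0, w 1], by rw [Matrix.det_fin_two_of]; exact hD1⟩, rfl⟩
  refine ⟨γ, ?_⟩
  ext
  rw [UpperHalfPlane.coe_specialLinearGroup_apply, hγ]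
  simp only [Matrix.of_apply, Matrix.cons_val', Matrix.cons_val_zero, Matrix.cons_val_one,
    Matrix.cons_val_fin_one, algebraMap_int_eq, Int.coe_castRingHom, Complex.ofReal_intCast]
  rw [div_eq_iff hden0, hτ]

/-- The map `E₄³ / Δ` is injective on orbits of the modular group. -/
theorem exists_smul_eq_of_E4_cube {τ₁ τ₂ : ℍ}
    (h : E₄ τ₁ ^ 3 * discriminant τ₂ = E₄ τ₂ ^ 3 * discriminant τ₁) :
    ∃ γ : SL(2, ℤ), γ • τ₁ = τ₂ := by
  have hΔ1 := discriminant_ne_zero τ₁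
  have hΔ2 := discriminant_ne_zero τ₂
  obtain ⟨l, hl⟩ := IsAlgClosed.exists_pow_nat_eq (discriminant τ₂ / discriminant τ₁)
    (show 0 < 12 by norm_num)
  rw [eq_div_iff hΔ1] at hl
  have hl0 : l ≠ 0 := by
    rintro rfl; apply hΔ2; rw [← hl]; simp
  have h4 : E₄ τ₂ ^ 3 = (l ^ 4 * E₄ τ₁) ^ 3 := by
    apply mul_right_cancel₀ hΔ1; rw [← h, ← hl]; ring
  obtain ⟨l, hl, hl0, h4⟩ : ∃ m : ℂ, m ^ 12 * discriminant τ₁ = discriminant τ₂ ∧ m ≠ 0 ∧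
      E₄ τ₂ = m ^ 4 * E₄ τ₁ := by
    rcases eq_or_ne (E₄ τ₁) 0 with h0 | h0
    · exact ⟨l, hl, hl0, by rw [h0] at h4 ⊢; simpa using h4⟩
    · have hx : (E₄ τ₂ / (l ^ 4 * E₄ τ₁)) ^ 3 = 1 := by
        rw [div_pow, h4, div_self (by positivity)]
      set ξ := E₄ τ₂ / (l ^ 4 * E₄ τ₁) with hξ
      have hξ0 : ξ ≠ 0 := by rintro h; rw [h] at hx; simp at hx
      refine ⟨l * ξ, ?_, mul_ne_zero hl0 hξ0, ?_⟩
      · rw [mul_pow, show ξ ^ 12 = (ξ ^ 3) ^ 4 by ring, hx, ← hl]; ring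
      · rw [mul_pow, show ξ ^ 4 = ξ ^ 3 * ξ by ring, hx, hξ]
        field_simp
  have h6 : E₆ τ₂ ^ 2 = (l ^ 6 * E₆ τ₁) ^ 2 := by
    have e1 := discriminant_eq_E₄_cube_sub_E₆_sq τ₁
    have e2 := discriminant_eq_E₄_cube_sub_E₆_sq τ₂
    rw [← hl, e1, h4] at e2
    linear_combination 1728 * e2
  obtain ⟨l, hl0, h4, h6⟩ : ∃ m : ℂ, m ≠ 0 ∧ E₄ τ₂ = m ^ 4 * E₄ τ₁ ∧ E₆ τ₂ = m ^ 6 * E₆ τ₁ := by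
    rcases sq_eq_sq_iff_eq_or_eq_neg.mp h6 with h6 | h6
    · exact ⟨l, hl0, h4, h6⟩
    · refine ⟨Complex.I * l, mul_ne_zero Complex.I_ne_zero hl0, ?_, ?_⟩
      · rw [mul_pow, Complex.I_pow_four, one_mul, h4]
      · rw [mul_pow, show Complex.I ^ 6 = Complex.I ^ 4 * Complex.I ^ 2 by ring, Complex.I_pow_four,
          Complex.I_sq, h6]; ring
  exact exists_smul_eq_of_range_eq hl0
    (range_eq_of_tsum_eq hl0 fun k hk ↦ tsum_eisSummand_eq h4 h6 hk)

end

section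

/-- A holomorphic function bounded at infinity and invariant under `SL(2, ℤ)` as a modular form. -/
def toModularForm (k : ℤ) (f : ℍ → ℂ) (hinv : ∀ γ : SL(2, ℤ), f ∣[k] γ = f) (hd : MDiff f)
    (hb : IsBoundedAtImInfty f) : ModularForm 𝒮ℒ k where
  toFun := f
  slash_action_eq' := by
    rintro _ ⟨γ, rfl⟩
    exact hinv γ
  holo' := hd
  bdd_at_cusps' := fun {c} hc ↦ by
    rw [OnePoint.isBoundedAt_iff_forall_SL2Z hc]
    intro γ _
    rw [hinv γ]; exact hb

/-- A holomorphic function vanishing at infinity and invariant under `SL(2, ℤ)` as a cusp form. -/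
def toCuspForm (k : ℤ) (f : ℍ → ℂ) (hinv : ∀ γ : SL(2, ℤ), f ∣[k] γ = f) (hd : MDiff f)
    (hb : IsZeroAtImInfty f) : CuspForm 𝒮ℒ k where
  toFun := f
  slash_action_eq' := by
    rintro _ ⟨γ, rfl⟩
    exact hinv γ
  holo' := hd
  zero_at_cusps' := fun {c} hc ↦ by
    rw [OnePoint.isZeroAt_iff_forall_SL2Z hc]
    intro γ _
    rw [hinv γ]; exact hb

lemma levelOne_slash {k : ℤ} (f : ModularForm 𝒮ℒ k) (γ : SL(2, ℤ)) : (f : ℍ → ℂ) ∣[k] γ = f := by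
  rw [SL_slash]; exact slash_action_eqn f _ ⟨γ, rfl⟩

lemma periodic_levelOne {k : ℤ} (f : ModularForm 𝒮ℒ k) :
    Function.Periodic (f ∘ ofComplex) (1 : ℝ) :=
  periodic_comp_ofComplex f one_mem_strictPeriods_SL

lemma isBoundedAtImInfty_levelOne {k : ℤ} (f : ModularForm 𝒮ℒ k) : IsBoundedAtImInfty f := by
  have : Fact (IsCusp OnePoint.infty 𝒮ℒ) :=
    ⟨Subgroup.isCusp_of_mem_strictPeriods one_pos one_mem_strictPeriods_SL⟩
  exact bdd_at_infty f

/-- The derivative of a periodic function which is bounded at infinity vanishes at infinity. -/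
lemma isZeroAtImInfty_D {f : ℍ → ℂ} (hper : Function.Periodic (f ∘ ofComplex) (1 : ℝ))
    (hd : MDiff f) (hb : IsBoundedAtImInfty f) : IsZeroAtImInfty (D f) := by
  have han := analyticAt_cuspFunction_zero one_pos hper hd hb
  have heq : ∀ z : ℍ, D f z = Function.Periodic.qParam 1 z *
      deriv (cuspFunction 1 f) (Function.Periodic.qParam 1 z) := by
    intro z
    have hq1 : ‖Function.Periodic.qParam 1 (z : ℂ)‖ < 1 :=
      Function.Periodic.norm_qParam_lt_one one_pos z.im_pos
    have hdc := differentiableAt_cuspFunction one_pos hper hd hb hq1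
    have hq : HasDerivAt (Function.Periodic.qParam 1)
        (2 * Real.pi * Complex.I * Function.Periodic.qParam 1 z) (z : ℂ) := by
      unfold Function.Periodic.qParam
      have := (((hasDerivAt_id (z : ℂ)).const_mul (2 * Real.pi * Complex.I)).div_const
        ((1 : ℝ) : ℂ)).cexp
      refine this.congr_deriv ?_
      simp [mul_comm]
    have hcomp := hdc.hasDerivAt.comp (z : ℂ) hq
    have : f ∘ ofComplex =ᶠ[𝓝 (z : ℂ)] cuspFunction 1 f ∘ Function.Periodic.qParam 1 := by
      filter_upwards [isOpen_upperHalfPlaneSet.mem_nhds z.2] with w hw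
      have := eq_cuspFunction (⟨w, hw⟩ : ℍ) one_ne_zero hper
      simp only [Function.comp_apply, ofComplex_apply_of_im_pos hw]
      exact this.symm
    rw [normalizedDerivOfComplex, this.deriv_eq, hcomp.deriv]
    have : (2 * Real.pi * Complex.I : ℂ) ≠ 0 := Complex.two_pi_I_ne_zero
    field_simp
  have hlim : Tendsto (fun q : ℂ ↦ q * deriv (cuspFunction 1 f) q) (𝓝 0) (𝓝 0) := by
    have : ContinuousAt (fun q : ℂ ↦ q * deriv (cuspFunction 1 f) q) 0 :=
      continuousAt_id.mul han.deriv.continuousAt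
    simpa [ContinuousAt] using this
  refine (hlim.comp (qParam_tendsto_atImInfty one_pos)).congr fun z ↦ ?_
  rw [heq]; rfl

lemma isZeroAtImInfty_mul {f g : ℍ → ℂ} (hf : IsBoundedAtImInfty f) (hg : IsZeroAtImInfty g) :
    IsZeroAtImInfty (f * g) := hf.mul_zeroAtFilter hg

lemma mdifferentiable_E4 : MDiff (E₄ : ℍ → ℂ) := E₄.holo'

lemma mdifferentiable_E6 : MDiff (E₆ : ℍ → ℂ) := E₆.holo'

lemma mdifferentiable_discriminant : MDiff discriminant := CuspForm.discriminant.holo'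

lemma D_discriminant (z : ℍ) :
    1728 * D discriminant z = 3 * E₄ z ^ 2 * D E₄ z - 2 * E₆ z * D E₆ z := by
  have h : discriminant = (1 / 1728 : ℂ) • ((E₄ : ℍ → ℂ) ^ 3 - (E₆ : ℍ → ℂ) ^ 2) := by
    ext z; simp [discriminant_eq_E₄_cube_sub_E₆_sq]; ring
  rw [h, normalizedDerivOfComplex_smul _ _ ((mdifferentiable_E4.pow 3).sub (mdifferentiable_E6.pow 2)),
    normalizedDerivOfComplex_sub _ _ (mdifferentiable_E4.pow 3) (mdifferentiable_E6.pow 2),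
    normalizedDerivOfComplex_pow _ _ mdifferentiable_E4, normalizedDerivOfComplex_pow _ _ mdifferentiable_E6]
  simp

lemma tendsto_of_qExpansion_coeff {k : ℤ} (f : ModularForm 𝒮ℒ k) :
    Tendsto f atImInfty (𝓝 ((qExpansion 1 f).coeff 0)) := by
  have h := ModularFormClass.analyticAt_cuspFunction_zero f one_pos one_mem_strictPeriods_SL
  have h0 : (qExpansion 1 f).coeff 0 = cuspFunction 1 f 0 := by simp [qExpansion_coeff]
  rw [h0]
  refine (h.continuousAt.tendsto.comp (qParam_tendsto_atImInfty one_pos)).congr fun z ↦ ?_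
  exact eq_cuspFunction z one_ne_zero (periodic_levelOne f)

lemma tendsto_E4 : Tendsto E₄ atImInfty (𝓝 1) := by
  have := tendsto_of_qExpansion_coeff E₄
  rwa [E_qExpansion_coeff_zero _ ⟨2, rfl⟩] at this

lemma tendsto_E6 : Tendsto E₆ atImInfty (𝓝 1) := by
  have := tendsto_of_qExpansion_coeff E₆
  rwa [E_qExpansion_coeff_zero _ ⟨3, rfl⟩] at this

/-- The Rankin–Cohen bracket of `E₄` and `E₆` has no zeros. -/
theorem bracket_ne_zero (z : ℍ) : 2 * E₄ z * D E₆ z - 3 * E₆ z * D E₄ z ≠ 0 := by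
  set W : ℍ → ℂ := (2 : ℂ) • ((E₄ : ℍ → ℂ) * D E₆) - (3 : ℂ) • ((E₆ : ℍ → ℂ) * D E₄) with hW
  have hWs : W = (2 : ℂ) • ((E₄ : ℍ → ℂ) * serreDerivative (6 : ℤ) E₆) -
      (3 : ℂ) • ((E₆ : ℍ → ℂ) * serreDerivative (4 : ℤ) E₄) := by
    ext z; simp [hW]; ring
  have hinv : ∀ γ : SL(2, ℤ), W ∣[(12 : ℤ)] γ = W := by
    intro γ
    have h1 := serreDerivative_slash_invariant mdifferentiable_E6 (levelOne_slash E₆ γ)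
    have h2 := serreDerivative_slash_invariant mdifferentiable_E4 (levelOne_slash E₄ γ)
    have m1 := mul_slash_SL2 4 (6 + 2) γ E₄ (serreDerivative (6 : ℤ) E₆)
    have m2 := mul_slash_SL2 6 (4 + 2) γ E₆ (serreDerivative (4 : ℤ) E₄)
    rw [h1, levelOne_slash E₄ γ] at m1
    rw [h2, levelOne_slash E₆ γ] at m2
    rw [hWs, sub_eq_add_neg, SlashAction.add_slash, SlashAction.neg_slash, SL_smul_slash, SL_smul_slash,
      ← sub_eq_add_neg]
    exact congrArg₂ (fun a b : ℍ → ℂ ↦ (2 : ℂ) • a - (3 : ℂ) • b) m1 m2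
  have hDE4 := normalizedDerivOfComplex_mdifferentiable mdifferentiable_E4
  have hDE6 := normalizedDerivOfComplex_mdifferentiable mdifferentiable_E6
  have hd : MDiff W := ((mdifferentiable_E4.mul hDE6).const_smul _).sub ((mdifferentiable_E6.mul hDE4).const_smul _)
  have hz4 := isZeroAtImInfty_D (periodic_levelOne E₄) mdifferentiable_E4 (isBoundedAtImInfty_levelOne E₄)
  have hz6 := isZeroAtImInfty_D (periodic_levelOne E₆) mdifferentiable_E6 (isBoundedAtImInfty_levelOne E₆)
  have hz : IsZeroAtImInfty W := by
    have h1 := (isZeroAtImInfty_mul (isBoundedAtImInfty_levelOne E₄) hz6).const_mul (2 : ℂ)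
    have h2 := (isZeroAtImInfty_mul (isBoundedAtImInfty_levelOne E₆) hz4).const_mul (3 : ℂ)
    have h3 := h1.sub h2
    rw [mul_zero, mul_zero, sub_zero] at h3
    exact h3
  obtain ⟨c, hc⟩ := CuspForm.exists_smul_discriminant_of_weight_eq_twelve (toCuspForm 12 W hinv hd hz)
  have hWc : ∀ w, W w = c * discriminant w := fun w ↦ by
    have := congrArg (fun f : CuspForm 𝒮ℒ 12 ↦ f w) hc
    exact this.symm
  have hWz : 2 * E₄ z * D E₆ z - 3 * E₆ z * D E₄ z = W z := by simp [hW]; ring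
  rw [hWz, hWc]
  refine mul_ne_zero ?_ (discriminant_ne_zero z)
  rintro rfl
  -- the quotient `E₄ ^ 3 / Δ` would be constant
  have hconst : ∀ w, 3 * E₄ w ^ 2 * D E₄ w * discriminant w - E₄ w ^ 3 * D discriminant w = 0 := by
    intro w
    have e1 := D_discriminant w
    have e2 := discriminant_eq_E₄_cube_sub_E₆_sq w
    have e3 : 2 * E₄ w * D E₆ w - 3 * E₆ w * D E₄ w = 0 := by
      have := hWc w
      simp [hW] at this; linear_combination this
    rw [e2]
    linear_combination (-E₄ w ^ 3 / 1728) * e1 + (E₄ w ^ 2 * E₆ w / 1728) * e3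
  have hderiv : ∀ w ∈ upperHalfPlaneSet,
      deriv (fun w ↦ E₄ (ofComplex w) ^ 3 / discriminant (ofComplex w)) w = 0 := by
    intro w hw
    have d1 : DifferentiableAt ℂ (fun w ↦ E₄ (ofComplex w)) w :=
      (UpperHalfPlane.mdifferentiable_iff.mp mdifferentiable_E4).differentiableAt
        (isOpen_upperHalfPlaneSet.mem_nhds hw)
    have d2 : DifferentiableAt ℂ (fun w ↦ discriminant (ofComplex w)) w :=
      (UpperHalfPlane.mdifferentiable_iff.mp mdifferentiable_discriminant).differentiableAt
        (isOpen_upperHalfPlaneSet.mem_nhds hw)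
    have hh := hconst ⟨w, hw⟩
    have hne := discriminant_ne_zero (⟨w, hw⟩ : ℍ)
    have h2pi := Complex.two_pi_I_ne_zero
    simp only [normalizedDerivOfComplex] at hh
    rw [(((d1.hasDerivAt.fun_pow 3)).fun_div d2.hasDerivAt (discriminant_ne_zero _)).deriv]
    rw [ofComplex_apply_of_im_pos hw]
    rw [div_eq_zero_iff]; left
    have h3 : (2 * Real.pi * Complex.I : ℂ)⁻¹ * (3 * E₄ ⟨w, hw⟩ ^ 2 * deriv (E₄ ∘ ofComplex) w *
      discriminant ⟨w, hw⟩ - E₄ ⟨w, hw⟩ ^ 3 * deriv (discriminant ∘ ofComplex) w) = 0 := by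
      rw [← hh]; ring
    have := (mul_eq_zero.mp h3).resolve_left (inv_ne_zero h2pi)
    simp only [Function.comp_def] at this
    simpa using this
  have hdiff : DifferentiableOn ℂ (fun w ↦ E₄ (ofComplex w) ^ 3 / discriminant (ofComplex w))
      upperHalfPlaneSet :=
    ((UpperHalfPlane.mdifferentiable_iff.mp mdifferentiable_E4).pow 3).div
      (UpperHalfPlane.mdifferentiable_iff.mp mdifferentiable_discriminant)
      fun w _ ↦ discriminant_ne_zero _
  obtain ⟨a, ha⟩ := isOpen_upperHalfPlaneSet.exists_is_const_of_deriv_eq_zero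
    (convex_halfSpace_im_gt 0).isPreconnected hdiff hderiv
  have ha' : ∀ w : ℍ, E₄ w ^ 3 = a * discriminant w := by
    intro w
    have := ha w w.2
    simp only [ofComplex_apply] at this
    rw [div_eq_iff (discriminant_ne_zero w)] at this
    exact this
  have l1 := tendsto_E4.pow 3
  have l2 : Tendsto (fun w ↦ a * discriminant w) atImInfty (𝓝 (a * 0)) :=
    Tendsto.const_mul a discriminant_isZeroAtImInfty
  have := tendsto_nhds_unique (l1.congr ha') l2
  simp at this

end

section

/-- The factor of automorphy `cτ + d`. -/
def jf (γ : SL(2, ℤ)) (τ : ℍ) : ℂ := (γ 1 0 : ℂ) * τ + γ 1 1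

lemma jf_eq_denom (γ : SL(2, ℤ)) (τ : ℍ) : denom γ (τ : ℂ) = jf γ τ :=
  ModularGroup.denom_apply γ τ

lemma jf_ne_zero (γ : SL(2, ℤ)) (τ : ℍ) : jf γ τ ≠ 0 := by
  rw [← jf_eq_denom]; exact denom_ne_zero _ τ

lemma jf_mul (γ δ : SL(2, ℤ)) (τ : ℍ) : jf (γ * δ) τ = jf γ (δ • τ) * jf δ τ := by
  have h := denom_cocycle_σ (γ : GL (Fin 2) ℝ) (δ : GL (Fin 2) ℝ) τ
  have hc : denom ((γ * δ : SL(2, ℤ)) : GL (Fin 2) ℝ) (τ : ℂ) =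
      denom ((γ : GL (Fin 2) ℝ) * (δ : GL (Fin 2) ℝ)) (τ : ℂ) := by
    congr 2; simp
  rw [← jf_eq_denom, ← jf_eq_denom, ← jf_eq_denom, hc, h, ModularGroup.sl_moeb, σ, if_pos (by simp)]
  rfl

lemma jf_one (τ : ℍ) : jf 1 τ = 1 := by simp [jf]

lemma jf_neg (γ : SL(2, ℤ)) (τ : ℍ) : jf (-γ) τ = -jf γ τ := by
  simp [jf]; ring

lemma slash_apply_jf (k : ℤ) (f : ℍ → ℂ) (γ : SL(2, ℤ)) (τ : ℍ) :
    (f ∣[k] γ) τ = f (γ • τ) * jf γ τ ^ (-k) := by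
  rw [SL_slash_apply, jf_eq_denom]

lemma slash_eq_iff (k : ℤ) (f g : ℍ → ℂ) (γ : SL(2, ℤ)) :
    f ∣[k] γ = g ↔ ∀ τ, f (γ • τ) = jf γ τ ^ k * g τ := by
  rw [funext_iff]
  refine forall_congr' fun τ ↦ ?_
  have := zpow_ne_zero k (jf_ne_zero γ τ)
  rw [slash_apply_jf, zpow_neg, ← div_eq_mul_inv, div_eq_iff this, mul_comm]

/-- Modular forms for `SL(2, ℤ)` as functions. -/
structure IsLevelOne (k : ℤ) (f : ℍ → ℂ) : Prop where
  mdiff : MDiff f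
  smul : ∀ (γ : SL(2, ℤ)) (τ : ℍ), f (γ • τ) = jf γ τ ^ k * f τ
  bdd : IsBoundedAtImInfty f

lemma IsLevelOne.of_modularForm {k : ℤ} (f : ModularForm 𝒮ℒ k) : IsLevelOne k f where
  mdiff := f.holo'
  smul γ := (slash_eq_iff k f f γ).mp (levelOne_slash f γ)
  bdd := isBoundedAtImInfty_levelOne f

lemma IsLevelOne.E4 : IsLevelOne 4 E₄ := .of_modularForm E₄

lemma IsLevelOne.E6 : IsLevelOne 6 E₆ := .of_modularForm E₆

lemma IsLevelOne.mul {k l : ℤ} {f g : ℍ → ℂ} (hf : IsLevelOne k f) (hg : IsLevelOne l g) :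
    IsLevelOne (k + l) (f * g) where
  mdiff := hf.mdiff.mul hg.mdiff
  smul γ τ := by
    simp only [Pi.mul_apply, hf.smul, hg.smul, zpow_add₀ (jf_ne_zero γ τ)]; ring
  bdd := BoundedAtFilter.mul hf.bdd hg.bdd

lemma IsLevelOne.sub {k : ℤ} {f g : ℍ → ℂ} (hf : IsLevelOne k f) (hg : IsLevelOne k g) :
    IsLevelOne k (f - g) where
  mdiff := hf.mdiff.sub hg.mdiff
  smul γ τ := by simp only [Pi.sub_apply, hf.smul, hg.smul]; ring
  bdd := hf.bdd.sub hg.bdd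

lemma IsLevelOne.const_smul {k : ℤ} {f : ℍ → ℂ} (hf : IsLevelOne k f) (c : ℂ) :
    IsLevelOne k (c • f) where
  mdiff := hf.mdiff.const_smul c
  smul γ τ := by simp only [Pi.smul_apply, smul_eq_mul, hf.smul]; ring
  bdd := hf.bdd.const_smul_left c

lemma IsLevelOne.one : IsLevelOne 0 1 where
  mdiff := mdifferentiable_const
  smul γ τ := by simp
  bdd := Filter.const_boundedAtFilter _ 1

lemma IsLevelOne.pow {k : ℤ} {f : ℍ → ℂ} (hf : IsLevelOne k f) (n : ℕ) :
    IsLevelOne (n * k) (f ^ n) := by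
  induction n with
  | zero => simpa using IsLevelOne.one
  | succ n ih =>
    have := ih.mul hf
    rw [pow_succ]; convert this using 1; push_cast; ring

lemma IsLevelOne.discriminant : IsLevelOne 12 discriminant where
  mdiff := mdifferentiable_discriminant
  smul γ τ := by
    have h := (IsLevelOne.E4.pow 3).sub (IsLevelOne.E6.pow 2)
    have := h.smul γ τ
    simp only [discriminant_eq_E₄_cube_sub_E₆_sq]
    simp only [Pi.sub_apply, Pi.pow_apply] at this
    rw [this]; norm_num; ring
  bdd := by
    have : Tendsto ModularForm.discriminant atImInfty (𝓝 0) := discriminant_isZeroAtImInfty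
    exact this.isBigO_one ℝ

/-- Every even weight `≥ 4` is the weight of a monomial in `E₄` and `E₆`. -/
lemma exists_levelOne_monomial (n : ℕ) (hn : 2 ∣ n) :
    ∃ a b : ℕ, IsLevelOne (n + 4) ((E₄ : ℍ → ℂ) ^ a * (E₆ : ℍ → ℂ) ^ b) := by
  obtain ⟨m, rfl⟩ := hn
  obtain ⟨a, b, hab⟩ : ∃ a b : ℕ, m + 2 = 2 * a + 3 * b := by
    rcases Nat.even_or_odd' m with ⟨c, rfl | rfl⟩
    · exact ⟨c + 1, 0, by ring⟩
    · exact ⟨c, 1, by ring⟩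
  refine ⟨a, b, ?_⟩
  convert (IsLevelOne.E4.pow a).mul (IsLevelOne.E6.pow b) using 1
  push_cast
  have : (m : ℤ) + 2 = 2 * a + 3 * b := by exact_mod_cast hab
  linarith

lemma isPrimitiveRoot_I : IsPrimitiveRoot Complex.I 4 := by
  refine IsPrimitiveRoot.mk_of_lt _ (by norm_num) (by simp) fun l h0 h4 ↦ ?_
  interval_cases l <;> norm_num [Complex.ext_iff, pow_succ]

lemma isPrimitiveRoot_six {u : ℂ} (hu : u ^ 2 - u + 1 = 0) : IsPrimitiveRoot u 6 := by
  have h3 : u ^ 3 = -1 := by linear_combination (u + 1) * hu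
  refine IsPrimitiveRoot.mk_of_lt _ (by norm_num) (by linear_combination (u ^ 3 - 1) * h3)
    fun l h0 h4 h ↦ ?_
  interval_cases l
  · simp at h; subst h; norm_num at hu
  · have : u = 2 := by linear_combination h - hu
    subst this; norm_num at h
  · rw [h3] at h; norm_num at h
  · have : u = -1 := by linear_combination u * h3 - h
    subst this; norm_num at hu
  · have : u ^ 2 = -1 := by linear_combination u ^ 2 * h3 - h
    have : u = 0 := by linear_combination this - hu
    subst this; norm_num at h

/-- The `n`-th fold elliptic data at a point `τ`: an element of `SL(2, ℤ)` fixing `τ` whose factor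
of automorphy is a primitive `n`-th root of unity. -/
def IsEllipticOfOrder (n : ℕ) (τ : ℍ) : Prop :=
  ∃ γ : SL(2, ℤ), γ • τ = τ ∧ IsPrimitiveRoot (jf γ τ) n

lemma IsEllipticOfOrder.smul {n : ℕ} {τ : ℍ} (h : IsEllipticOfOrder n τ) (δ : SL(2, ℤ)) :
    IsEllipticOfOrder n (δ • τ) := by
  obtain ⟨γ, hγ, hn⟩ := h
  refine ⟨δ * γ * δ⁻¹, by simp [mul_smul, hγ, -ModularGroup.sl_moeb], ?_⟩
  have h1 : jf δ⁻¹ (δ • τ) * jf δ τ = 1 := by rw [← jf_mul]; simp [jf_one]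
  have : jf (δ * γ * δ⁻¹) (δ • τ) = jf γ τ := by
    rw [jf_mul, jf_mul, inv_smul_smul, hγ]
    linear_combination jf γ τ * h1
  rwa [this]

lemma S_smul_I : ModularGroup.S • (I : ℍ) = I :=
  ModularGroup.stabilizer_I.mpr (by simp)

lemma jf_S_I : jf ModularGroup.S I = Complex.I := by
  simp [jf, ModularGroup.S]

lemma isElliptic_I : IsEllipticOfOrder 4 I :=
  ⟨ModularGroup.S, S_smul_I, by rw [jf_S_I]; exact isPrimitiveRoot_I⟩

open ModularGroup in
lemma ST_smul_rho : (S * T) • (ρ : ℍ) = ρ :=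
  stabilizer_ρ.mpr (by simp)

open ModularGroup in
lemma jf_ST_rho : jf (S * T) ρ = ρ + 1 := by
  rw [jf]; simp [Matrix.mul_apply, Fin.sum_univ_two, coe_S, coe_T]

open ModularGroup in
lemma rho_sq : (ρ : ℂ) ^ 2 + ρ + 1 = 0 := by
  have h : (3 : ℝ) = √3 ^ 2 := by simp
  apply Complex.ext <;> simp [ρ, pow_two] <;> nlinarith

open ModularGroup in
lemma isPrimitiveRoot_jf_ST : IsPrimitiveRoot (jf (S * T) ρ) 6 := by
  rw [jf_ST_rho]
  exact isPrimitiveRoot_six (by linear_combination rho_sq)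

lemma isElliptic_rho : IsEllipticOfOrder 6 UpperHalfPlane.ρ :=
  ⟨_, ST_smul_rho, isPrimitiveRoot_jf_ST⟩

lemma isElliptic_two (τ : ℍ) : IsEllipticOfOrder 2 τ := by
  refine ⟨-1, by simp, ?_⟩
  rw [jf_neg, jf_one]
  exact IsPrimitiveRoot.neg_one 0 (by norm_num)

lemma E6_I : E₆ I = 0 := by
  have := IsLevelOne.E6.smul ModularGroup.S I
  rw [S_smul_I, jf_S_I] at this
  have h6 : Complex.I ^ (6 : ℤ) = -1 := by
    have : Complex.I ^ (6 : ℕ) = -1 := by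
      rw [show 6 = 2 * 3 by norm_num, pow_mul, Complex.I_sq]; norm_num
    exact_mod_cast this
  rw [h6] at this
  linear_combination this / 2

open ModularGroup in
lemma E4_rho : E₄ ρ = 0 := by
  have := IsLevelOne.E4.smul (S * T) ρ
  rw [ST_smul_rho, jf_ST_rho] at this
  have h4 : ((ρ : ℂ) + 1) ^ (4 : ℤ) = -ρ - 1 := by
    have : ((ρ : ℂ) + 1) ^ (4 : ℕ) = -ρ - 1 := by
      linear_combination ((ρ : ℂ) ^ 2 + 3 * ρ + 2) * rho_sq
    exact_mod_cast this
  rw [h4] at this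
  have h1 : ((ρ : ℂ) + 2) ≠ 0 := by
    intro h
    have := rho_sq
    have hh : (ρ : ℂ) = -2 := by linear_combination h
    rw [hh] at this; norm_num at this
  have : ((ρ : ℂ) + 2) * E₄ ρ = 0 := by linear_combination this
  exact (mul_eq_zero.mp this).resolve_left h1

lemma exists_smul_of_E6_eq_zero {τ₁ τ₂ : ℍ} (h₁ : E₆ τ₁ = 0) (h₂ : E₆ τ₂ = 0) :
    ∃ γ : SL(2, ℤ), γ • τ₁ = τ₂ := by
  refine exists_smul_eq_of_E4_cube ?_
  rw [discriminant_eq_E₄_cube_sub_E₆_sq, discriminant_eq_E₄_cube_sub_E₆_sq, h₁, h₂]; ring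

lemma exists_smul_of_E4_eq_zero {τ₁ τ₂ : ℍ} (h₁ : E₄ τ₁ = 0) (h₂ : E₄ τ₂ = 0) :
    ∃ γ : SL(2, ℤ), γ • τ₁ = τ₂ :=
  exists_smul_eq_of_E4_cube (by rw [h₁, h₂]; ring)

/-- At each point `τ₀` there is a form `h` with at most simple zeros, all equivalent to `τ₀`,
whose weight exceeds that of enough forms not vanishing at `τ₀`. -/
theorem exists_simple_zero_form (τ₀ : ℍ) : ∃ (w : ℤ) (h : ℍ → ℂ) (s : ℤ) (e : ℕ) (l : ℂ),
    IsLevelOne w h ∧ s < w ∧ l ≠ 0 ∧ Tendsto h atImInfty (𝓝 l) ∧ IsEllipticOfOrder e τ₀ ∧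
    (∀ z, h z = 0 → (∃ γ : SL(2, ℤ), γ • τ₀ = z) ∧ D h z ≠ 0) ∧
    ∀ n : ℕ, e ∣ n → ∃ p, IsLevelOne (n + s) p ∧ p τ₀ ≠ 0 := by
  by_cases h4 : E₄ τ₀ = 0
  · have h6 : E₆ τ₀ ≠ 0 := fun h6 ↦ discriminant_ne_zero τ₀ (by
      rw [discriminant_eq_E₄_cube_sub_E₆_sq, h4, h6]; ring)
    refine ⟨4, E₄, 0, 6, 1, .E4, by norm_num, one_ne_zero, tendsto_E4, ?_, fun z hz ↦
      ⟨exists_smul_of_E4_eq_zero h4 hz, fun hD ↦ bracket_ne_zero z (by rw [hz, hD]; ring)⟩, ?_⟩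
    · obtain ⟨γ, rfl⟩ := exists_smul_of_E4_eq_zero E4_rho h4
      exact isElliptic_rho.smul γ
    · rintro _ ⟨m, rfl⟩
      refine ⟨(E₆ : ℍ → ℂ) ^ m, ?_, pow_ne_zero _ h6⟩
      convert IsLevelOne.E6.pow m using 1; push_cast; ring
  by_cases h6 : E₆ τ₀ = 0
  · refine ⟨6, E₆, 0, 4, 1, .E6, by norm_num, one_ne_zero, tendsto_E6, ?_, fun z hz ↦
      ⟨exists_smul_of_E6_eq_zero h6 hz, fun hD ↦ bracket_ne_zero z (by rw [hz, hD]; ring)⟩, ?_⟩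
    · obtain ⟨γ, rfl⟩ := exists_smul_of_E6_eq_zero E6_I h6
      exact isElliptic_I.smul γ
    · rintro _ ⟨m, rfl⟩
      refine ⟨(E₄ : ℍ → ℂ) ^ m, ?_, pow_ne_zero _ h4⟩
      convert IsLevelOne.E4.pow m using 1; push_cast; ring
  set h : ℍ → ℂ := discriminant τ₀ • (E₄ : ℍ → ℂ) ^ 3 - E₄ τ₀ ^ 3 • discriminant with hh
  refine ⟨12, h, 4, 2, discriminant τ₀, ?_, by norm_num, discriminant_ne_zero _, ?_,
    isElliptic_two τ₀, fun z hz ↦ ?_, fun n hn ↦ ?_⟩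
  · exact ((IsLevelOne.E4.pow 3).const_smul _).sub (IsLevelOne.discriminant.const_smul _)
  · have h1 := ((tendsto_E4.pow 3).const_mul (discriminant τ₀)).sub
      (Tendsto.const_mul (E₄ τ₀ ^ 3) discriminant_isZeroAtImInfty)
    simpa using! h1
  · have hz' : discriminant τ₀ * E₄ z ^ 3 = E₄ τ₀ ^ 3 * discriminant z := by
      simpa [hh, sub_eq_zero] using hz
    obtain ⟨γ, rfl⟩ := exists_smul_eq_of_E4_cube (hz'.symm.trans (mul_comm _ _))
    refine ⟨⟨γ, rfl⟩, fun hD ↦ ?_⟩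
    have hb := bracket_ne_zero (γ • τ₀)
    have hE6 : E₆ (γ • τ₀) ≠ 0 := by
      rw [IsLevelOne.E6.smul]
      exact mul_ne_zero (zpow_ne_zero _ (jf_ne_zero _ _)) h6
    rw [hh, normalizedDerivOfComplex_sub _ _ ((mdifferentiable_E4.pow 3).const_smul _)
      (mdifferentiable_discriminant.const_smul _),
      normalizedDerivOfComplex_smul _ _ (mdifferentiable_E4.pow 3),
      normalizedDerivOfComplex_smul _ _ mdifferentiable_discriminant,
      normalizedDerivOfComplex_pow _ _ mdifferentiable_E4] at hD
    have e1 := D_discriminant (γ • τ₀)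
    have e2 := discriminant_eq_E₄_cube_sub_E₆_sq (γ • τ₀)
    generalize γ • τ₀ = z at *
    simp at hD
    refine mul_ne_zero (mul_ne_zero (pow_ne_zero 3 h4) hE6) hb ?_
    linear_combination 1728 * E₄ z * hD - 1728 * 3 * D E₄ z * hz'
      + E₄ τ₀ ^ 3 * E₄ z * e1 - 1728 * 3 * D E₄ z * E₄ τ₀ ^ 3 * e2
  · obtain ⟨a, b, hp⟩ := exists_levelOne_monomial n hn
    exact ⟨_, hp, mul_ne_zero (pow_ne_zero _ h4) (pow_ne_zero _ h6)⟩

end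

section

/-- Division of a holomorphic function on `ℍ` by one whose zeros are simple. -/
theorem exists_mdiff_eq_mul {g h : ℍ → ℂ} (hg : MDiff g) (hh : MDiff h)
    (hz : ∀ z, h z = 0 → g z = 0 ∧ D h z ≠ 0) : ∃ r : ℍ → ℂ, MDiff r ∧ g = h * r := by
  set r : ℍ → ℂ := fun z ↦ if h z = 0 then D g z / D h z else g z / h z with hr
  have hmul : g = h * r := by
    ext z
    by_cases h0 : h z = 0
    · simp [h0, (hz z h0).1]
    · simp [hr, h0, mul_div_cancel₀]
  refine ⟨r, ?_, hmul⟩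
  have hG := UpperHalfPlane.mdifferentiable_iff.mp hg
  have hH := UpperHalfPlane.mdifferentiable_iff.mp hh
  rw [UpperHalfPlane.mdifferentiable_iff]
  intro w hw
  have hnhds := isOpen_upperHalfPlaneSet.mem_nhds hw
  apply DifferentiableAt.differentiableWithinAt
  have hGw := hG.differentiableAt hnhds
  have hHw := hH.differentiableAt hnhds
  by_cases h0 : (h ∘ ofComplex) w = 0
  · have hz0 : h ⟨w, hw⟩ = 0 := by simpa [ofComplex_apply_of_im_pos hw] using h0
    obtain ⟨g0, d0⟩ := hz _ hz0
    have g0' : (g ∘ ofComplex) w = 0 := by simpa [ofComplex_apply_of_im_pos hw] using g0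
    have dG : DifferentiableAt ℂ (dslope (g ∘ ofComplex) w) w :=
      ((Complex.differentiableOn_dslope hnhds).mpr hG).differentiableAt hnhds
    have dH : DifferentiableAt ℂ (dslope (h ∘ ofComplex) w) w :=
      ((Complex.differentiableOn_dslope hnhds).mpr hH).differentiableAt hnhds
    have hd : deriv (h ∘ ofComplex) w ≠ 0 := by
      intro hd; apply d0; simp [normalizedDerivOfComplex, hd]
    have hne : dslope (h ∘ ofComplex) w w ≠ 0 := by rwa [dslope_same]
    refine (dG.div dH hne).congr_of_eventuallyEq ?_
    filter_upwards [hnhds, dH.continuousAt.eventually_ne hne] with v hv hvne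
    by_cases hvw : v = w
    · subst hvw
      simp [hr, ofComplex_apply_of_im_pos hw, hz0, normalizedDerivOfComplex]
      exact mul_div_mul_left _ _ (by simp)
    · have hs : v - w ≠ 0 := sub_ne_zero.mpr hvw
      simp only [dslope_of_ne _ hvw, slope_def_field, h0, sub_zero] at hvne ⊢
      have hv0 : h (ofComplex v) ≠ 0 := by
        intro hv0; apply hvne; simp [hv0]
      simp only [Pi.div_apply, dslope_of_ne _ hvw, slope_def_field, h0, g0', sub_zero,
        Function.comp_apply, hr, if_neg hv0]
      rw [div_div_div_cancel_right₀ hs]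
  · refine (hGw.div hHw h0).congr_of_eventuallyEq ?_
    filter_upwards [hHw.continuousAt.eventually_ne h0] with v hv
    simp only [Function.comp_apply] at hv
    simp [hr, hv]

lemma tendsto_of_periodic {f : ℍ → ℂ} (hper : ∀ τ : ℍ, f ((1 : ℝ) +ᵥ τ) = f τ) (hd : MDiff f)
    (hb : IsBoundedAtImInfty f) : ∃ l, Tendsto f atImInfty (𝓝 l) ∧
    ∃ l', Tendsto (fun τ : ℍ ↦ (f τ - l) / Complex.exp (2 * Real.pi * Complex.I * τ))
      atImInfty (𝓝 l') := by
  have hper' : Function.Periodic (f ∘ ofComplex) (1 : ℝ) := by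
    intro w
    by_cases hw : 0 < w.im
    · have hw' : 0 < (w + (1 : ℝ)).im := by simpa using hw
      have := hper ⟨w, hw⟩
      simp only [Function.comp_apply, ofComplex_apply_of_im_pos hw, ofComplex_apply_of_im_pos hw']
      rw [← this]; congr 1; ext; simp [add_comm]
    · have hw' : ¬ 0 < (w + (1 : ℝ)).im := by simpa using hw
      simp only [Function.comp_apply]
      rw [ofComplex_apply_of_im_nonpos (not_lt.mp hw), ofComplex_apply_of_im_nonpos (not_lt.mp hw')]
  have han := analyticAt_cuspFunction_zero one_pos hper' hd hb
  have heq (z : ℍ) : cuspFunction 1 f (Function.Periodic.qParam 1 z) = f z :=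
    eq_cuspFunction z one_ne_zero hper'
  refine ⟨cuspFunction 1 f 0, (han.continuousAt.tendsto.comp
    (qParam_tendsto_atImInfty one_pos)).congr heq, deriv (cuspFunction 1 f) 0, ?_⟩
  have hds : ContinuousAt (dslope (cuspFunction 1 f) 0) 0 :=
    continuousAt_dslope_same.mpr han.differentiableAt
  have h1 := hds.tendsto.comp (qParam_tendsto_atImInfty one_pos)
  rw [dslope_same] at h1
  refine h1.congr fun z ↦ ?_
  have hq : Function.Periodic.qParam 1 (z : ℂ) ≠ 0 := Complex.exp_ne_zero _
  rw [Function.comp_apply, dslope_of_ne _ hq, slope_def_field, heq, sub_zero]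
  simp [Function.Periodic.qParam]

end

section

lemma mdiff_sum {ι : Type*} (s : Finset ι) {f : ι → ℍ → ℂ} (hf : ∀ i ∈ s, MDiff (f i)) :
    MDiff (fun τ ↦ ∑ i ∈ s, f i τ) := by
  classical
  induction s using Finset.induction_on with
  | empty => simpa using mdifferentiable_const
  | insert a s ha ih =>
    simp only [Finset.sum_insert ha]
    exact (hf a (Finset.mem_insert_self a s)).add
      (ih fun i hi ↦ hf i (Finset.mem_insert_of_mem hi))

lemma mdiff_prod {ι : Type*} (s : Finset ι) {f : ι → ℍ → ℂ} (hf : ∀ i ∈ s, MDiff (f i)) :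
    MDiff (fun τ ↦ ∏ i ∈ s, f i τ) := by
  classical
  induction s using Finset.induction_on with
  | empty => simpa using mdifferentiable_const
  | insert a s ha ih =>
    simp only [Finset.prod_insert ha]
    exact (hf a (Finset.mem_insert_self a s)).mul
      (ih fun i hi ↦ hf i (Finset.mem_insert_of_mem hi))

lemma mdiff_div {f g : ℍ → ℂ} (hf : MDiff f) (hg : MDiff g) (h0 : ∀ τ, g τ ≠ 0) :
    MDiff (fun τ ↦ f τ / g τ) := by
  have hi : MDiff (fun τ ↦ (g τ)⁻¹) := fun τ ↦ (hg τ).inv (h0 τ)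
  simpa [div_eq_mul_inv] using! hf.mul hi

variable {n : Type} [Fintype n] [DecidableEq n]

lemma mdiff_det {A : ℍ → Matrix n n ℂ} (hA : ∀ i j, MDiff (fun τ ↦ A τ i j)) :
    MDiff (fun τ ↦ (A τ).det) := by
  simp only [Matrix.det_apply]
  refine mdiff_sum _ fun σ _ ↦ ?_
  have := (mdiff_prod Finset.univ fun i _ ↦ hA (σ i) i).const_smul (((σ.sign : ℤ) : ℂ))
  simpa [Units.smul_def] using! this

/-- Vector-valued modular forms for a representation of `SL(2, ℤ)`. -/
structure IsVForm (ρ : SL(2, ℤ) →* Matrix n n ℂ) (k : ℤ) (v : ℍ → n → ℂ) : Prop where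
  mdiff : ∀ j, MDiff (fun τ ↦ v τ j)
  smul : ∀ (γ : SL(2, ℤ)) (τ : ℍ), v (γ • τ) = jf γ τ ^ k • (ρ γ *ᵥ v τ)
  bdd : ∀ j, IsBoundedAtImInfty (fun τ ↦ v τ j)

/-- Vector-valued cusp forms for a representation of `SL(2, ℤ)`. -/
structure IsVCusp (ρ : SL(2, ℤ) →* Matrix n n ℂ) (k : ℤ) (v : ℍ → n → ℂ) : Prop where
  mdiff : ∀ j, MDiff (fun τ ↦ v τ j)
  smul : ∀ (γ : SL(2, ℤ)) (τ : ℍ), v (γ • τ) = jf γ τ ^ k • (ρ γ *ᵥ v τ)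
  zero : ∀ j, IsZeroAtImInfty (fun τ ↦ v τ j)

variable {ρ : SL(2, ℤ) →* Matrix n n ℂ}

omit [DecidableEq n] in
lemma tendsto_zero_of_bdd_mul {ι : Type*} {l : Filter ι} {f g : ι → ℂ}
    (hf : BoundedAtFilter l f) (hg : Tendsto g l (𝓝 0)) : Tendsto (fun x ↦ f x * g x) l (𝓝 0) :=
  BoundedAtFilter.mul_zeroAtFilter (f := f) (g := g) hf hg

lemma bdd_of_tendsto {ι : Type*} {l : Filter ι} {f : ι → ℂ} {a : ℂ}
    (hf : Tendsto f l (𝓝 a)) : BoundedAtFilter l f := hf.isBigO_one ℝ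

lemma bdd_sum {ι κ : Type*} {l : Filter ι} (s : Finset κ) {f : κ → ι → ℂ}
    (hf : ∀ i ∈ s, BoundedAtFilter l (f i)) : BoundedAtFilter l (fun x ↦ ∑ i ∈ s, f i x) :=
  IsBigO.fun_sum hf

lemma IsVCusp.isVForm {k : ℤ} {v : ℍ → n → ℂ} (hv : IsVCusp ρ k v) : IsVForm ρ k v where
  mdiff := hv.mdiff
  smul := hv.smul
  bdd j := bdd_of_tendsto (hv.zero j)

lemma IsVForm.slash_apply {k : ℤ} {v : ℍ → n → ℂ} (hv : IsVForm ρ k v) (γ : SL(2, ℤ)) (j : n) :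
    (fun τ ↦ v τ j) ∣[k] γ = fun τ ↦ ∑ l, ρ γ j l * v τ l := by
  rw [slash_eq_iff]
  intro τ
  rw [hv.smul]; simp [Matrix.mulVec, dotProduct]

lemma IsVForm.eq_zero_of_neg {N : ℕ} [NeZero N]
    (hρ : ∀ γ ∈ CongruenceSubgroup.Gamma N, ρ γ = 1) {k : ℤ} (hk : k < 0) {v : ℍ → n → ℂ}
    (hv : IsVForm ρ k v) : v = 0 := by
  have hone (γ : SL(2, ℤ)) (hγ : γ ∈ CongruenceSubgroup.Gamma N) (j : n) :
      (fun τ ↦ v τ j) ∣[k] γ = fun τ ↦ v τ j := by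
    rw [hv.slash_apply, hρ γ hγ]; ext τ; simp [Matrix.one_apply]
  let F (j : n) : ModularForm (CongruenceSubgroup.Gamma N) k :=
    { toFun := fun τ ↦ v τ j
      slash_action_eq' := by
        rintro _ ⟨γ, hγ, rfl⟩
        exact hone γ hγ j
      holo' := hv.mdiff j
      bdd_at_cusps' := fun {c} hc ↦ by
        have hc' : IsCusp c 𝒮ℒ :=
          (Subgroup.IsArithmetic.isCusp_iff_isCusp_SL2Z _).mp hc
        rw [OnePoint.isBoundedAt_iff_forall_SL2Z hc']
        intro γ _
        rw [hv.slash_apply]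
        exact bdd_sum _ fun l _ ↦ (hv.bdd l).const_mul_left _ }
  ext τ j
  have := ModularForm.isZero_of_neg_weight hk (F j)
  exact congrArg (fun f ↦ f τ) this

/-- The matrix with rows `f i τ`. -/
def rowMat (f : n → ℍ → n → ℂ) (τ : ℍ) : Matrix n n ℂ := Matrix.of fun i ↦ f i τ

/-- A family of vector-valued cusp forms which is generically a basis. -/
structure IsFull (ρ : SL(2, ℤ) →* Matrix n n ℂ) (k : n → ℤ) (f : n → ℍ → n → ℂ) : Prop where
  cusp : ∀ i, IsVCusp ρ (k i) (f i)
  det : ∃ τ, (rowMat f τ).det ≠ 0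

/-- A generic basis of minimal total weight. -/
structure IsMinimal (ρ : SL(2, ℤ) →* Matrix n n ℂ) (k : n → ℤ) (f : n → ℍ → n → ℂ) : Prop
    extends IsFull ρ k f where
  le : ∀ k' f', IsFull ρ k' f' → ∑ i, k i ≤ ∑ i, k' i

lemma IsFull.nonneg {N : ℕ} [NeZero N] (hρ : ∀ γ ∈ CongruenceSubgroup.Gamma N, ρ γ = 1)
    {k : n → ℤ} {f : n → ℍ → n → ℂ} (h : IsFull ρ k f) (i : n) : 0 ≤ k i := by
  by_contra! hk
  obtain ⟨τ, hτ⟩ := h.det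
  apply hτ
  refine Matrix.det_eq_zero_of_row_eq_zero i fun j ↦ ?_
  simp [rowMat, (h.cusp i).isVForm.eq_zero_of_neg hρ hk]

lemma exists_isMinimal {N : ℕ} [NeZero N] (hρ : ∀ γ ∈ CongruenceSubgroup.Gamma N, ρ γ = 1)
    {k : n → ℤ} {f : n → ℍ → n → ℂ} (h : IsFull ρ k f) : ∃ k' f', IsMinimal ρ k' f' := by
  classical
  have hex : ∃ m : ℕ, ∃ k' f', IsFull ρ k' f' ∧ ∑ i, k' i = m := by
    refine ⟨(∑ i, k i).toNat, k, f, h, ?_⟩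
    rw [Int.toNat_of_nonneg (Finset.sum_nonneg fun i _ ↦ h.nonneg hρ i)]
  obtain ⟨k', f', hf', hs⟩ := Nat.find_spec hex
  refine ⟨k', f', hf', fun k'' f'' h'' ↦ ?_⟩
  have hnn := Finset.sum_nonneg fun i (_ : i ∈ Finset.univ) ↦ h''.nonneg hρ i
  have := Nat.find_min' hex (m := (∑ i, k'' i).toNat)
    ⟨k'', f'', h'', by rw [Int.toNat_of_nonneg hnn]⟩
  rw [hs]; omega

omit [Fintype n] in
lemma rowMat_update (f : n → ℍ → n → ℂ) (i : n) (g : ℍ → n → ℂ) (τ : ℍ) :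
    rowMat (Function.update f i g) τ = (rowMat f τ).updateRow i (g τ) := by
  ext a b
  by_cases h : a = i
  · subst h; simp [rowMat]
  · simp [rowMat, h]

lemma mdiff_rowMat {k : n → ℤ} {f : n → ℍ → n → ℂ} (hf : ∀ i, IsVCusp ρ (k i) (f i)) :
    MDiff (fun τ ↦ (rowMat f τ).det) :=
  mdiff_det fun i j ↦ (hf i).mdiff j

/-- In a minimal generic basis, a form involving `f i₀` has weight at least that of `f i₀`. -/
theorem IsMinimal.le_of_mul_eq {k : n → ℤ} {f : n → ℍ → n → ℂ} (hf : IsMinimal ρ k f)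
    {k' : ℤ} {g : ℍ → n → ℂ} (hg : IsVCusp ρ k' g) (h : ℍ → ℂ) (p : n → ℍ → ℂ)
    (hgp : ∀ τ, h τ • g τ = ∑ i, p i τ • f i τ) (i₀ : n) (hp : MDiff (p i₀)) (hp0 : p i₀ ≠ 0) :
    k i₀ ≤ k' := by
  have hdet : (fun τ ↦ (rowMat f τ).det) ≠ 0 := by
    obtain ⟨τ, hτ⟩ := hf.det
    exact fun h0 ↦ hτ (congrFun h0 τ)
  have hne : p i₀ * (fun τ ↦ (rowMat f τ).det) ≠ 0 := by
    rw [Ne, UpperHalfPlane.mul_eq_zero_iff hp (mdiff_rowMat hf.cusp)]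
    tauto
  obtain ⟨τ, hτ⟩ := Function.ne_iff.mp hne
  have hfull : IsFull ρ (Function.update k i₀ k') (Function.update f i₀ g) := by
    refine ⟨fun i ↦ ?_, τ, fun h0 ↦ hτ ?_⟩
    · by_cases hi : i = i₀
      · subst hi; simpa using hg
      · simpa [hi] using hf.cusp i
    · rw [rowMat_update] at h0
      have h1 := Matrix.det_updateRow_sum (rowMat f τ) i₀ (fun i ↦ p i τ)
      have h2 : ∑ i, p i τ • (rowMat f τ) i = h τ • g τ := by rw [hgp]; rfl
      rw [h2, Matrix.det_updateRow_smul, h0] at h1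
      simpa using h1.symm
  have := hf.le _ _ hfull
  rw [Finset.sum_update_of_mem (Finset.mem_univ _), ← Finset.add_sum_erase _ _ (Finset.mem_univ i₀),
    ← Finset.sdiff_singleton_eq_erase] at this
  linarith

/-- Linear combination of vector-valued forms with level one coefficients. -/
lemma isVCusp_sum {k : n → ℤ} {f : n → ℍ → n → ℂ} (hf : ∀ i, IsVCusp ρ (k i) (f i)) {w : ℤ}
    {p : n → ℍ → ℂ} (hp : ∀ i, IsLevelOne (w - k i) (p i)) :
    IsVCusp ρ w (fun τ ↦ ∑ i, p i τ • f i τ) where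
  mdiff j := by
    simp only [Finset.sum_apply, Pi.smul_apply, smul_eq_mul]
    exact mdiff_sum _ fun i _ ↦ (hp i).mdiff.mul ((hf i).mdiff j)
  smul γ τ := by
    rw [Matrix.mulVec_sum, Finset.smul_sum]
    refine Finset.sum_congr rfl fun i _ ↦ ?_
    rw [(hp i).smul, (hf i).smul, Matrix.mulVec_smul, smul_smul, smul_smul, mul_right_comm,
      ← zpow_add₀ (jf_ne_zero γ τ), sub_add_cancel]
  zero j := by
    simp only [Finset.sum_apply, Pi.smul_apply, smul_eq_mul]
    have := tendsto_finsetSum Finset.univ fun i _ ↦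
      tendsto_zero_of_bdd_mul (hp i).bdd ((hf i).zero j)
    simpa using! this

lemma isLevelOne_zero (k : ℤ) : IsLevelOne k 0 := by
  simpa using! (IsLevelOne.of_modularForm (0 : ModularForm 𝒮ℒ k))

end

section

variable {n : Type} [Fintype n] [DecidableEq n] {ρ : SL(2, ℤ) →* Matrix n n ℂ}

lemma sum_zpow_of_isPrimitiveRoot {e : ℕ} {j : ℂ} (hj : IsPrimitiveRoot j e) (m : ℤ) :
    ∑ t ∈ Finset.range e, (j ^ m) ^ t = if (e : ℤ) ∣ m then (e : ℂ) else 0 := by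
  split_ifs with h
  · rw [(hj.zpow_eq_one_iff_dvd m).mpr h]; simp
  · have h1 : j ^ m ≠ 1 := fun h1 ↦ h ((hj.zpow_eq_one_iff_dvd m).mp h1)
    rw [geom_sum_eq h1, ← zpow_natCast, ← zpow_mul, mul_comm, zpow_mul, zpow_natCast, hj.pow_eq_one]
    simp

/-- A linear relation between values at an elliptic point is compatible with the residue classes
of the weights. -/
lemma sum_filter_eq_zero {k : n → ℤ} {f : n → ℍ → n → ℂ} (hf : ∀ i, IsVCusp ρ (k i) (f i))
    {e : ℕ} (he : 0 < e) {τ : ℍ} (hτ : IsEllipticOfOrder e τ) {c : n → ℂ}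
    (hc : ∑ i, c i • f i τ = 0) (K : ℤ) :
    ∑ i, (if (e : ℤ) ∣ K - k i then c i else 0) • f i τ = 0 := by
  obtain ⟨γ, hγ, hj⟩ := hτ
  set j := jf γ τ
  have hj0 : j ≠ 0 := jf_ne_zero γ τ
  have h1 (i : n) : ρ γ *ᵥ f i τ = j ^ (-k i) • f i τ := by
    have := (hf i).smul γ τ
    rw [hγ] at this
    conv_rhs => rw [this]
    rw [smul_smul, ← zpow_add₀ hj0]; simp
  have h2 (i : n) (t : ℕ) : (ρ γ) ^ t *ᵥ f i τ = (j ^ (-k i)) ^ t • f i τ := by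
    induction t with
    | zero => simp
    | succ t ih =>
      rw [pow_succ, ← Matrix.mulVec_mulVec, h1, Matrix.mulVec_smul, ih, smul_smul, pow_succ,
        mul_comm]
  have h3 (t : ℕ) : ∑ i, (c i * (j ^ (K - k i)) ^ t) • f i τ = 0 := by
    have : (j ^ K) ^ t • ((ρ γ) ^ t *ᵥ ∑ i, c i • f i τ) = 0 := by rw [hc]; simp
    rw [← this, Matrix.mulVec_sum, Finset.smul_sum]
    refine Finset.sum_congr rfl fun i _ ↦ ?_
    rw [Matrix.mulVec_smul, h2, smul_smul, smul_smul]
    congr 1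
    rw [sub_eq_add_neg, zpow_add₀ hj0, mul_pow]; ring
  have h4 : ∑ t ∈ Finset.range e, ∑ i, (c i * (j ^ (K - k i)) ^ t) • f i τ = 0 :=
    Finset.sum_eq_zero fun t _ ↦ h3 t
  rw [Finset.sum_comm] at h4
  simp only [← Finset.sum_smul, ← Finset.mul_sum, sum_zpow_of_isPrimitiveRoot hj] at h4
  have he' : (e : ℂ) ≠ 0 := by exact_mod_cast he.ne'
  have h5 : (e : ℂ)⁻¹ • ∑ i, (c i * if (e : ℤ) ∣ K - k i then (e : ℂ) else 0) • f i τ = 0 := by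
    rw [h4, smul_zero]
  rw [← h5, Finset.smul_sum]
  refine Finset.sum_congr rfl fun i _ ↦ ?_
  split_ifs
  · rw [smul_smul]; field_simp
  · simp

/-- Division of a vector-valued cusp form by a level one form. -/
lemma IsVCusp.exists_div {w K : ℤ} {h : ℍ → ℂ} (hh : IsLevelOne w h) {l : ℂ} (hl : l ≠ 0)
    (hlim : Tendsto h atImInfty (𝓝 l)) {g : ℍ → n → ℂ} (hg : IsVCusp ρ K g)
    (hz : ∀ z, h z = 0 → g z = 0 ∧ D h z ≠ 0) :
    ∃ r, IsVCusp ρ (K - w) r ∧ ∀ τ, h τ • r τ = g τ := by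
  have hex (j : n) : ∃ r : ℍ → ℂ, MDiff r ∧ (fun τ ↦ g τ j) = h * r :=
    exists_mdiff_eq_mul (hg.mdiff j) hh.mdiff fun z h0 ↦ ⟨by simp [(hz z h0).1], (hz z h0).2⟩
  choose r hr hgr using hex
  have hgr' (τ : ℍ) (j : n) : g τ j = h τ * r j τ := congrFun (hgr j) τ
  refine ⟨fun τ j ↦ r j τ, ⟨hr, fun γ τ ↦ ?_, fun j ↦ ?_⟩, fun τ ↦ ?_⟩
  · ext j
    have h0 : h * ((r j) ∣[K - w] γ - fun τ ↦ ∑ l, ρ γ j l * r l τ) = 0 := by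
      ext τ
      have h1 := congrFun (hg.smul γ τ) j
      have hj := jf_ne_zero γ τ
      simp only [Pi.smul_apply, Matrix.mulVec, dotProduct, hgr', hh.smul, smul_eq_mul] at h1
      have h2 : h τ * r j (γ • τ) = jf γ τ ^ (K - w) * ∑ l, ρ γ j l * (h τ * r l τ) := by
        rw [zpow_sub₀ hj, div_mul_eq_mul_div, eq_div_iff (zpow_ne_zero _ hj), ← h1]; ring
      have h3 : ∑ l, ρ γ j l * (h τ * r l τ) = h τ * ∑ l, ρ γ j l * r l τ := by
        rw [Finset.mul_sum]; exact Finset.sum_congr rfl fun _ _ ↦ by ring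
      rw [h3] at h2
      simp only [Pi.mul_apply, Pi.sub_apply, slash_apply_jf, Pi.zero_apply]
      rw [mul_sub, ← mul_assoc, h2, zpow_neg]
      have := zpow_ne_zero (K - w) hj
      field_simp
      ring
    have hne : h ≠ 0 := by
      rintro rfl
      exact hl (tendsto_nhds_unique hlim tendsto_const_nhds)
    have hs : MDiff ((r j) ∣[K - w] γ - fun τ ↦ ∑ l, ρ γ j l * r l τ) := by
      refine MDifferentiable.sub ?_ (mdiff_sum _ fun l _ ↦ (hr l).const_smul (ρ γ j l))
      exact MDifferentiable.slash (hr j) _ _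
    have h2 := ((UpperHalfPlane.mul_eq_zero_iff hh.mdiff hs).mp h0).resolve_left hne
    rw [sub_eq_zero, slash_eq_iff] at h2
    simpa [Matrix.mulVec, dotProduct] using h2 τ
  · have h1 := (hg.zero j).div hlim hl
    rw [zero_div] at h1
    refine Tendsto.congr' ?_ h1
    filter_upwards [hlim.eventually_ne hl] with τ hτ
    simp [hgr', hτ]
  · ext j; simp [hgr']

/-- A minimal generic basis is a basis at every point of the upper half plane. -/
theorem IsMinimal.det_ne_zero {k : n → ℤ} {f : n → ℍ → n → ℂ} (hf : IsMinimal ρ k f) (τ₀ : ℍ) :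
    (rowMat f τ₀).det ≠ 0 := by
  intro hdet
  obtain ⟨c, hc0, hc⟩ := Matrix.exists_vecMul_eq_zero_iff.mpr hdet
  have hc' : ∑ i, c i • f i τ₀ = 0 := by
    rw [← hc, Matrix.vecMul_eq_sum]; rfl
  obtain ⟨w, h, s, e, l, hh, hsw, hl, hlim, hell, hzero, hp⟩ := exists_simple_zero_form τ₀
  have he : 0 < e := by
    obtain ⟨γ, hγ, hj⟩ := hell
    by_contra! h0
    obtain rfl : e = 0 := by omega
    have := hj.pow_eq_one
    have hord := IsLevelOne.discriminant.smul γ τ₀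
    rw [hγ] at hord
    have h12 : jf γ τ₀ ^ (12 : ℤ) = 1 := by
      have := discriminant_ne_zero τ₀
      field_simp at hord
      exact hord.symm
    have := (hj.zpow_eq_one_iff_dvd 12).mp h12
    norm_num at this
  obtain ⟨i₁, hi₁⟩ := Function.ne_iff.mp hc0
  obtain ⟨i₀, hi₀, hmax⟩ := Finset.exists_max_image (Finset.univ.filter fun i ↦ c i ≠ 0) k
    ⟨i₁, by simpa using hi₁⟩
  have hi₀' : c i₀ ≠ 0 := by simpa using hi₀
  have hex (i : n) : ∃ p, IsLevelOne (k i₀ + s - k i) p ∧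
      p τ₀ = if (e : ℤ) ∣ k i₀ - k i then c i else 0 := by
    by_cases hi : (e : ℤ) ∣ k i₀ - k i ∧ c i ≠ 0
    · have hle := hmax i (by simpa using hi.2)
      obtain ⟨m, hm⟩ := Int.eq_ofNat_of_zero_le (sub_nonneg.mpr hle)
      obtain ⟨p, hpl, hp0⟩ := hp m (by rw [← Int.natCast_dvd_natCast, ← hm]; exact hi.1)
      refine ⟨(c i / p τ₀) • p, ?_, by simp [hi.1, hp0]⟩
      convert hpl.const_smul _ using 1
      rw [← hm]; ring
    · refine ⟨0, isLevelOne_zero _, ?_⟩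
      by_cases hi' : (e : ℤ) ∣ k i₀ - k i
      · have : c i = 0 := by tauto
        simp [this]
      · simp [hi']
  choose p hpl hp0 using hex
  have hg := isVCusp_sum hf.cusp hpl
  have hg0 : ∑ i, p i τ₀ • f i τ₀ = 0 := by
    simp only [hp0]
    exact sum_filter_eq_zero hf.cusp he hell hc' (k i₀)
  obtain ⟨r, hr, hrg⟩ := hg.exists_div hh hl hlim fun z hz ↦ by
    obtain ⟨⟨γ, rfl⟩, hD⟩ := hzero z hz
    refine ⟨?_, hD⟩
    rw [hg.smul, hg0]; simp
  have := hf.le_of_mul_eq hr h p hrg i₀ (hpl i₀).mdiff fun h0 ↦ by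
    have := hp0 i₀
    simp [h0] at this
    exact hi₀' this.symm
  linarith

end

section

variable {n : Type} [Fintype n] [DecidableEq n] {ρ : SL(2, ℤ) →* Matrix n n ℂ}

/-- The parameter `q = exp(2 π i τ)`. -/
def qq (τ : ℍ) : ℂ := Complex.exp (2 * Real.pi * Complex.I * τ)

lemma qq_ne_zero (τ : ℍ) : qq τ ≠ 0 := Complex.exp_ne_zero _

/-- A frame trivialising the action of `T` near the cusp at infinity, in which cusp forms are
those vector-valued forms with holomorphic coordinates in `q`. -/
structure CuspFrame (ρ : SL(2, ℤ) →* Matrix n n ℂ) (c : ℂ) where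
  frame : ℍ → Matrix n n ℂ
  inv : ℍ → Matrix n n ℂ
  mul_inv : ∀ τ, frame τ * inv τ = 1
  inv_vadd : ∀ τ : ℍ, inv ((1 : ℝ) +ᵥ τ) * ρ ModularGroup.T = inv τ
  mdiff_frame : ∀ i j, MDiff (fun τ ↦ frame τ i j)
  mdiff_inv : ∀ i j, MDiff (fun τ ↦ inv τ i j)
  zero : ∀ i j, IsZeroAtImInfty (fun τ ↦ frame τ i j)
  bdd : ∀ i j, IsBoundedAtImInfty (fun τ ↦ qq τ * inv τ i j)
  det : ∀ τ : ℍ, (frame τ).det = Complex.exp (2 * Real.pi * Complex.I * c * τ)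

variable {c : ℂ} (Φ : CuspFrame ρ c)

lemma vadd_eq_T_smul (τ : ℍ) : (1 : ℝ) +ᵥ τ = ModularGroup.T • τ := (modular_T_smul τ).symm

lemma jf_T (τ : ℍ) : jf ModularGroup.T τ = 1 := by simp [jf, ModularGroup.T]

lemma CuspFrame.inv_mulVec_vadd {k : ℤ} {v : ℍ → n → ℂ} (hv : IsVCusp ρ k v) (τ : ℍ) :
    Φ.inv ((1 : ℝ) +ᵥ τ) *ᵥ v ((1 : ℝ) +ᵥ τ) = Φ.inv τ *ᵥ v τ := by
  conv_lhs => rw [vadd_eq_T_smul τ, hv.smul, jf_T, one_zpow, one_smul, ← vadd_eq_T_smul,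
    Matrix.mulVec_mulVec, Φ.inv_vadd]

lemma CuspFrame.mdiff_inv_mulVec {k : ℤ} {v : ℍ → n → ℂ} (hv : IsVCusp ρ k v) (j : n) :
    MDiff (fun τ ↦ (Φ.inv τ *ᵥ v τ) j) :=
  mdiff_sum _ fun l _ ↦ (Φ.mdiff_inv j l).mul (hv.mdiff l)

lemma mdiff_qq : MDiff qq := by
  rw [UpperHalfPlane.mdifferentiable_iff]
  have : DifferentiableOn ℂ (fun z : ℂ ↦ Complex.exp (2 * Real.pi * Complex.I * z))
      upperHalfPlaneSet := by fun_prop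
  refine this.congr fun z hz ↦ ?_
  simp [qq, ofComplex_apply_of_im_pos hz]

lemma qq_vadd (τ : ℍ) : qq ((1 : ℝ) +ᵥ τ) = qq τ := by
  simp only [qq, coe_vadd, mul_add]
  rw [Complex.exp_add]; simp

theorem CuspFrame.exists_tendsto {k : ℤ} {v : ℍ → n → ℂ} (hv : IsVCusp ρ k v) (j : n) :
    ∃ l, Tendsto (fun τ ↦ (Φ.inv τ *ᵥ v τ) j) atImInfty (𝓝 l) := by
  have h0 : Tendsto (fun τ ↦ qq τ * (Φ.inv τ *ᵥ v τ) j) atImInfty (𝓝 0) := by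
    have : Tendsto (fun τ ↦ ∑ l, (qq τ * Φ.inv τ j l) * v τ l) atImInfty (𝓝 (∑ _l : n, 0)) :=
      tendsto_finsetSum Finset.univ fun l _ ↦ tendsto_zero_of_bdd_mul (Φ.bdd j l) (hv.zero l)
    rw [Finset.sum_const_zero] at this
    refine this.congr fun τ ↦ ?_
    simp only [Matrix.mulVec, dotProduct, Finset.mul_sum, mul_assoc]
  obtain ⟨l, hl, l', hl'⟩ := tendsto_of_periodic (f := fun τ ↦ qq τ * (Φ.inv τ *ᵥ v τ) j)
    (fun τ ↦ by rw [qq_vadd, Φ.inv_mulVec_vadd hv]) (mdiff_qq.mul (Φ.mdiff_inv_mulVec hv j))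
    (bdd_of_tendsto h0)
  obtain rfl := tendsto_nhds_unique hl h0
  refine ⟨l', hl'.congr fun τ ↦ ?_⟩
  rw [sub_zero]
  exact mul_div_cancel_left₀ _ (qq_ne_zero τ)

theorem CuspFrame.exists_tendsto_div {k : ℤ} {v : ℍ → n → ℂ} (hv : IsVCusp ρ k v) (j : n)
    (h0 : Tendsto (fun τ ↦ (Φ.inv τ *ᵥ v τ) j) atImInfty (𝓝 0)) :
    ∃ l, Tendsto (fun τ ↦ (Φ.inv τ *ᵥ v τ) j / qq τ) atImInfty (𝓝 l) := by
  obtain ⟨l, hl, l', hl'⟩ := tendsto_of_periodic (f := fun τ ↦ (Φ.inv τ *ᵥ v τ) j)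
    (fun τ ↦ by rw [Φ.inv_mulVec_vadd hv]) (Φ.mdiff_inv_mulVec hv j)
    (bdd_of_tendsto h0)
  obtain rfl := tendsto_nhds_unique hl h0
  exact ⟨l', by simpa [qq] using! hl'⟩

lemma qq_isBigO_discriminant : qq =O[atImInfty] discriminant := by
  refine IsBigO.trans (IsBigO.of_bound 1 (Eventually.of_forall fun τ ↦ ?_))
    exp_isBigO_discriminant
  simp [qq, Complex.norm_exp]

lemma discriminant_isBigO_qq : discriminant =O[atImInfty] qq := by
  refine IsBigO.trans (CuspFormClass.exp_decay_atImInfty (h := 1) CuspForm.discriminant one_pos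
    one_mem_strictPeriods_SL)
    (IsBigO.of_bound 1 (Eventually.of_forall fun τ ↦ ?_))
  simp [qq, Complex.norm_exp]

lemma bdd_qq_div_discriminant : IsBoundedAtImInfty (fun τ ↦ qq τ / discriminant τ) := by
  have := qq_isBigO_discriminant.mul (isBigO_refl (fun τ ↦ (discriminant τ)⁻¹) atImInfty)
  refine (this.congr_left fun τ ↦ (div_eq_mul_inv _ _).symm).trans ?_
  refine IsBigO.of_bound 1 (Eventually.of_forall fun τ ↦ ?_)
  simp [discriminant_ne_zero τ]

lemma bdd_discriminant_div_qq : IsBoundedAtImInfty (fun τ ↦ discriminant τ / qq τ) := by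
  have := discriminant_isBigO_qq.mul (isBigO_refl (fun τ ↦ (qq τ)⁻¹) atImInfty)
  refine (this.congr_left fun τ ↦ (div_eq_mul_inv _ _).symm).trans ?_
  refine IsBigO.of_bound 1 (Eventually.of_forall fun τ ↦ ?_)
  simp [qq_ne_zero τ]

/-- The leading coefficients of vector-valued cusp forms with respect to a frame. -/
def CuspFrame.IsLeading (f : n → ℍ → n → ℂ) (U : Matrix n n ℂ) : Prop :=
  ∀ i j, Tendsto (fun τ ↦ (Φ.inv τ *ᵥ f i τ) j) atImInfty (𝓝 (U i j))

lemma CuspFrame.exists_isLeading {k : n → ℤ} {f : n → ℍ → n → ℂ}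
    (hf : ∀ i, IsVCusp ρ (k i) (f i)) : ∃ U, Φ.IsLeading f U := by
  have := fun i j ↦ Φ.exists_tendsto (hf i) j
  choose U hU using this
  exact ⟨U, hU⟩

lemma IsFull.exists_ne_zero {k : n → ℤ} {f : n → ℍ → n → ℂ} (hf : IsFull ρ k f) (i : n) :
    ∃ τ, f i τ ≠ 0 := by
  obtain ⟨τ, hτ⟩ := hf.det
  refine ⟨τ, fun h0 ↦ hτ (Matrix.det_eq_zero_of_row_eq_zero i fun j ↦ ?_)⟩
  simp [rowMat, h0]

lemma IsFull.even_sub {k : n → ℤ} {f : n → ℍ → n → ℂ} (hf : IsFull ρ k f) {p : ℤ}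
    (hρ : ρ (-1) = (-1 : ℂ) ^ p • (1 : Matrix n n ℂ)) (i : n) : Even (p - k i) := by
  obtain ⟨τ, hτ⟩ := hf.exists_ne_zero i
  have h := (hf.cusp i).smul (-1) τ
  rw [hρ, jf_neg, jf_one, ModularGroup.SL_neg_smul, one_smul, Matrix.smul_mulVec, Matrix.one_mulVec,
    smul_smul, ← zpow_add₀ (by norm_num)] at h
  by_contra hodd
  rw [Int.not_even_iff_odd] at hodd
  have : Odd (k i + p) := by
    obtain ⟨m, hm⟩ := hodd
    exact ⟨m + k i, by lia⟩
  rw [this.neg_one_zpow] at h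
  apply hτ
  ext j
  have := congrFun h j
  simp at this
  simp only [Pi.zero_apply]
  linear_combination this / 2

/-- The leading coefficients of a minimal generic basis are linearly independent. -/
theorem IsMinimal.det_leading_ne_zero {k : n → ℤ} {f : n → ℍ → n → ℂ} (hf : IsMinimal ρ k f) {p : ℤ}
    (hρ : ρ (-1) = (-1 : ℂ) ^ p • (1 : Matrix n n ℂ)) {U : Matrix n n ℂ} (hU : Φ.IsLeading f U) :
    U.det ≠ 0 := by
  intro hdet
  obtain ⟨c, hc0, hc⟩ := Matrix.exists_vecMul_eq_zero_iff.mpr hdet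
  obtain ⟨i₁, hi₁⟩ := Function.ne_iff.mp hc0
  obtain ⟨i₀, hi₀, hmax⟩ := Finset.exists_max_image (Finset.univ.filter fun i ↦ c i ≠ 0) k
    ⟨i₁, by simpa using hi₁⟩
  have hi₀' : c i₀ ≠ 0 := by simpa using hi₀
  have hex (i : n) : ∃ p, IsLevelOne (k i₀ + 4 - k i) p ∧ Tendsto p atImInfty (𝓝 (c i)) := by
    by_cases hi : c i = 0
    · exact ⟨0, isLevelOne_zero _, by rw [hi]; exact tendsto_const_nhds⟩
    · have hle := hmax i (by simpa using hi)
      obtain ⟨m, hm⟩ := Int.eq_ofNat_of_zero_le (sub_nonneg.mpr hle)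
      have hev : Even (k i₀ - k i) := by
        have := (hf.even_sub hρ i).sub (hf.even_sub hρ i₀)
        rwa [sub_sub_sub_cancel_left] at this
      obtain ⟨a, b, hab⟩ := exists_levelOne_monomial m
        (by rw [hm] at hev; exact_mod_cast even_iff_two_dvd.mp hev)
      refine ⟨c i • _, IsLevelOne.const_smul (f := (E₄ : ℍ → ℂ) ^ a * (E₆ : ℍ → ℂ) ^ b) ?_ _, ?_⟩
      · convert hab using 1; rw [← hm]; ring
      · have := ((tendsto_E4.pow a).mul (tendsto_E6.pow b)).const_mul (c i)
        simpa using! this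
  choose q hql hqlim using hex
  have hg := isVCusp_sum hf.cusp hql
  set g : ℍ → n → ℂ := fun τ ↦ ∑ i, q i τ • f i τ with hgdef
  have hglim (j : n) : Tendsto (fun τ ↦ (Φ.inv τ *ᵥ g τ) j) atImInfty (𝓝 0) := by
    have h1 : Tendsto (fun τ ↦ ∑ i, q i τ * (Φ.inv τ *ᵥ f i τ) j) atImInfty
        (𝓝 (∑ i, c i * U i j)) :=
      tendsto_finsetSum Finset.univ fun i _ ↦ (hqlim i).mul (hU i j)
    have h2 : ∑ i, c i * U i j = 0 := congrFun hc j
    rw [h2] at h1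
    refine h1.congr fun τ ↦ ?_
    simp [hgdef, Matrix.mulVec_sum, Matrix.mulVec_smul]
  have hr : IsVCusp ρ (k i₀ + 4 - 12) (fun τ ↦ (discriminant τ)⁻¹ • g τ) := by
    refine ⟨fun j ↦ ?_, fun γ τ ↦ ?_, fun j ↦ ?_⟩
    · have := mdiff_div (hg.mdiff j) mdifferentiable_discriminant discriminant_ne_zero
      convert this using 2
      simp [div_eq_inv_mul]
    · rw [hg.smul, IsLevelOne.discriminant.smul, zpow_sub₀ (jf_ne_zero γ τ), Matrix.mulVec_smul,
        smul_smul, smul_smul]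
      congr 1
      rw [mul_inv]; ring
    · have h1 (l : n) : IsBoundedAtImInfty
          (fun τ ↦ (qq τ / discriminant τ) * ((Φ.inv τ *ᵥ g τ) l / qq τ)) := by
        obtain ⟨b, hb⟩ := Φ.exists_tendsto_div hg l (hglim l)
        exact BoundedAtFilter.mul bdd_qq_div_discriminant (bdd_of_tendsto hb)
      have h2 : Tendsto (fun τ ↦ ∑ l, ((qq τ / discriminant τ) * ((Φ.inv τ *ᵥ g τ) l / qq τ)) *
          Φ.frame τ j l) atImInfty (𝓝 (∑ _l : n, 0)) :=
        tendsto_finsetSum Finset.univ fun l _ ↦ tendsto_zero_of_bdd_mul (h1 l) (Φ.zero j l)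
      rw [Finset.sum_const_zero] at h2
      refine h2.congr fun τ ↦ ?_
      have h3 : g τ = Φ.frame τ *ᵥ (Φ.inv τ *ᵥ g τ) := by
        rw [Matrix.mulVec_mulVec, Φ.mul_inv, Matrix.one_mulVec]
      conv_rhs => rw [h3]
      generalize Φ.inv τ *ᵥ g τ = y
      simp only [Pi.smul_apply, smul_eq_mul, Matrix.mulVec, dotProduct, Finset.mul_sum]
      refine Finset.sum_congr rfl fun l _ ↦ ?_
      have := qq_ne_zero τ
      have := discriminant_ne_zero τ
      field_simp
  have := hf.le_of_mul_eq hr discriminant q (fun τ ↦ by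
    rw [smul_smul, mul_inv_cancel₀ (discriminant_ne_zero τ), one_smul]) i₀ (hql i₀).mdiff fun h0 ↦ by
      have := hqlim i₀
      rw [h0] at this
      exact hi₀' (tendsto_nhds_unique this tendsto_const_nhds)
  linarith

end

section

variable {n : Type} [Fintype n] [DecidableEq n]

/-- An idempotent matrix factors through its image. -/
theorem exists_factor_of_idempotent {E : Matrix n n ℂ} (hE : E * E = E) :
    ∃ (r : ℕ) (B : Matrix n (Fin r) ℂ) (A : Matrix (Fin r) n ℂ), B * A = E ∧ A * B = 1 ∧
      (r : ℂ) = E.trace := by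
  set L := Matrix.toLin' E with hL
  have hLL : L ∘ₗ L = L := by rw [hL, ← Matrix.toLin'_mul, hE]
  set b := Module.finBasis ℂ (LinearMap.range L)
  set i : (Fin _ → ℂ) →ₗ[ℂ] (n → ℂ) :=
    (LinearMap.range L).subtype ∘ₗ b.equivFun.symm.toLinearMap
  set p : (n → ℂ) →ₗ[ℂ] (Fin _ → ℂ) := b.equivFun.toLinearMap ∘ₗ L.rangeRestrict
  have h1 : i ∘ₗ p = L := by ext; simp [i, p]
  have h2 : p ∘ₗ i = LinearMap.id := by
    refine LinearMap.ext fun x ↦ ?_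
    have h3 (y : LinearMap.range L) : L.rangeRestrict (y : n → ℂ) = y := by
      obtain ⟨y, z, rfl⟩ := y
      exact Subtype.ext (LinearMap.congr_fun hLL z)
    change b.equivFun (L.rangeRestrict (b.equivFun.symm x : n → ℂ)) = x
    rw [h3, LinearEquiv.apply_symm_apply]
  have hBA : LinearMap.toMatrix' i * LinearMap.toMatrix' p = E := by
    rw [← LinearMap.toMatrix'_comp, h1, hL, LinearMap.toMatrix'_toLin']
  have hAB : LinearMap.toMatrix' p * LinearMap.toMatrix' i = 1 := by
    rw [← LinearMap.toMatrix'_comp, h2, LinearMap.toMatrix'_id]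
  refine ⟨_, LinearMap.toMatrix' i, LinearMap.toMatrix' p, hBA, hAB, ?_⟩
  rw [← hBA, Matrix.trace_mul_comm, hAB]
  simp

lemma sum_pow_eq_ite {N : ℕ} {u : ℂ} (hu : u ^ N = 1) :
    ∑ t ∈ Finset.range N, u ^ t = if u = 1 then (N : ℂ) else 0 := by
  split_ifs with h
  · simp [h]
  · have := mul_geom_sum u N
    rw [hu, sub_self] at this
    exact (mul_eq_zero.mp this).resolve_left (sub_ne_zero.mpr h)

/-- Spectral projections of a matrix of finite order. -/
theorem exists_spectral_projections {N : ℕ} (hN : N ≠ 0) {M : Matrix n n ℂ} (hM : M ^ N = 1)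
    (htr : ∀ t, 0 < t → t < N → (M ^ t).trace = 0) {ζ : ℂ} (hζ : IsPrimitiveRoot ζ N) :
    ∃ E : Fin N → Matrix n n ℂ, (∀ a b, E a * E b = if a = b then E b else 0) ∧
      (∑ a, E a = 1) ∧ (∀ a, E a * M = ζ ^ (a + 1 : ℕ) • E a) ∧
      ∀ a, (E a).trace = Fintype.card n / N := by
  have hN' : (N : ℂ) ≠ 0 := by exact_mod_cast hN
  have hζ0 : ζ ≠ 0 := hζ.ne_zero hN
  set z : Fin N → ℂ := fun a ↦ ζ ^ (a + 1 : ℕ)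
  have hz0 (a) : z a ≠ 0 := pow_ne_zero _ hζ0
  have hzN (a) : z a ^ N = 1 := by rw [← pow_mul, mul_comm, pow_mul, hζ.pow_eq_one, one_pow]
  have hinj {a b} (h : z a = z b) : a = b := by
    have : ζ ^ (a : ℕ) = ζ ^ (b : ℕ) := by
      simp only [z, pow_succ] at h
      exact mul_right_cancel₀ hζ0 h
    exact Fin.ext (hζ.pow_inj a.2 b.2 this)
  set E : Fin N → Matrix n n ℂ := fun a ↦
    (N : ℂ)⁻¹ • ∑ t ∈ Finset.range N, ((z a)⁻¹) ^ t • M ^ t with hE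
  have hME (a) : M * E a = z a • E a := by
    set P := (z a)⁻¹ • M with hP
    have h1 : E a = (N : ℂ)⁻¹ • ∑ t ∈ Finset.range N, P ^ t := by simp [hE, hP, smul_pow]
    have h2 : P * E a = E a := by
      have h3 := mul_geom_sum P N
      have h4 : P ^ N = 1 := by rw [hP, smul_pow, hM, inv_pow, hzN]; simp
      rw [h4, sub_self, sub_mul, one_mul, sub_eq_zero] at h3
      rw [h1, Matrix.mul_smul, h3]
    have h5 : M = z a • P := by rw [hP, smul_smul, mul_inv_cancel₀ (hz0 a), one_smul]
    conv_lhs => rw [h5, Matrix.smul_mul, h2]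
  have hEM (a) : E a * M = z a • E a := by
    rw [← hME]
    simp [hE, Finset.mul_sum, Finset.sum_mul, ← pow_succ, ← pow_succ']
  have hMpow (b) (t : ℕ) : M ^ t * E b = z b ^ t • E b := by
    induction t with
    | zero => simp
    | succ t ih => rw [pow_succ, mul_assoc, hME, Matrix.mul_smul, ih, smul_smul, pow_succ, mul_comm]
  refine ⟨E, fun a b ↦ ?_, ?_, hEM, fun a ↦ ?_⟩
  · have h1 : E a * E b = ((N : ℂ)⁻¹ * ∑ t ∈ Finset.range N, ((z a)⁻¹ * z b) ^ t) • E b := by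
      conv_lhs => rw [hE]
      simp only [Matrix.smul_mul, Finset.sum_mul]
      rw [mul_smul, Finset.sum_smul]
      congr 1
      refine Finset.sum_congr rfl fun t _ ↦ ?_
      rw [hMpow, smul_smul, mul_pow]
    rw [h1, sum_pow_eq_ite (by rw [mul_pow, inv_pow, hzN, hzN]; simp)]
    have h2 : (z a)⁻¹ * z b = 1 ↔ a = b := by
      rw [inv_mul_eq_one₀ (hz0 a)]
      exact ⟨hinj, fun h ↦ by rw [h]⟩
    simp only [h2]
    split_ifs <;> simp [hN']
  · have h1 (t : ℕ) (ht : t ∈ Finset.range N) :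
        ∑ a : Fin N, ((z a)⁻¹) ^ t = if t = 0 then (N : ℂ) else 0 := by
      have h2 (a : Fin N) : ((z a)⁻¹) ^ t = (ζ⁻¹ ^ t) * (ζ⁻¹ ^ t) ^ (a : ℕ) := by
        simp only [z, inv_pow, ← pow_mul, ← mul_inv, ← pow_add]
        congr 2; ring
      have h3 : ζ⁻¹ ^ t = 1 ↔ t = 0 := by
        rw [inv_pow, inv_eq_one]
        refine ⟨fun h ↦ ?_, fun h ↦ by simp [h]⟩
        have := (hζ.pow_eq_one_iff_dvd t).mp h
        exact Nat.eq_zero_of_dvd_of_lt this (Finset.mem_range.mp ht)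
      simp_rw [h2, ← Finset.mul_sum]
      rw [Fin.sum_univ_eq_sum_range (fun a ↦ (ζ⁻¹ ^ t) ^ a), sum_pow_eq_ite]
      · simp only [h3]
        split_ifs with h <;> simp [h]
      · rw [← pow_mul, mul_comm, pow_mul, inv_pow, hζ.pow_eq_one]; simp
    simp only [hE]
    rw [← Finset.smul_sum, Finset.sum_comm]
    simp_rw [← Finset.sum_smul]
    rw [Finset.sum_congr rfl fun t ht ↦ by rw [h1 t ht]]
    simp [ite_smul, hN', Nat.pos_of_ne_zero hN]
  · simp only [hE, Matrix.trace_smul, Matrix.trace_sum]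
    rw [Finset.sum_eq_single 0]
    · simp [div_eq_inv_mul]
    · intro t ht h0
      rw [htr t (Nat.pos_of_ne_zero h0) (Finset.mem_range.mp ht), smul_zero]
    · simp [Nat.pos_of_ne_zero hN]

/-- The determinant of a combination of complete orthogonal idempotents. -/
theorem det_sum_smul_idempotents {N : ℕ} {E : Fin N → Matrix n n ℂ}
    (hE : ∀ a b, E a * E b = if a = b then E b else 0) (h1 : ∑ a, E a = 1) :
    ∃ r : Fin N → ℕ, (∀ a, (r a : ℂ) = (E a).trace) ∧
      ∀ x : Fin N → ℂ, (∑ a, x a • E a).det = ∏ a, x a ^ r a := by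
  have hid (a) : E a * E a = E a := by simpa using hE a a
  choose r B A hBA hAB hr using fun a ↦ exists_factor_of_idempotent (hid a)
  refine ⟨r, hr, fun x ↦ ?_⟩
  let B' : Matrix n (Σ a, Fin (r a)) ℂ := .of fun i q ↦ B q.1 i q.2
  let A' : Matrix (Σ a, Fin (r a)) n ℂ := .of fun q i ↦ A q.1 q.2 i
  have hdiag (y : Fin N → ℂ) : B' * (Matrix.diagonal (fun q ↦ y q.1) :
      Matrix (Σ a, Fin (r a)) (Σ a, Fin (r a)) ℂ) * A' = ∑ a, y a • E a := by
    ext i j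
    rw [Matrix.mul_apply]
    simp_rw [Matrix.mul_diagonal]
    simp only [B', A', Matrix.of_apply, Fintype.sum_sigma, Matrix.sum_apply,
      Matrix.smul_apply, smul_eq_mul, ← hBA, Matrix.mul_apply, Finset.mul_sum]
    refine Finset.sum_congr rfl fun a _ ↦ Finset.sum_congr rfl fun b _ ↦ by ring
  have hBA' : B' * A' = 1 := by
    have := hdiag 1
    simpa [h1] using! this
  have hoff (a b) (h : a ≠ b) : A a * B b = 0 := by
    have h1 : A a = A a * E a := by rw [← hBA, ← Matrix.mul_assoc, hAB, Matrix.one_mul]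
    have h2 : B b = E b * B b := by rw [← hBA, Matrix.mul_assoc, hAB, Matrix.mul_one]
    rw [h1, h2, Matrix.mul_assoc, ← Matrix.mul_assoc (E a), hE, if_neg h]
    simp
  have hAB' : A' * B' = 1 := by
    ext ⟨a, i⟩ ⟨b, j⟩
    change (A a * B b) i j = _
    by_cases h : a = b
    · subst h
      rw [hAB]
      simp [Matrix.one_apply]
    · rw [hoff a b h, Matrix.one_apply_ne (by simp [h])]
      rfl
  rw [← hdiag, Matrix.det_conj_of_mul_eq_one hBA' hAB', Matrix.det_diagonal, Fintype.prod_sigma]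
  simp

/-- The function `exp(2 π i x τ)`. -/
def qpow (x : ℝ) (τ : ℍ) : ℂ := Complex.exp (2 * Real.pi * Complex.I * x * τ)

lemma mdiff_qpow (x : ℝ) : MDiff (qpow x) := by
  rw [UpperHalfPlane.mdifferentiable_iff]
  have : DifferentiableOn ℂ (fun z : ℂ ↦ Complex.exp (2 * Real.pi * Complex.I * x * z))
      upperHalfPlaneSet := by fun_prop
  refine this.congr fun z hz ↦ ?_
  simp [qpow, ofComplex_apply_of_im_pos hz]

lemma qpow_mul_qpow (x y : ℝ) (τ : ℍ) : qpow x τ * qpow y τ = qpow (x + y) τ := by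
  rw [qpow, qpow, qpow, ← Complex.exp_add]
  congr 1
  push_cast; ring

lemma qpow_zero (τ : ℍ) : qpow 0 τ = 1 := by simp [qpow]

lemma qq_eq_qpow (τ : ℍ) : qq τ = qpow 1 τ := by simp [qq, qpow]

lemma tendsto_qpow {x : ℝ} (hx : 0 < x) : Tendsto (qpow x) atImInfty (𝓝 0) := by
  refine (qParam_tendsto_atImInfty (inv_pos.mpr hx)).congr fun z ↦ ?_
  simp only [Function.Periodic.qParam, qpow]
  congr 1
  push_cast
  rw [div_inv_eq_mul]; ring

lemma qpow_vadd (x : ℝ) (τ : ℍ) :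
    qpow x ((1 : ℝ) +ᵥ τ) = Complex.exp (2 * Real.pi * Complex.I * x) * qpow x τ := by
  simp only [qpow, coe_vadd]
  rw [← Complex.exp_add]
  congr 1
  push_cast; ring

lemma bdd_qpow {x : ℝ} (hx : 0 ≤ x) : IsBoundedAtImInfty (qpow x) := by
  rcases hx.eq_or_lt with rfl | hx
  · refine bdd_of_tendsto (tendsto_const_nhds (x := (1 : ℂ)) |>.congr fun τ ↦ (qpow_zero τ).symm)
  · exact bdd_of_tendsto (tendsto_qpow hx)

/-- If the nontrivial powers of `ρ T` have vanishing trace, then the action of `T` can be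
trivialised with explicit determinant. -/
theorem exists_cuspFrame (ρ : SL(2, ℤ) →* Matrix n n ℂ) {N : ℕ} (hN : N ≠ 0)
    (hM : ρ ModularGroup.T ^ N = 1)
    (htr : ∀ t, 0 < t → t < N → (ρ ModularGroup.T ^ t).trace = 0) :
    Nonempty (CuspFrame ρ ((Fintype.card n * (N + 1) / (2 * N) : ℝ) : ℂ)) := by
  have hN' : (N : ℝ) ≠ 0 := by exact_mod_cast hN
  have hNC : (N : ℂ) ≠ 0 := by exact_mod_cast hN
  have hNpos : (0 : ℝ) < N := by positivity
  obtain ⟨E, hE, hsum, hEM, htrE⟩ := exists_spectral_projections hN hM htr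
    (Complex.isPrimitiveRoot_exp N hN)
  obtain ⟨r, hr, hdet⟩ := det_sum_smul_idempotents hE hsum
  set x : Fin N → ℝ := fun a ↦ ((a : ℕ) + 1 : ℝ) / N with hx
  have hxpos (a) : 0 < x a := by positivity
  have hxle (a) : x a ≤ 1 := by
    rw [hx]
    rw [div_le_one hNpos]
    exact_mod_cast a.2
  refine ⟨⟨fun τ ↦ ∑ a, qpow (x a) τ • E a, fun τ ↦ ∑ a, qpow (-x a) τ • E a, fun τ ↦ ?_,
    fun τ ↦ ?_, fun i j ↦ ?_, fun i j ↦ ?_, fun i j ↦ ?_, fun i j ↦ ?_, fun τ ↦ ?_⟩⟩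
  · simp only [Finset.sum_mul, Finset.mul_sum, Matrix.smul_mul, Matrix.mul_smul, hE]
    rw [← hsum]
    refine Finset.sum_congr rfl fun a _ ↦ ?_
    simp [smul_smul, qpow_mul_qpow, qpow_zero]
  · simp only [Finset.sum_mul, Matrix.smul_mul, hEM]
    refine Finset.sum_congr rfl fun a _ ↦ ?_
    rw [smul_smul, qpow_vadd, ← Complex.exp_nat_mul]
    congr 1
    rw [mul_right_comm, ← Complex.exp_add]
    convert one_mul _
    rw [Complex.exp_eq_one_iff]
    refine ⟨0, ?_⟩
    simp only [hx]
    push_cast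
    field_simp
    ring
  · simp only [Matrix.sum_apply, Matrix.smul_apply, smul_eq_mul]
    exact mdiff_sum _ fun a _ ↦ (mdiff_qpow _).mul mdifferentiable_const
  · simp only [Matrix.sum_apply, Matrix.smul_apply, smul_eq_mul]
    exact mdiff_sum _ fun a _ ↦ (mdiff_qpow _).mul mdifferentiable_const
  · have : Tendsto (fun τ ↦ ∑ a, qpow (x a) τ * E a i j) atImInfty (𝓝 (∑ a, 0 * E a i j)) :=
      tendsto_finsetSum _ fun a _ ↦ (tendsto_qpow (hxpos a)).mul_const _
    simpa [IsZeroAtImInfty, ZeroAtFilter, Matrix.sum_apply] using! this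
  · have h1 (τ : ℍ) : qq τ * (∑ a, qpow (-x a) τ • E a) i j =
        ∑ a, qpow (1 - x a) τ * E a i j := by
      simp only [Matrix.sum_apply, Matrix.smul_apply, smul_eq_mul, Finset.mul_sum, ← mul_assoc,
        qq_eq_qpow, qpow_mul_qpow, sub_eq_add_neg]
    simp only [h1]
    exact bdd_sum _ fun a _ ↦ BoundedAtFilter.mul (bdd_qpow (sub_nonneg.mpr (hxle a)))
      (Filter.const_boundedAtFilter _ _)
  · rw [hdet]
    simp only [qpow, ← Complex.exp_nat_mul]
    rw [← Complex.exp_sum]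
    congr 1
    simp only [hr, htrE, hx]
    have h1 : ∑ a : Fin N, ((a : ℕ) + 1 : ℂ) = N * (N + 1) / 2 := by
      rw [Fin.sum_univ_eq_sum_range (fun a ↦ (a + 1 : ℂ))]
      clear * -
      induction N with
      | zero => simp
      | succ m ih => rw [Finset.sum_range_succ, ih]; push_cast; ring
    calc _ = (∑ a : Fin N, ((a : ℕ) + 1 : ℂ)) *
          (Fintype.card n / N * (2 * Real.pi * Complex.I) / N * τ) := by
          rw [Finset.sum_mul]
          refine Finset.sum_congr rfl fun a _ ↦ ?_
          push_cast
          ring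
      _ = _ := by
          rw [h1]
          push_cast
          field_simp

end

section

variable {n : Type} [Fintype n] [DecidableEq n] {ρ : SL(2, ℤ) →* Matrix n n ℂ} {c : ℝ}

/-- A family of vector-valued cusp forms which is a basis everywhere, including at the cusp. -/
structure IsFree (Φ : CuspFrame ρ c) (k : n → ℤ) (f : n → ℍ → n → ℂ) : Prop where
  cusp : ∀ i, IsVCusp ρ (k i) (f i)
  det : ∀ τ, (rowMat f τ).det ≠ 0
  lead : ∃ U : Matrix n n ℂ, Φ.IsLeading f U ∧ U.det ≠ 0

theorem IsMinimal.isFree {k : n → ℤ} {f : n → ℍ → n → ℂ} (hf : IsMinimal ρ k f) {p : ℤ}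
    (hρ : ρ (-1) = (-1 : ℂ) ^ p • (1 : Matrix n n ℂ)) (Φ : CuspFrame ρ c) : IsFree Φ k f := by
  obtain ⟨U, hU⟩ := Φ.exists_isLeading hf.cusp
  exact ⟨hf.cusp, hf.det_ne_zero, U, hU, hf.det_leading_ne_zero Φ hρ hU⟩

namespace IsFree

variable {Φ : CuspFrame ρ c} {k : n → ℤ} {f : n → ℍ → n → ℂ}

lemma rowMat_smul (hf : ∀ i, IsVCusp ρ (k i) (f i)) (γ : SL(2, ℤ)) (τ : ℍ) :
    rowMat f (γ • τ) = Matrix.diagonal (fun i ↦ jf γ τ ^ k i) * rowMat f τ * (ρ γ)ᵀ := by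
  ext i j
  rw [Matrix.mul_assoc, Matrix.diagonal_mul]
  simp only [rowMat, Matrix.of_apply, (hf i).smul, Pi.smul_apply, smul_eq_mul, Matrix.mulVec,
    dotProduct, Matrix.mul_apply, Matrix.transpose_apply]
  congr 1
  exact Finset.sum_congr rfl fun _ _ ↦ mul_comm _ _

lemma inv_mul (hf : IsFree Φ k f) (τ : ℍ) : (rowMat f τ)⁻¹ * rowMat f τ = 1 :=
  Matrix.nonsing_inv_mul _ (isUnit_iff_ne_zero.mpr (hf.det τ))

lemma mul_inv (hf : IsFree Φ k f) (τ : ℍ) : rowMat f τ * (rowMat f τ)⁻¹ = 1 :=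
  Matrix.mul_nonsing_inv _ (isUnit_iff_ne_zero.mpr (hf.det τ))

lemma map_mul_inv (γ : SL(2, ℤ)) : ρ γ * ρ γ⁻¹ = 1 := by
  rw [← map_mul, mul_inv_cancel, map_one]

lemma inv_smul (hf : IsFree Φ k f) (γ : SL(2, ℤ)) (τ : ℍ) :
    (rowMat f (γ • τ))⁻¹ =
      (ρ γ⁻¹)ᵀ * (rowMat f τ)⁻¹ * Matrix.diagonal (fun i ↦ jf γ τ ^ (-k i)) := by
  refine Matrix.inv_eq_left_inv ?_
  rw [rowMat_smul hf.cusp]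
  have h1 : Matrix.diagonal (fun i ↦ jf γ τ ^ (-k i)) * Matrix.diagonal (fun i ↦ jf γ τ ^ k i) =
      1 := by
    rw [Matrix.diagonal_mul_diagonal, ← Matrix.diagonal_one]
    congr 1
    ext i
    rw [← zpow_add₀ (jf_ne_zero γ τ)]; simp
  calc _ = (ρ γ⁻¹)ᵀ * ((rowMat f τ)⁻¹ * (Matrix.diagonal (fun i ↦ jf γ τ ^ (-k i)) *
        Matrix.diagonal (fun i ↦ jf γ τ ^ k i)) * rowMat f τ) * (ρ γ)ᵀ := by
        simp only [Matrix.mul_assoc]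
    _ = 1 := by
        rw [h1, Matrix.mul_one, hf.inv_mul, Matrix.mul_one, ← Matrix.transpose_mul, map_mul_inv,
          Matrix.transpose_one]

/-- The trace of the representation at an elliptic fixed point. -/
theorem trace_eq (hf : IsFree Φ k f) {γ : SL(2, ℤ)} {τ : ℍ} (hγ : γ • τ = τ) :
    (ρ γ).trace = ∑ i, jf γ τ ^ (-k i) := by
  have h := rowMat_smul hf.cusp γ τ
  rw [hγ] at h
  have h1 : Matrix.diagonal (fun i ↦ jf γ τ ^ (-k i)) * rowMat f τ = rowMat f τ * (ρ γ)ᵀ := by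
    conv_lhs => rw [h]
    rw [Matrix.mul_assoc, ← Matrix.mul_assoc, Matrix.diagonal_mul_diagonal]
    have : (fun i ↦ jf γ τ ^ (-k i) * jf γ τ ^ k i) = 1 := by
      ext i
      rw [← zpow_add₀ (jf_ne_zero γ τ)]; simp
    rw [this]
    simp
  have h2 : (ρ γ)ᵀ =
      (rowMat f τ)⁻¹ * (Matrix.diagonal (fun i ↦ jf γ τ ^ (-k i)) * rowMat f τ) := by
    rw [h1, ← Matrix.mul_assoc, hf.inv_mul, Matrix.one_mul]
  rw [← Matrix.trace_transpose, h2, Matrix.trace_mul_comm, Matrix.mul_assoc, hf.mul_inv,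
    Matrix.mul_one, Matrix.trace_diagonal]

lemma mdiff_inv (hf : IsFree Φ k f) (i j : n) : MDiff (fun τ ↦ (rowMat f τ)⁻¹ i j) := by
  have h1 (τ : ℍ) : (rowMat f τ)⁻¹ i j = (rowMat f τ).adjugate i j / (rowMat f τ).det := by
    rw [Matrix.inv_def, Matrix.smul_apply, Ring.inverse_eq_inv', smul_eq_mul, div_eq_inv_mul]
  simp only [h1]
  refine mdiff_div ?_ (mdiff_rowMat hf.cusp) hf.det
  simp only [Matrix.adjugate_apply]
  refine mdiff_det fun a b ↦ ?_
  by_cases h : a = j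
  · subst h
    simp only [Matrix.updateRow_self]
    exact mdifferentiable_const
  · simp only [Matrix.updateRow_ne h]
    exact (hf.cusp a).mdiff b

lemma rowMat_mul_inv_apply (f : n → ℍ → n → ℂ) (τ : ℍ) (i j : n) :
    (rowMat f τ * (Φ.inv τ)ᵀ) i j = (Φ.inv τ *ᵥ f i τ) j := by
  simp [Matrix.mul_apply, rowMat, Matrix.mulVec, dotProduct, mul_comm]

lemma rowMat_eq (f : n → ℍ → n → ℂ) (τ : ℍ) :
    rowMat f τ = rowMat f τ * (Φ.inv τ)ᵀ * (Φ.frame τ)ᵀ := by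
  rw [Matrix.mul_assoc, ← Matrix.transpose_mul, Φ.mul_inv, Matrix.transpose_one, Matrix.mul_one]

lemma tendsto_rowMat {U : Matrix n n ℂ} (hU : Φ.IsLeading f U) :
    Tendsto (fun τ ↦ rowMat f τ * (Φ.inv τ)ᵀ) atImInfty (𝓝 U) :=
  tendsto_pi_nhds.mpr fun i ↦ tendsto_pi_nhds.mpr fun j ↦
    (hU i j).congr fun τ ↦ (rowMat_mul_inv_apply f τ i j).symm

lemma inv_eq (hf : IsFree Φ k f) (τ : ℍ) :
    (rowMat f τ)⁻¹ = (Φ.inv τ)ᵀ * (rowMat f τ * (Φ.inv τ)ᵀ)⁻¹ := by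
  have h : (rowMat f τ * (Φ.inv τ)ᵀ).det ≠ 0 := by
    intro h0
    apply hf.det τ
    rw [rowMat_eq (Φ := Φ) f τ, Matrix.det_mul, h0, zero_mul]
  refine Matrix.inv_eq_right_inv ?_
  rw [← Matrix.mul_assoc, Matrix.mul_nonsing_inv _ (isUnit_iff_ne_zero.mpr h)]

lemma tendsto_inv {U : Matrix n n ℂ} (hU : Φ.IsLeading f U) (hdet : U.det ≠ 0) (i j : n) :
    Tendsto (fun τ ↦ (rowMat f τ * (Φ.inv τ)ᵀ)⁻¹ i j) atImInfty (𝓝 (U⁻¹ i j)) := by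
  have h1 : ContinuousAt (fun A : Matrix n n ℂ ↦ A⁻¹ i j) U := by
    have h2 (A : Matrix n n ℂ) : A⁻¹ i j = A.adjugate i j / A.det := by
      rw [Matrix.inv_def, Matrix.smul_apply, Ring.inverse_eq_inv', smul_eq_mul, div_eq_inv_mul]
    simp only [h2]
    exact ((continuous_id.matrix_adjugate.matrix_elem i j).continuousAt).div
      continuous_id.matrix_det.continuousAt hdet
  exact h1.tendsto.comp (tendsto_rowMat hU)

/-- The weights of a free basis of cusp forms are at most `12`. -/
theorem weight_le (hf : IsFree Φ k f) {N : ℕ} [NeZero N]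
    (hρ : ∀ γ ∈ CongruenceSubgroup.Gamma N, ρ γ = 1) (i : n) : k i ≤ 12 := by
  by_contra! hlt
  obtain ⟨U, hU, hdet⟩ := hf.lead
  let ρ' : SL(2, ℤ) →* Matrix n n ℂ :=
    { toFun := fun γ ↦ (ρ γ⁻¹)ᵀ
      map_one' := by simp
      map_mul' := fun γ δ ↦ by rw [mul_inv_rev, map_mul, Matrix.transpose_mul] }
  have hv : IsVForm ρ' (12 - k i) (fun τ l ↦ discriminant τ * (rowMat f τ)⁻¹ l i) := by
    refine ⟨fun j ↦ mdifferentiable_discriminant.mul (hf.mdiff_inv j i), fun γ τ ↦ ?_, fun j ↦ ?_⟩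
    · ext l
      rw [hf.inv_smul, Matrix.mul_diagonal, IsLevelOne.discriminant.smul, Matrix.mul_apply,
        sub_eq_add_neg, zpow_add₀ (jf_ne_zero γ τ)]
      simp only [Pi.smul_apply, smul_eq_mul, Matrix.mulVec, dotProduct, ρ', MonoidHom.coe_mk,
        OneHom.coe_mk, Finset.mul_sum, Finset.sum_mul]
      exact Finset.sum_congr rfl fun _ _ ↦ by ring
    · have h1 (τ : ℍ) : discriminant τ * (rowMat f τ)⁻¹ j i =
          ∑ m, ((discriminant τ / qq τ) * (qq τ * Φ.inv τ m j)) *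
            (rowMat f τ * (Φ.inv τ)ᵀ)⁻¹ m i := by
        rw [hf.inv_eq, Matrix.mul_apply, Finset.mul_sum]
        refine Finset.sum_congr rfl fun m _ ↦ ?_
        have := qq_ne_zero τ
        rw [Matrix.transpose_apply]
        field_simp
      simp only [h1]
      exact bdd_sum _ fun m _ ↦ BoundedAtFilter.mul (BoundedAtFilter.mul bdd_discriminant_div_qq
        (Φ.bdd m j)) (bdd_of_tendsto (tendsto_inv hU hdet m i))
  have h0 := hv.eq_zero_of_neg (N := N) (fun γ hγ ↦ by
    change (ρ γ⁻¹)ᵀ = 1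
    rw [hρ _ (inv_mem hγ), Matrix.transpose_one]) (by lia)
  have h1 := hf.mul_inv UpperHalfPlane.I
  have h2 : (rowMat f UpperHalfPlane.I * (rowMat f UpperHalfPlane.I)⁻¹) i i = 0 := by
    rw [Matrix.mul_apply]
    refine Finset.sum_eq_zero fun l _ ↦ ?_
    have := congrFun (congrFun h0 UpperHalfPlane.I) l
    simp only [Pi.zero_apply, mul_eq_zero, discriminant_ne_zero, false_or] at this
    rw [this, mul_zero]
  rw [h1] at h2
  simp at h2

end IsFree

lemma false_of_tendsto_zero {φ : ℍ → ℂ} (hd : MDiff φ)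
    (hinv : ∀ (γ : SL(2, ℤ)) (τ : ℍ), φ (γ • τ) = φ τ) (hne : ∀ τ, φ τ ≠ 0)
    (h0 : Tendsto φ atImInfty (𝓝 0)) : False := by
  have hinv' (γ : SL(2, ℤ)) : φ ∣[(0 : ℤ)] γ = φ := by
    rw [slash_eq_iff]; intro τ; rw [hinv]; simp
  obtain ⟨c, hc⟩ := levelOne_weight_zero_const
    (toModularForm 0 φ hinv' hd (bdd_of_tendsto h0))
  have hc' : φ = Function.const _ c := hc
  rw [hc'] at h0
  have : c = 0 := tendsto_nhds_unique tendsto_const_nhds h0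
  exact hne UpperHalfPlane.I (by rw [hc', this]; rfl)

lemma mdiff_pow {f : ℍ → ℂ} (hf : MDiff f) (m : ℕ) : MDiff (fun τ ↦ f τ ^ m) := by
  simpa using mdiff_prod (Finset.range m) fun _ _ ↦ hf

lemma bdd_pow {ι : Type*} {l : Filter ι} {f : ι → ℂ} (hf : BoundedAtFilter l f) (m : ℕ) :
    BoundedAtFilter l (fun x ↦ f x ^ m) := by
  have := IsBigO.pow hf m
  simpa only [BoundedAtFilter, Pi.one_def, one_pow] using this

lemma prod_zpow {ι : Type*} {s : Finset ι} {j : ℂ} (hj : j ≠ 0) (k : ι → ℤ) :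
    ∏ i ∈ s, j ^ k i = j ^ ∑ i ∈ s, k i := by
  classical
  induction s using Finset.induction_on with
  | empty => simp
  | insert a s ha ih => rw [Finset.prod_insert ha, Finset.sum_insert ha, zpow_add₀ hj, ih]

/-- The total weight of a free basis. -/
theorem IsFree.sum_weight {Φ : CuspFrame ρ c} {k : n → ℤ} {f : n → ℍ → n → ℂ}
    (hf : IsFree Φ k f) {M : ℕ} (hM : 0 < M) (hρ : ∀ γ, ρ γ ^ M = 1) (hk : ∀ i, 0 ≤ k i) :
    ((∑ i, k i : ℤ) : ℝ) = 12 * c := by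
  obtain ⟨K, hK⟩ := Int.eq_ofNat_of_zero_le (Finset.sum_nonneg fun i (_ : i ∈ Finset.univ) ↦ hk i)
  obtain ⟨U, hU, hdet⟩ := hf.lead
  rw [hK]
  set δ : ℍ → ℂ := fun τ ↦ (rowMat f τ).det
  set u : ℍ → ℂ := fun τ ↦ (rowMat f τ * (Φ.inv τ)ᵀ).det
  have hu : Tendsto u atImInfty (𝓝 U.det) :=
    (continuous_id.matrix_det.tendsto U).comp (IsFree.tendsto_rowMat hU)
  have hδ (τ : ℍ) : δ τ = u τ * qpow c τ := by
    simp only [δ, u]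
    conv_lhs => rw [IsFree.rowMat_eq (Φ := Φ) f τ]
    rw [Matrix.det_mul, Matrix.det_transpose, Φ.det]
    rfl
  have hu0 (τ : ℍ) : u τ ≠ 0 := fun h ↦ hf.det τ (by
    have := hδ τ
    rwa [h, zero_mul] at this)
  have hδd : MDiff δ := mdiff_rowMat hf.cusp
  have hδs (γ : SL(2, ℤ)) (τ : ℍ) : δ (γ • τ) ^ M = jf γ τ ^ (K * M) * δ τ ^ M := by
    simp only [δ]
    rw [IsFree.rowMat_smul hf.cusp, Matrix.det_mul, Matrix.det_mul, Matrix.det_diagonal,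
      Matrix.det_transpose, mul_pow, mul_pow, ← Matrix.det_pow (ρ γ), hρ, Matrix.det_one, mul_one,
      pow_mul]
    congr 2
    rw [prod_zpow (jf_ne_zero γ τ), hK, zpow_natCast]
  have hΔ (τ : ℍ) := discriminant_ne_zero τ
  have hδ12 (γ : SL(2, ℤ)) (τ : ℍ) :
      δ (γ • τ) ^ (12 * M) = jf γ τ ^ (12 * K * M) * δ τ ^ (12 * M) := by
    rw [mul_comm 12 M, pow_mul, hδs, mul_pow, ← pow_mul, ← pow_mul]
    ring
  have hΔs (γ : SL(2, ℤ)) (τ : ℍ) :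
      discriminant (γ • τ) ^ (K * M) = jf γ τ ^ (12 * K * M) * discriminant τ ^ (K * M) := by
    rw [IsLevelOne.discriminant.smul, mul_pow]
    norm_cast
    rw [← pow_mul]
    ring
  have hδ0 (τ : ℍ) : δ τ ≠ 0 := hf.det τ
  have hq0 (x : ℝ) (τ : ℍ) : qpow x τ ≠ 0 := Complex.exp_ne_zero _
  have hqpow (x : ℝ) (m : ℕ) (τ : ℍ) : qpow x τ ^ m = qpow (m * x) τ := by
    simp only [qpow, ← Complex.exp_nat_mul]
    congr 1; push_cast; ring
  rcases lt_trichotomy (K : ℝ) (12 * c) with h | h | h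
  · exfalso
    refine false_of_tendsto_zero (φ := fun τ ↦ δ τ ^ (12 * M) / discriminant τ ^ (K * M))
      (mdiff_div (mdiff_pow hδd _) (mdiff_pow mdifferentiable_discriminant _)
        fun τ ↦ pow_ne_zero _ (hΔ τ)) (fun γ τ ↦ ?_)
      (fun τ ↦ div_ne_zero (pow_ne_zero _ (hδ0 τ)) (pow_ne_zero _ (hΔ τ))) ?_
    · rw [hδ12, hΔs, mul_div_mul_left _ _ (pow_ne_zero _ (jf_ne_zero γ τ))]
    · have h1 : IsBoundedAtImInfty (fun τ ↦ u τ ^ (12 * M) * (qq τ / discriminant τ) ^ (K * M)) :=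
        BoundedAtFilter.mul (bdd_of_tendsto (hu.pow _))
          (bdd_pow bdd_qq_div_discriminant (K * M))
      refine (tendsto_zero_of_bdd_mul h1 (tendsto_qpow
        (x := M * (12 * c - K)) (by have : (0 : ℝ) < M := by exact_mod_cast hM
                                    have := sub_pos.mpr h
                                    positivity))).congr fun τ ↦ ?_
      have h2 : qpow (M * (12 * c - K)) τ * qq τ ^ (K * M) = qpow c τ ^ (12 * M) := by
        rw [qq_eq_qpow, hqpow, hqpow, qpow_mul_qpow]
        congr 1; push_cast; ring
      rw [hδ, mul_pow, ← h2, div_pow]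
      ring
  · exact_mod_cast h
  · exfalso
    refine false_of_tendsto_zero (φ := fun τ ↦ discriminant τ ^ (K * M) / δ τ ^ (12 * M))
      (mdiff_div (mdiff_pow mdifferentiable_discriminant _) (mdiff_pow hδd _)
        fun τ ↦ pow_ne_zero _ (hδ0 τ)) (fun γ τ ↦ ?_)
      (fun τ ↦ div_ne_zero (pow_ne_zero _ (hΔ τ)) (pow_ne_zero _ (hδ0 τ))) ?_
    · rw [hδ12, hΔs, mul_div_mul_left _ _ (pow_ne_zero _ (jf_ne_zero γ τ))]
    · have h1 : IsBoundedAtImInfty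
          (fun τ ↦ (u τ)⁻¹ ^ (12 * M) * (discriminant τ / qq τ) ^ (K * M)) :=
        BoundedAtFilter.mul (bdd_of_tendsto ((hu.inv₀ hdet).pow _))
          (bdd_pow bdd_discriminant_div_qq (K * M))
      refine (tendsto_zero_of_bdd_mul h1 (tendsto_qpow
        (x := M * (K - 12 * c)) (by have : (0 : ℝ) < M := by exact_mod_cast hM
                                    have := sub_pos.mpr h
                                    positivity))).congr fun τ ↦ ?_
      have h2 : qpow (M * (K - 12 * c)) τ * qpow c τ ^ (12 * M) = qq τ ^ (K * M) := by
        rw [qq_eq_qpow, hqpow, hqpow, qpow_mul_qpow]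
        congr 1; push_cast; ring
      have := qq_ne_zero τ
      have := hq0 c τ
      have := hu0 τ
      rw [hδ, mul_pow, div_pow, ← h2, inv_pow]
      have := hq0 (M * (K - 12 * c)) τ
      field_simp

end

section

lemma finrank_levelOne {q r : ℤ} (hr0 : 0 ≤ r) (hr : r < 12) (he : Even r)
    (hw : -8 ≤ 12 * q + r) :
    (Module.finrank ℂ (ModularForm 𝒮ℒ (12 * q + r)) : ℤ) = if r = 2 then q else q + 1 := by
  rcases lt_or_ge (12 * q + r) 0 with h | h
  · rw [Module.finrank, levelOne_neg_weight_rank_zero h]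
    obtain rfl : q = -1 := by lia
    rw [if_neg (by lia)]
    simp
  · obtain ⟨k, hk⟩ := Int.eq_ofNat_of_zero_le h
    have hke : Even k := by
      obtain ⟨m, rfl⟩ := he
      exact Nat.even_iff.mpr (by lia)
    have h1 : Module.finrank ℂ (ModularForm 𝒮ℒ k) =
        if k ≡ 2 [MOD 12] then k / 12 else k / 12 + 1 := by
      have := dimension_level_one k hke
      rw [Module.finrank, this]
      exact Cardinal.toNat_natCast _
    rw [hk, h1]
    simp only [Nat.ModEq]
    split_ifs <;> lia

/-- The dimension of a space of level one forms as a combination of roots of unity. -/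
lemma finrank_levelOne_eq {ω : ℂ} (hω : IsPrimitiveRoot ω 6) {w : ℤ} (he : Even w) (hw : -8 ≤ w) :
    12 * (Module.finrank ℂ (ModularForm 𝒮ℒ w) : ℂ) = w + 5 + 3 * Complex.I ^ w +
      4 * ((ω - 1) / (2 * ω - 1) * ω ^ w + ω / (2 * ω - 1) * ω ^ (-w)) := by
  have hω2 : ω ^ 2 = ω - 1 := by
    have h6 := hω.pow_eq_one
    have h2 : ω ^ 2 - 1 ≠ 0 := sub_ne_zero.mpr (hω.pow_ne_one_of_pos_of_lt (by norm_num) (by norm_num))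
    have h3 : ω ^ 3 - 1 ≠ 0 := sub_ne_zero.mpr (hω.pow_ne_one_of_pos_of_lt (by norm_num) (by norm_num))
    have h4 : ω + 1 ≠ 0 := fun h ↦ h2 (by linear_combination (ω - 1) * h)
    have : (ω ^ 3 - 1) * (ω + 1) * (ω ^ 2 - ω + 1) = 0 := by linear_combination h6
    have := (mul_eq_zero.mp this).resolve_left (mul_ne_zero h3 h4)
    linear_combination this
  have hω0 : ω ≠ 0 := hω.ne_zero (by norm_num)
  have hs : (2 * ω - 1) ≠ 0 := by
    intro h
    have : (2 * ω - 1) ^ 2 = -3 := by linear_combination 4 * hω2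
    rw [h] at this
    norm_num at this
  have hdm := Int.mul_ediv_add_emod w 12
  set q := w / 12
  set r := w % 12
  have hr0 : 0 ≤ r := Int.emod_nonneg _ (by norm_num)
  have hr : r < 12 := Int.emod_lt_of_pos _ (by norm_num)
  have her : Even r := by
    obtain ⟨m, hm⟩ := he
    exact Int.even_iff.mpr (by lia)
  have hd := finrank_levelOne hr0 hr her (hdm.symm ▸ hw)
  rw [hdm] at hd
  have hd' : (Module.finrank ℂ (ModularForm 𝒮ℒ w) : ℂ) = ((if r = 2 then q else q + 1 : ℤ) : ℂ) := by
    exact_mod_cast hd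
  have hI : Complex.I ^ w = Complex.I ^ r := by
    rw [← hdm, zpow_add₀ Complex.I_ne_zero, zpow_mul]
    have : Complex.I ^ (12 : ℤ) = 1 := by
      rw [show (12 : ℤ) = ((4 * 3 : ℕ) : ℤ) by norm_num, zpow_natCast, pow_mul, Complex.I_pow_four,
        one_pow]
    rw [this, one_zpow, one_mul]
  have hω12 : ω ^ (12 : ℤ) = 1 := by
    rw [show (12 : ℤ) = ((6 * 2 : ℕ) : ℤ) by norm_num, zpow_natCast, pow_mul, hω.pow_eq_one, one_pow]
  have hωw : ω ^ w = ω ^ r := by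
    rw [← hdm, zpow_add₀ hω0, zpow_mul, hω12, one_zpow, one_mul]
  have hωw' : ω ^ (-w) = ω ^ (12 - r) := by
    rw [show -w = 12 * (-q - 1) + (12 - r) by lia, zpow_add₀ hω0, zpow_mul, hω12, one_zpow, one_mul]
  have hwc : (w : ℂ) = 12 * q + r := by rw [← hdm]; push_cast; ring
  have hI2 := Complex.I_sq
  have hI4 := Complex.I_pow_four
  have hω3 : ω ^ 3 = -1 := by linear_combination (ω + 1) * hω2
  rw [hd', hI, hωw, hωw', hwc]
  clear_value q r
  have key (x : ℂ) (hx : (ω - 1) * ω ^ r + ω * ω ^ (12 - r) = x * (2 * ω - 1)) :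
      (ω - 1) / (2 * ω - 1) * ω ^ r + ω / (2 * ω - 1) * ω ^ (12 - r) = x := by
    rw [div_mul_eq_mul_div, div_mul_eq_mul_div, ← add_div, div_eq_iff hs, hx]
  have hω4 : ω ^ 4 = -ω := by linear_combination ω * hω3
  have hω6 : ω ^ 6 = 1 := hω.pow_eq_one
  have hω8 : ω ^ 8 = ω - 1 := by linear_combination ω ^ 2 * hω6 + hω2
  have hω10 : ω ^ 10 = -ω := by linear_combination ω ^ 4 * hω6 + hω4
  have hω12' : ω ^ 12 = 1 := by linear_combination (ω ^ 6 + 1) * hω6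
  have hI6 : Complex.I ^ 6 = -1 := by linear_combination Complex.I ^ 2 * hI4 + hI2
  have hI8 : Complex.I ^ 8 = 1 := by linear_combination (Complex.I ^ 4 + 1) * hI4
  have hI10 : Complex.I ^ 10 = -1 := by linear_combination Complex.I ^ 6 * hI4 + hI6
  interval_cases r <;> first | exact absurd her (by decide) | skip
  · rw [key 1 (by norm_num [zpow_ofNat, hω12']; ring)]
    norm_num; ring
  · rw [key (-1) (by norm_num [zpow_ofNat, hω2, hω10]; ring)]
    norm_num [zpow_ofNat, hI2]; ring
  · rw [key 0 (by norm_num [zpow_ofNat, hω4, hω8]; ring)]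
    norm_num [zpow_ofNat, hI4]; ring
  · rw [key 1 (by norm_num [zpow_ofNat, hω6]; ring)]
    norm_num [zpow_ofNat, hI6]; ring
  · rw [key (-1) (by norm_num [zpow_ofNat, hω4, hω8]; ring)]
    norm_num [zpow_ofNat, hI8]; ring
  · rw [key 0 (by norm_num [zpow_ofNat, hω2, hω10]; ring)]
    norm_num [zpow_ofNat, hI10]; ring

variable {n : Type} [Fintype n] [DecidableEq n] {ρ : SL(2, ℤ) →* Matrix n n ℂ} {c : ℝ}

/-- The space of vector-valued cusp forms. -/
def cuspSpace (ρ : SL(2, ℤ) →* Matrix n n ℂ) (w : ℤ) : Submodule ℂ (ℍ → n → ℂ) where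
  carrier := {v | IsVCusp ρ w v}
  zero_mem' := ⟨fun j ↦ mdifferentiable_const, fun γ τ ↦ by simp,
    fun j ↦ tendsto_const_nhds⟩
  add_mem' {u v} hu hv := ⟨fun j ↦ (hu.mdiff j).add (hv.mdiff j), fun γ τ ↦ by
    simp [hu.smul, hv.smul, Matrix.mulVec_add, -ModularGroup.sl_moeb], fun j ↦ by
      simpa using! (hu.zero j).add (hv.zero j)⟩
  smul_mem' a v hv := ⟨fun j ↦ (hv.mdiff j).const_smul a, fun γ τ ↦ by
    simp [hv.smul, Matrix.mulVec_smul, smul_comm a, -ModularGroup.sl_moeb], fun j ↦ by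
      have := Tendsto.const_mul a (hv.zero j)
      simpa [IsZeroAtImInfty, ZeroAtFilter] using! this⟩

/-- Linear combinations of cusp forms with level one coefficients. -/
def combination {k : n → ℤ} {f : n → ℍ → n → ℂ} (hf : ∀ i, IsVCusp ρ (k i) (f i)) (w : ℤ) :
    (∀ i, ModularForm 𝒮ℒ (w - k i)) →ₗ[ℂ] cuspSpace ρ w where
  toFun r := ⟨fun τ ↦ ∑ i, r i τ • f i τ,
    isVCusp_sum hf fun i ↦ IsLevelOne.of_modularForm (r i)⟩
  map_add' r s := by
    ext τ : 2
    simp [add_smul, Finset.sum_add_distrib]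
  map_smul' a r := by
    ext τ : 2
    simp [mul_smul, Finset.smul_sum]

omit [DecidableEq n] in
lemma sum_smul_eq_vecMul (f : n → ℍ → n → ℂ) (r : n → ℂ) (τ : ℍ) :
    ∑ i, r i • f i τ = r ᵥ* rowMat f τ := by
  rw [Matrix.vecMul_eq_sum]; rfl

theorem IsFree.bijective_combination {Φ : CuspFrame ρ c} {k : n → ℤ} {f : n → ℍ → n → ℂ}
    (hf : IsFree Φ k f) (w : ℤ) : Function.Bijective (combination hf.cusp w) := by
  constructor
  · rw [injective_iff_map_eq_zero]
    intro r hr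
    have h1 (τ : ℍ) : (fun i ↦ r i τ) = 0 := by
      have h2 : (fun i ↦ r i τ) ᵥ* rowMat f τ = 0 := by
        rw [← sum_smul_eq_vecMul]
        exact congrFun (congrArg Subtype.val hr) τ
      have := congrArg (· ᵥ* (rowMat f τ)⁻¹) h2
      simpa [Matrix.vecMul_vecMul, hf.mul_inv] using this
    ext i τ
    exact congrFun (h1 τ) i
  · rintro ⟨v, hv⟩
    obtain ⟨U, hU, hdet⟩ := hf.lead
    set r : n → ℍ → ℂ := fun i τ ↦ (v τ ᵥ* (rowMat f τ)⁻¹) i with hr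
    have hrd (i : n) : MDiff (r i) :=
      mdiff_sum _ fun l _ ↦ (hv.mdiff l).mul (hf.mdiff_inv l i)
    have hrs (i : n) (γ : SL(2, ℤ)) (τ : ℍ) : r i (γ • τ) = jf γ τ ^ (w - k i) * r i τ := by
      have h1 : v τ ᵥ* (ρ γ)ᵀ ᵥ* (ρ γ⁻¹)ᵀ = v τ := by
        have := map_mul_inv (ρ := ρ) γ⁻¹
        rw [inv_inv] at this
        rw [Matrix.vecMul_vecMul, ← Matrix.transpose_mul, this, Matrix.transpose_one,
          Matrix.vecMul_one]
      simp only [hr]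
      rw [hf.inv_smul, hv.smul, ← Matrix.vecMul_transpose, Matrix.smul_vecMul,
        ← Matrix.vecMul_vecMul, ← Matrix.vecMul_vecMul, h1, Pi.smul_apply, Matrix.vecMul_diagonal,
        sub_eq_add_neg, zpow_add₀ (jf_ne_zero γ τ), smul_eq_mul]
      ring
    have hrb (i : n) : IsBoundedAtImInfty (r i) := by
      choose l hl using Φ.exists_tendsto hv
      have h1 (τ : ℍ) : r i τ =
          ∑ m, (Φ.inv τ *ᵥ v τ) m * (rowMat f τ * (Φ.inv τ)ᵀ)⁻¹ m i := by
        simp only [hr]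
        rw [hf.inv_eq, ← Matrix.vecMul_vecMul, Matrix.vecMul_transpose]
        rfl
      have h2 : Tendsto (fun τ ↦ ∑ m, (Φ.inv τ *ᵥ v τ) m * (rowMat f τ * (Φ.inv τ)ᵀ)⁻¹ m i)
          atImInfty (𝓝 (∑ m, l m * U⁻¹ m i)) :=
        tendsto_finsetSum _ fun m _ ↦ (hl m).mul (tendsto_inv hU hdet m i)
      exact bdd_of_tendsto (h2.congr fun τ ↦ (h1 τ).symm)
    refine ⟨fun i ↦ toModularForm (w - k i) (r i)
      (fun γ ↦ (slash_eq_iff _ _ _ _).mpr (hrs i γ)) (hrd i) (hrb i), Subtype.ext ?_⟩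
    ext τ : 1
    change ∑ i, r i τ • f i τ = v τ
    rw [sum_smul_eq_vecMul f (fun i ↦ r i τ)]
    change (v τ ᵥ* (rowMat f τ)⁻¹) ᵥ* rowMat f τ = v τ
    rw [Matrix.vecMul_vecMul, hf.inv_mul, Matrix.vecMul_one]

theorem IsFree.finrank_eq {Φ : CuspFrame ρ c} {k : n → ℤ} {f : n → ℍ → n → ℂ}
    (hf : IsFree Φ k f) (w : ℤ) : Module.finrank ℂ (cuspSpace ρ w) =
      ∑ i, Module.finrank ℂ (ModularForm 𝒮ℒ (w - k i)) := by
  rw [← (LinearEquiv.ofBijective _ (hf.bijective_combination w)).finrank_eq,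
    Module.finrank_pi_fintype]

end

section

lemma jf_inv (γ : SL(2, ℤ)) {τ : ℍ} (h : γ • τ = τ) : jf γ⁻¹ τ = (jf γ τ)⁻¹ := by
  have h1 := jf_mul γ⁻¹ γ τ
  rw [inv_mul_cancel, jf_one, h] at h1
  exact eq_inv_of_mul_eq_one_left h1.symm

lemma T_pow_mem_Gamma (N : ℕ) : ModularGroup.T ^ N ∈ CongruenceSubgroup.Gamma N := by
  rw [CongruenceSubgroup.Gamma_mem, ← zpow_natCast, ModularGroup.coe_T_zpow]
  simp

variable {n : Type} [Fintype n] [DecidableEq n] {ρ : SL(2, ℤ) →* Matrix n n ℂ}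

open ModularGroup in
/-- The dimension of a space of vector-valued cusp forms for a representation for which all
elliptic elements and all nontrivial unipotent elements are traceless. -/
theorem finrank_cuspSpace {N : ℕ} [NeZero N]
    (hρ : ∀ γ ∈ CongruenceSubgroup.Gamma N, ρ γ = 1) {p w : ℤ}
    (hneg : ρ (-1) = (-1 : ℂ) ^ p • (1 : Matrix n n ℂ)) (hwp : Even (w - p)) (hw : 3 ≤ w)
    (hT : ∀ t, 0 < t → t < N → (ρ (T ^ t)).trace = 0) (hS : (ρ S).trace = 0)
    (hST : (ρ (S * T)).trace = 0) (hST' : (ρ (S * T)⁻¹).trace = 0)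
    (hfull : ∃ k f, IsFull ρ k f) :
    (Module.finrank ℂ (cuspSpace ρ w) : ℝ) =
      Fintype.card n * (((w : ℝ) - 1) / 12 - 1 / (2 * N)) := by
  have hN : (N : ℝ) ≠ 0 := NeZero.ne _
  have := CongruenceSubgroup.Gamma_normal N
  obtain ⟨Φ⟩ := exists_cuspFrame ρ (NeZero.ne N)
    (by rw [← map_pow, hρ _ (T_pow_mem_Gamma N)]) (by simpa only [map_pow] using hT)
  obtain ⟨_, _, h⟩ := hfull
  obtain ⟨k, f, hf⟩ := exists_isMinimal hρ h
  have hfree := hf.isFree hneg Φ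
  have hsum := hfree.sum_weight (M := (CongruenceSubgroup.Gamma N).index)
    (Nat.pos_of_ne_zero Subgroup.FiniteIndex.index_ne_zero)
    (fun γ ↦ by rw [← map_pow, hρ _ (Subgroup.pow_index_mem _ γ)]) (fun i ↦ hf.nonneg hρ i)
  have he (i : n) : Even (w - k i) := by
    have := hf.even_sub hneg i
    obtain ⟨a, ha⟩ := this
    obtain ⟨b, hb⟩ := hwp
    exact ⟨a + b, by lia⟩
  have hle (i : n) : -8 ≤ w - k i := by
    have := hfree.weight_le hρ i
    obtain ⟨a, ha⟩ := he i
    lia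
  set ω := jf (S * T) UpperHalfPlane.ρ with hω
  have hω6 : IsPrimitiveRoot ω 6 := isPrimitiveRoot_jf_ST
  have hω0 : ω ≠ 0 := hω6.ne_zero (by norm_num)
  have s1 : ∑ i, Complex.I ^ (w - k i) = 0 := by
    have := hfree.trace_eq S_smul_I
    rw [hS, jf_S_I] at this
    simp_rw [sub_eq_add_neg, zpow_add₀ Complex.I_ne_zero, ← Finset.mul_sum, ← this, mul_zero]
  have s2 : ∑ i, ω ^ (w - k i) = 0 := by
    have := hfree.trace_eq ST_smul_rho
    rw [hST, ← hω] at this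
    simp_rw [sub_eq_add_neg, zpow_add₀ hω0, ← Finset.mul_sum, ← this, mul_zero]
  have s3 : ∑ i, ω ^ (-(w - k i)) = 0 := by
    have := hfree.trace_eq (inv_smul_eq_iff.mpr ST_smul_rho.symm)
    rw [hST', jf_inv _ ST_smul_rho, ← hω] at this
    simp_rw [inv_zpow', neg_neg] at this
    simp_rw [neg_sub, sub_eq_neg_add, zpow_add₀ hω0, ← Finset.mul_sum, ← this, mul_zero]
  have hsum' : (∑ i, (k i : ℂ)) = ((12 * (Fintype.card n * (N + 1) / (2 * N)) : ℝ) : ℂ) := by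
    rw [← hsum]; push_cast; rfl
  have key : 12 * (Module.finrank ℂ (cuspSpace ρ w) : ℂ) =
      Fintype.card n * (w + 5 : ℂ) - ∑ i, (k i : ℂ) := by
    rw [hfree.finrank_eq]
    push_cast
    rw [Finset.mul_sum, Finset.sum_congr rfl fun i _ ↦ finrank_levelOne_eq hω6 (he i) (hle i)]
    simp only [Finset.sum_add_distrib, ← Finset.mul_sum, s1, s2, s3]
    push_cast
    simp [Finset.sum_sub_distrib]
    ring
  rw [hsum'] at key
  have key' : 12 * (Module.finrank ℂ (cuspSpace ρ w) : ℝ) =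
      Fintype.card n * (w + 5 : ℝ) - 12 * (Fintype.card n * (N + 1) / (2 * N)) := by
    exact_mod_cast key
  field_simp at key' ⊢
  linarith

end

section

/-- Points of the imaginary axis tending to the cusp. -/
def axisPt (m : ℕ) : ℍ := ⟨(m + 1 : ℝ) * Complex.I, by
  simp only [Complex.mul_im, Complex.ofReal_re, Complex.I_im, mul_one, Complex.I_re, mul_zero,
    add_zero]
  positivity⟩

lemma coe_axisPt (m : ℕ) : (axisPt m : ℂ) = (m + 1) * Complex.I := by
  simp [axisPt]

lemma axisPt_mem (m : ℕ) : axisPt m ∈ verticalStrip 0 1 := by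
  rw [mem_verticalStrip_iff]
  constructor
  · simp [← coe_re, coe_axisPt]
  · simp [← coe_im, coe_axisPt]

lemma tendsto_eisSummand (v : Fin 2 → ℤ) : Tendsto (fun m ↦ eisSummand 3 v (axisPt m)) atTop
    (𝓝 (if v 0 = 0 then (v 1 : ℂ) ^ (-3 : ℤ) else 0)) := by
  split_ifs with h
  · simp [eisSummand, h]
  · have h1 : Tendsto (fun m : ℕ ↦ ((v 0 : ℂ) * axisPt m + v 1)⁻¹) atTop (𝓝 0) := by
      apply tendsto_inv₀_cobounded.comp
      rw [← tendsto_norm_atTop_iff_cobounded]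
      have h2 : Tendsto (fun m : ℕ ↦ (m : ℝ) + 1) atTop atTop :=
        tendsto_atTop_add_const_right _ _ tendsto_natCast_atTop_atTop
      refine tendsto_atTop_mono (fun m ↦ ?_) h2
      refine le_trans ?_ (Complex.abs_im_le_norm _)
      have h3 : (1 : ℝ) ≤ |(v 0 : ℝ)| := by exact_mod_cast Int.one_le_abs h
      have : ((v 0 : ℂ) * axisPt m + v 1).im = v 0 * (m + 1) := by
        simp [coe_axisPt]
      rw [this, abs_mul, abs_of_nonneg (by positivity : (0 : ℝ) ≤ m + 1)]
      nlinarith [(by positivity : (0 : ℝ) ≤ m)]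
    have := h1.pow 3
    simpa [eisSummand, zpow_neg, zpow_ofNat] using this

variable {N : ℕ}

lemma tendsto_eisensteinSeries (a : Fin 2 → ZMod N) :
    Tendsto (fun m ↦ eisensteinSeries a 3 (axisPt m)) atTop
      (𝓝 (∑' v : gammaSet N 1 a, if v.1 0 = 0 then (v.1 1 : ℂ) ^ (-3 : ℤ) else 0)) := by
  have hs := (summable_one_div_norm_rpow (k := 3) (by norm_num)).mul_left
    (r ⟨⟨0, 1⟩, one_pos⟩ ^ (-3 : ℝ))
  refine tendsto_tsum_of_dominated_convergence (hs.subtype (gammaSet N 1 a))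
    (fun v ↦ tendsto_eisSummand v.1) (Eventually.of_forall fun m v ↦ ?_)
  have := summand_bound_of_mem_verticalStrip (k := 3) (by norm_num) v.1 one_pos (axisPt_mem m)
  simp only [eisSummand, norm_zpow]
  rw [← Real.rpow_intCast]
  simpa using! this

lemma eq_of_mem_gammaSet {a : Fin 2 → ZMod N} {v : Fin 2 → ℤ} (hv : v ∈ gammaSet N 1 a)
    (h0 : v 0 = 0) : v = ![0, 1] ∨ v = ![0, -1] := by
  have := hv.2
  rw [h0, Int.gcd_zero_left, Int.natAbs_eq_iff] at this
  refine this.imp ?_ ?_ <;>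
  · intro h; ext i; fin_cases i <;> simp [h0, h]

lemma eisensteinSeries_ne (hN : 2 < N) {a : Fin 2 → ZMod N} (ha : a ≠ ![0, 1]) :
    eisensteinSeries a 3 ≠ eisensteinSeries (![0, 1] : Fin 2 → ZMod N) 3 := by
  intro h
  have hne : (-1 : ZMod N) ≠ 1 := by
    have : Fact (2 < N) := ⟨hN⟩
    exact ZMod.neg_one_ne_one
  have hmem (b : Fin 2 → ZMod N) : (![0, 1] ∈ gammaSet N 1 b ↔ b = ![0, 1]) ∧
      (![0, -1] ∈ gammaSet N 1 b ↔ b = ![0, -1]) := by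
    constructor <;>
    · simp only [gammaSet, Set.mem_ofPred_eq]
      constructor
      · rintro ⟨rfl, -⟩; ext i; fin_cases i <;> simp
      · rintro rfl
        refine ⟨by ext i; fin_cases i <;> simp, by simp⟩
  have h1 : ∑' v : gammaSet N 1 (![0, 1] : Fin 2 → ZMod N), (if v.1 0 = 0 then (v.1 1 : ℂ) ^ (-3 : ℤ) else 0) = 1 := by
    rw [tsum_eq_single ⟨![0, 1], (hmem _).1.mpr rfl⟩]
    · simp
    · rintro ⟨v, hv⟩ hv'
      refine if_neg fun h0 ↦ ?_
      rcases eq_of_mem_gammaSet hv h0 with rfl | rfl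
      · exact hv' rfl
      · have := congrFun ((hmem _).2.mp hv) 1
        exact hne (by simpa using this.symm)
  have h2 := tendsto_nhds_unique (h ▸ tendsto_eisensteinSeries a) (tendsto_eisensteinSeries ![0, 1])
  rw [h1] at h2
  by_cases hb : a = ![0, -1]
  · subst hb
    rw [tsum_eq_single ⟨![0, -1], (hmem _).2.mpr rfl⟩] at h2
    · norm_num [zpow_neg, zpow_ofNat] at h2
    · rintro ⟨v, hv⟩ hv'
      refine if_neg fun h0 ↦ ?_
      rcases eq_of_mem_gammaSet hv h0 with rfl | rfl
      · exact ha ((hmem _).1.mp hv)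
      · exact hv' rfl
  · rw [tsum_congr (g := fun _ ↦ 0), tsum_zero] at h2
    · exact zero_ne_one h2
    · rintro ⟨v, hv⟩
      refine if_neg fun h0 ↦ ?_
      rcases eq_of_mem_gammaSet hv h0 with rfl | rfl
      · exact ha ((hmem _).1.mp hv)
      · exact hb ((hmem _).2.mp hv)

/-- The Eisenstein series of weight three separate the cosets of `Γ(N)`. -/
lemma exists_slash_ne (hN : 2 < N) {γ : SL(2, ℤ)} (hγ : γ ∉ CongruenceSubgroup.Gamma N) :
    ∃ a : Fin 2 → ZMod N, eisensteinSeries a 3 ∣[(3 : ℤ)] γ ≠ eisensteinSeries a 3 := by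
  by_contra! h
  apply hγ
  have key (δ : SL(2, ℤ)) : (![0, 1] : Fin 2 → ZMod N) ᵥ*
      ((δ * γ * δ⁻¹ : SL(2, ℤ)).map (Int.castRingHom (ZMod N))).1 = ![0, 1] := by
    by_contra hne
    apply eisensteinSeries_ne hN hne
    have h1 := h (![0, 1] ᵥ* (δ.map (Int.castRingHom (ZMod N))).1)
    have h2 := eisensteinSeries_slash_apply (![0, 1] : Fin 2 → ZMod N) 3 δ
    have h3 := eisensteinSeries_slash_apply (![0, 1] : Fin 2 → ZMod N) 3 (δ * γ * δ⁻¹)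
    have h4 := h1
    rw [← h2, ← SlashAction.slash_mul] at h4
    rw [SlashAction.slash_mul, h4, ← SlashAction.slash_mul, mul_inv_cancel,
      SlashAction.slash_one] at h3
    exact h3.symm
  have k1 := key 1
  have k2 := key ModularGroup.S
  have e1 := congrFun k1 0
  have e2 := congrFun k1 1
  have e3 := congrFun k2 0
  have e4 := congrFun k2 1
  simp [Matrix.vecMul, dotProduct, Fin.sum_univ_two, ModularGroup.coe_S, Matrix.mul_apply,
    Matrix.SpecialLinearGroup.coe_mul, Matrix.SpecialLinearGroup.coe_inv,
    Matrix.adjugate_fin_two] at e1 e2 e3 e4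
  rw [CongruenceSubgroup.Gamma_mem]
  exact ⟨by assumption, by assumption, by assumption, by assumption⟩

end

section

open CongruenceSubgroup

/-- Evaluation of translates, as a character of the graded monoid of modular forms. -/
def evalSlash (N : ℕ) (γ : SL(2, ℤ)) (τ : ℍ) : GradedMonoid (ModularForm (Gamma N)) →* ℂ where
  toFun x := ((x.2 : ℍ → ℂ) ∣[x.1] γ) τ
  map_one' := by
    have := is_invariant_one γ
    exact congrFun this τ
  map_mul' x y := congrFun (mul_slash_SL2 x.1 y.1 γ x.2 y.2) τ

lemma slash_eq_of_mem {N : ℕ} {k : ℤ} {F : Type*} [FunLike F ℍ ℂ]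
    [SlashInvariantFormClass F (Gamma N) k] (f : F) {γ : SL(2, ℤ)} (hγ : γ ∈ Gamma N) :
    (f : ℍ → ℂ) ∣[k] γ = f :=
  SlashInvariantFormClass.slash_action_eq f _ ⟨γ, hγ, rfl⟩

lemma exists_forall_ne_zero {ι : Type*} (s : Finset ι) {h : ι → ℍ → ℂ}
    (hm : ∀ i ∈ s, MDiff (h i)) (h0 : ∀ i ∈ s, h i ≠ 0) : ∃ τ, ∀ i ∈ s, h i τ ≠ 0 := by
  classical
  suffices (fun τ ↦ ∏ i ∈ s, h i τ) ≠ 0 by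
    obtain ⟨τ, hτ⟩ := Function.ne_iff.mp this
    exact ⟨τ, fun i hi h ↦ hτ (Finset.prod_eq_zero hi h)⟩
  induction s using Finset.induction_on with
  | empty => exact fun h ↦ by simpa using congrFun h I
  | insert a s ha ih =>
    simp only [Finset.prod_insert ha]
    have hs (i) (hi : i ∈ s) : i ∈ insert a s := Finset.mem_insert_of_mem hi
    have := UpperHalfPlane.mul_eq_zero_iff (hm a (Finset.mem_insert_self a s))
      (mdiff_prod s fun i hi ↦ hm i (hs i hi))
    intro h
    rcases this.mp h with h | h
    · exact h0 a (Finset.mem_insert_self a s) h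
    · exact ih (fun i hi ↦ hm i (hs i hi)) (fun i hi ↦ h0 i (hs i hi)) h

/-- Translates of modular forms along distinct cosets of `Γ(N)` are independent at some point. -/
theorem exists_independent {N : ℕ} [NeZero N] (hN : 2 < N) {ι : Type*} [Fintype ι]
    (g : ι → SL(2, ℤ)) (hg : ∀ i j, i ≠ j → g i * (g j)⁻¹ ∉ Gamma N) :
    ∃ τ : ℍ, ∀ c : ι → ℂ, (∀ (k : ℤ) (f : ModularForm (Gamma N) k),
      ∑ i, c i * ((f : ℍ → ℂ) ∣[k] g i) τ = 0) → c = 0 := by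
  classical
  have hex (x : ι × ι) (hx : x.1 ≠ x.2) : ∃ a : Fin 2 → ZMod N,
      (eisensteinSeries a 3 ∣[(3 : ℤ)] g x.1) - (eisensteinSeries a 3 ∣[(3 : ℤ)] g x.2) ≠ 0 := by
    obtain ⟨a, ha⟩ := exists_slash_ne hN (hg x.1 x.2 hx)
    refine ⟨a, fun h ↦ ha ?_⟩
    rw [SlashAction.slash_mul, sub_eq_zero.mp h, ← SlashAction.slash_mul, mul_inv_cancel,
      SlashAction.slash_one]
  choose! a ha using hex
  have hm (b : Fin 2 → ZMod N) (γ : SL(2, ℤ)) : MDiff (eisensteinSeries b 3 ∣[(3 : ℤ)] γ) :=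
    (ModularFormClass.holo (eisensteinSeriesMF le_rfl b)).slash 3 _
  obtain ⟨τ, hτ⟩ := exists_forall_ne_zero (Finset.univ.filter fun x : ι × ι ↦ x.1 ≠ x.2)
    (fun x _ ↦ (hm (a x) (g x.1)).sub (hm (a x) (g x.2)))
    (fun x hx ↦ ha x (Finset.mem_filter.mp hx).2)
  refine ⟨τ, fun c hc ↦ ?_⟩
  have hinj : Function.Injective fun i ↦ evalSlash N (g i) τ := by
    intro i j hij
    by_contra hne
    refine hτ (i, j) (by simpa using hne) (sub_eq_zero.mpr ?_)
    exact DFunLike.congr_fun hij ⟨3, eisensteinSeriesMF le_rfl (a (i, j))⟩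
  have hli := (linearIndependent_monoidHom (GradedMonoid (ModularForm (Gamma N))) ℂ).comp _ hinj
  rw [Fintype.linearIndependent_iff] at hli
  ext i
  refine hli c (funext fun x ↦ ?_) i
  simpa using! hc x.1 x.2

end

section

open CongruenceSubgroup

section Compress

variable {m n : Type} [Fintype m] [DecidableEq m] [Fintype n] [DecidableEq n]

/-- The subrepresentation cut out by an equivariant idempotent `B * A`. -/
def compress (ρ : SL(2, ℤ) →* Matrix m m ℂ) (B : Matrix m n ℂ) (A : Matrix n m ℂ)
    (hAB : A * B = 1) (hc : ∀ γ, B * A * ρ γ = ρ γ * (B * A)) : SL(2, ℤ) →* Matrix n n ℂ where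
  toFun γ := A * ρ γ * B
  map_one' := by rw [map_one, Matrix.mul_one, hAB]
  map_mul' γ δ := by
    calc A * ρ (γ * δ) * B = A * B * A * (ρ γ * ρ δ) * B := by rw [hAB, Matrix.one_mul, map_mul]
      _ = A * (B * A * ρ γ) * ρ δ * B := by simp only [Matrix.mul_assoc]
      _ = A * ρ γ * B * (A * ρ δ * B) := by rw [hc]; simp only [Matrix.mul_assoc]

variable {ρ : SL(2, ℤ) →* Matrix m m ℂ} {B : Matrix m n ℂ} {A : Matrix n m ℂ}
  {hAB : A * B = 1} {hc : ∀ γ, B * A * ρ γ = ρ γ * (B * A)}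

lemma compress_apply (γ : SL(2, ℤ)) : compress ρ B A hAB hc γ = A * ρ γ * B := rfl

lemma compress_mul (γ : SL(2, ℤ)) : compress ρ B A hAB hc γ * A = A * ρ γ := by
  rw [compress_apply, Matrix.mul_assoc, Matrix.mul_assoc, ← hc, ← Matrix.mul_assoc,
    ← Matrix.mul_assoc, hAB, Matrix.one_mul]

lemma mul_compress (γ : SL(2, ℤ)) : B * compress ρ B A hAB hc γ = ρ γ * B := by
  rw [compress_apply, ← Matrix.mul_assoc, ← Matrix.mul_assoc, hc, Matrix.mul_assoc,
    Matrix.mul_assoc, hAB, Matrix.mul_one]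

lemma trace_compress (γ : SL(2, ℤ)) :
    (compress ρ B A hAB hc γ).trace = (ρ γ * (B * A)).trace := by
  rw [compress_apply, Matrix.mul_assoc, Matrix.trace_mul_comm, Matrix.mul_assoc]

variable {k : ℤ} {v : ℍ → m → ℂ}

omit [DecidableEq m] [Fintype n] [DecidableEq n] in
lemma mdiff_mulVec (A : Matrix n m ℂ) (hv : ∀ j, MDiff (fun τ ↦ v τ j)) (j : n) :
    MDiff (fun τ ↦ (A *ᵥ v τ) j) :=
  mdiff_sum _ fun l _ ↦ (hv l).const_smul (A j l)

lemma IsVForm.compress (hv : IsVForm ρ k v) :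
    IsVForm (compress ρ B A hAB hc) k (fun τ ↦ A *ᵥ v τ) where
  mdiff := mdiff_mulVec A hv.mdiff
  smul γ τ := by
    rw [hv.smul, Matrix.mulVec_smul, Matrix.mulVec_mulVec, Matrix.mulVec_mulVec, compress_mul]
  bdd j := bdd_sum _ fun l _ ↦ (hv.bdd l).const_mul_left _

lemma IsVCusp.compress (hv : IsVCusp ρ k v) :
    IsVCusp (compress ρ B A hAB hc) k (fun τ ↦ A *ᵥ v τ) where
  mdiff := mdiff_mulVec A hv.mdiff
  smul := (hv.isVForm.compress (hAB := hAB) (hc := hc)).smul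
  zero j := by
    have : Tendsto (fun τ ↦ ∑ l, A j l * v τ l) atImInfty (𝓝 (∑ l, A j l * 0)) :=
      tendsto_finsetSum _ fun l _ ↦ (hv.zero l).const_mul (A j l)
    simpa using! this

lemma IsVForm.discriminant_smul (hv : IsVForm ρ k v) :
    IsVCusp ρ (12 + k) (fun τ ↦ discriminant τ • v τ) where
  mdiff j := IsLevelOne.discriminant.mdiff.mul (hv.mdiff j)
  smul γ τ := by
    rw [hv.smul, IsLevelOne.discriminant.smul, zpow_add₀ (jf_ne_zero γ τ), Matrix.mulVec_smul,
      smul_smul, smul_smul]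
    congr 1; ring
  zero j := by
    have := tendsto_zero_of_bdd_mul (hv.bdd j) discriminant_isZeroAtImInfty
    simpa [mul_comm] using! this

end Compress

section Regular

/-- The quotient of the modular group by `Γ(N)`. -/
abbrev LevelGroup (N : ℕ) := SL(2, ℤ) ⧸ Gamma N

instance (N : ℕ) : (Gamma N).Normal := Gamma_normal N

instance (N : ℕ) [NeZero N] : Fintype (LevelGroup N) := Fintype.ofFinite _

instance (N : ℕ) : DecidableEq (LevelGroup N) := Classical.decEq _

variable (N : ℕ) [NeZero N]

/-- The right regular representation of `SL(2, ℤ) ⧸ Γ(N)`. -/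
def regular : SL(2, ℤ) →* Matrix (LevelGroup N) (LevelGroup N) ℂ where
  toFun γ := Matrix.of fun q q' ↦ if q' = q * (γ : LevelGroup N) then 1 else 0
  map_one' := by
    ext q q'
    simp [Matrix.one_apply, eq_comm]
  map_mul' γ δ := by
    ext q q'
    rw [Matrix.mul_apply, Finset.sum_eq_single (q * (γ : LevelGroup N))]
    · simp only [Matrix.of_apply, if_true, one_mul, mul_assoc, QuotientGroup.mk_mul]
      rfl
    · intro j _ hj
      simp [hj]
    · simp

variable {N}

lemma regular_mulVec (γ : SL(2, ℤ)) (u : LevelGroup N → ℂ) (q : LevelGroup N) :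
    (regular N γ *ᵥ u) q = u (q * γ) := by
  simp [regular, Matrix.mulVec, dotProduct]

lemma trace_regular {γ : SL(2, ℤ)} (hγ : γ ∉ Gamma N) : (regular N γ).trace = 0 := by
  refine Finset.sum_eq_zero fun q _ ↦ ?_
  simp [regular, hγ, QuotientGroup.eq_one_iff]

lemma regular_eq_one {γ : SL(2, ℤ)} (hγ : γ ∈ Gamma N) : regular N γ = 1 := by
  have : (γ : LevelGroup N) = 1 := (QuotientGroup.eq_one_iff γ).mpr hγ
  ext q q'
  simp [regular, this, Matrix.one_apply, eq_comm]

lemma regular_neg_mul (γ : SL(2, ℤ)) : regular N γ * regular N (-1) = regular N (-γ) := by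
  rw [← map_mul, mul_neg_one]

variable (N) in
/-- The projection to the part of given parity. -/
def parityProj (p : ℤ) : Matrix (LevelGroup N) (LevelGroup N) ℂ :=
  (1 / 2 : ℂ) • (1 + (-1 : ℂ) ^ p • regular N (-1))

lemma neg_one_zpow_sq (p : ℤ) : (-1 : ℂ) ^ p * (-1 : ℂ) ^ p = 1 := by
  rw [← mul_zpow]; norm_num

lemma regular_neg_one_mul_parityProj (p : ℤ) :
    regular N (-1) * parityProj N p = (-1 : ℂ) ^ p • parityProj N p := by
  have h1 : regular N (-1) * regular N (-1) = 1 := by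
    rw [regular_neg_mul, neg_neg, map_one]
  rw [parityProj, Matrix.mul_smul, Matrix.mul_add, Matrix.mul_smul, Matrix.mul_one, h1,
    smul_comm ((-1 : ℂ) ^ p) (1 / 2 : ℂ), smul_add ((-1 : ℂ) ^ p), smul_smul ((-1 : ℂ) ^ p),
    neg_one_zpow_sq, one_smul, add_comm]

lemma parityProj_mul_self (p : ℤ) : parityProj N p * parityProj N p = parityProj N p := by
  nth_rewrite 1 [parityProj]
  rw [Matrix.smul_mul, Matrix.add_mul, Matrix.smul_mul, regular_neg_one_mul_parityProj, smul_smul,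
    neg_one_zpow_sq, one_smul, Matrix.one_mul, ← two_smul ℂ, smul_smul]
  norm_num

lemma parityProj_comm (p : ℤ) (γ : SL(2, ℤ)) :
    parityProj N p * regular N γ = regular N γ * parityProj N p := by
  have h : regular N (-1) * regular N γ = regular N γ * regular N (-1) := by
    rw [← map_mul, ← map_mul]; simp
  simp [parityProj, Matrix.add_mul, Matrix.mul_add, h]

lemma trace_regular_mul_parityProj (p : ℤ) {γ : SL(2, ℤ)} (h1 : γ ∉ Gamma N) (h2 : -γ ∉ Gamma N) :
    (regular N γ * parityProj N p).trace = 0 := by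
  simp [parityProj, Matrix.mul_add, regular_neg_mul, trace_regular h1, trace_regular h2]

omit [NeZero N] in
lemma neg_one_notMem_Gamma (hN : 2 < N) : (-1 : SL(2, ℤ)) ∉ Gamma N := by
  have : Fact (2 < N) := ⟨hN⟩
  rw [Gamma_mem]
  intro h
  have := h.1
  simp only [Matrix.SpecialLinearGroup.coe_neg, Matrix.SpecialLinearGroup.coe_one,
    Matrix.neg_apply, Matrix.one_apply_eq, Int.cast_neg, Int.cast_one] at this
  exact ZMod.neg_one_ne_one this

lemma trace_parityProj (hN : 2 < N) (p : ℤ) :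
    (parityProj N p).trace = Fintype.card (LevelGroup N) / 2 := by
  simp [parityProj, trace_regular (neg_one_notMem_Gamma hN), Matrix.trace_one]
  ring

end Regular

end

section

open CongruenceSubgroup

variable {N : ℕ} [NeZero N] {k : ℤ}

/-- The vector of all translates of a function. -/
def translates (N : ℕ) (k : ℤ) (f : ℍ → ℂ) (τ : ℍ) (q : LevelGroup N) : ℂ := (f ∣[k] q.out) τ

omit [NeZero N] in
lemma translates_mk {f : ℍ → ℂ} (hf : ∀ γ ∈ Gamma N, f ∣[k] γ = f) (γ : SL(2, ℤ)) (τ : ℍ) :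
    translates N k f τ (γ : LevelGroup N) = (f ∣[k] γ) τ := by
  set δ := (γ : LevelGroup N).out with hδ
  have h1 : (δ : LevelGroup N) = γ := QuotientGroup.out_eq' _
  have h2 : γ * δ⁻¹ ∈ Gamma N := by
    rw [← QuotientGroup.eq_one_iff, QuotientGroup.mk_mul, QuotientGroup.mk_inv, h1, mul_inv_cancel]
  have h3 : γ = γ * δ⁻¹ * δ := by group
  rw [h3, SlashAction.slash_mul, hf _ h2, ← h3]
  rfl

lemma translates_smul {f : ℍ → ℂ} (hf : ∀ γ ∈ Gamma N, f ∣[k] γ = f) (γ : SL(2, ℤ)) (τ : ℍ) :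
    translates N k f (γ • τ) = jf γ τ ^ k • (regular N γ *ᵥ translates N k f τ) := by
  ext q
  have h1 : q * (γ : LevelGroup N) = ((q.out * γ : SL(2, ℤ)) : LevelGroup N) := by
    rw [QuotientGroup.mk_mul, QuotientGroup.out_eq']
  rw [Pi.smul_apply, regular_mulVec, h1, translates_mk hf, SlashAction.slash_mul, smul_eq_mul]
  exact (slash_eq_iff k (f ∣[k] q.out) _ γ).mp rfl τ

lemma isVForm_translates (f : ModularForm (Gamma N) k) :
    IsVForm (regular N) k (translates N k f) where
  mdiff _ := (ModularFormClass.holo f).slash k _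
  smul := translates_smul fun _ ↦ slash_eq_of_mem f
  bdd q := ModularFormClass.bdd_at_infty_slash f q.out

lemma isVCusp_translates (f : CuspForm (Gamma N) k) :
    IsVCusp (regular N) k (translates N k f) where
  mdiff _ := (CuspFormClass.holo f).slash k _
  smul := translates_smul fun _ ↦ slash_eq_of_mem f
  zero q := CuspFormClass.zero_at_infty_slash f q.out

lemma parityProj_mulVec {v : ℍ → LevelGroup N → ℂ} (hv : IsVForm (regular N) k v) (τ : ℍ) :
    parityProj N k *ᵥ v τ = v τ := by
  have h := hv.smul (-1) τ
  rw [ModularGroup.SL_neg_smul, one_smul, jf_neg, jf_one] at h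
  rw [parityProj, Matrix.smul_mulVec, Matrix.add_mulVec, Matrix.smul_mulVec, ← h,
    Matrix.one_mulVec, ← two_smul ℂ, smul_smul]
  norm_num

variable {r : ℕ} {B : Matrix (LevelGroup N) (Fin r) ℂ} {A : Matrix (Fin r) (LevelGroup N) ℂ}
  (hAB : A * B = 1) (hBA : B * A = parityProj N k)

include hBA in
omit hAB in
lemma comm_of_eq_parityProj (γ : SL(2, ℤ)) : B * A * regular N γ = regular N γ * (B * A) := by
  rw [hBA, parityProj_comm]

/-- The representation of `SL(2, ℤ)` on functions of given parity on the level group. -/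
abbrev parityRep : SL(2, ℤ) →* Matrix (Fin r) (Fin r) ℂ :=
  compress (regular N) B A hAB (comm_of_eq_parityProj hBA)

/-- A cusp form as a vector-valued cusp form of level one. -/
def toVec : CuspForm (Gamma N) k →ₗ[ℂ] cuspSpace (parityRep hAB hBA) k where
  toFun f := ⟨fun τ ↦ A *ᵥ translates N k f τ, (isVCusp_translates f).compress⟩
  map_add' f g := by
    ext τ : 2
    change A *ᵥ _ = A *ᵥ _ + A *ᵥ _
    rw [← Matrix.mulVec_add]
    congr 1
    ext q
    exact congrFun (SlashAction.add_slash k q.out (f : ℍ → ℂ) g) τ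
  map_smul' c f := by
    ext τ : 2
    change A *ᵥ _ = c • A *ᵥ _
    rw [← Matrix.mulVec_smul]
    congr 1
    ext q
    exact congrFun (SL_smul_slash k q.out (f : ℍ → ℂ) c) τ

lemma toVec_injective : Function.Injective (toVec hAB hBA) := by
  rw [injective_iff_map_eq_zero]
  intro f hf
  ext τ
  have h1 : A *ᵥ translates N k f τ = 0 := congrFun (congrArg Subtype.val hf) τ
  have h2 : translates N k f τ = 0 := by
    rw [← parityProj_mulVec (isVCusp_translates f).isVForm τ, ← hBA, ← Matrix.mulVec_mulVec, h1,
      Matrix.mulVec_zero]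
  have h3 := translates_mk (k := k) (f := f) (fun _ ↦ slash_eq_of_mem f) 1 τ
  rw [h2, SlashAction.slash_one] at h3
  exact h3.symm

lemma toVec_surjective : Function.Surjective (toVec hAB hBA) := by
  rintro ⟨v, hv⟩
  have hs (γ : SL(2, ℤ)) (τ : ℍ) : B *ᵥ v (γ • τ) = jf γ τ ^ k • (regular N γ *ᵥ (B *ᵥ v τ)) := by
    rw [hv.smul, Matrix.mulVec_smul, Matrix.mulVec_mulVec, mul_compress, Matrix.mulVec_mulVec]
  have hslash (γ : SL(2, ℤ)) :
      (fun τ ↦ (B *ᵥ v τ) 1) ∣[k] γ = fun τ ↦ (B *ᵥ v τ) (γ : LevelGroup N) := by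
    rw [slash_eq_iff]
    intro τ
    rw [hs, Pi.smul_apply, regular_mulVec, one_mul, smul_eq_mul]
  have hz (q : LevelGroup N) : IsZeroAtImInfty fun τ ↦ (B *ᵥ v τ) q := by
    have : Tendsto (fun τ ↦ ∑ l, B q l * v τ l) atImInfty (𝓝 (∑ l, B q l * 0)) :=
      tendsto_finsetSum _ fun l _ ↦ (hv.zero l).const_mul (B q l)
    simpa using! this
  have hinv (γ : SL(2, ℤ)) (hγ : γ ∈ Gamma N) :
      (fun τ ↦ (B *ᵥ v τ) 1) ∣[k] γ = fun τ ↦ (B *ᵥ v τ) 1 := by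
    rw [hslash, (QuotientGroup.eq_one_iff γ).mpr hγ]
  let F : CuspForm (Gamma N) k :=
    { toFun := fun τ ↦ (B *ᵥ v τ) 1
      slash_action_eq' := by
        rintro _ ⟨γ, hγ, rfl⟩
        exact hinv γ hγ
      holo' := mdiff_mulVec B hv.mdiff 1
      zero_at_cusps' := fun {c} hc ↦ by
        have hc' : IsCusp c 𝒮ℒ := (Subgroup.IsArithmetic.isCusp_iff_isCusp_SL2Z _).mp hc
        rw [OnePoint.isZeroAt_iff_forall_SL2Z hc']
        intro γ _
        rw [hslash]
        exact hz γ }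
  refine ⟨F, Subtype.ext (funext fun τ ↦ ?_)⟩
  have h1 : translates N k F τ = B *ᵥ v τ := by
    ext q
    have := congrFun (hslash q.out) τ
    rw [QuotientGroup.out_eq'] at this
    exact this
  change A *ᵥ translates N k F τ = v τ
  rw [h1, Matrix.mulVec_mulVec, hAB, Matrix.one_mulVec]

lemma finrank_cuspForm_eq : Module.finrank ℂ (CuspForm (Gamma N) k) =
    Module.finrank ℂ (cuspSpace (parityRep hAB hBA) k) :=
  (LinearEquiv.ofBijective _ ⟨toVec_injective hAB hBA, toVec_surjective hAB hBA⟩).finrank_eq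

include hAB in
/-- There is a generic basis of vector-valued cusp forms. -/
theorem exists_isFull (hN : 2 < N) : ∃ w f, IsFull (parityRep hAB hBA) w f := by
  obtain ⟨τ, hτ⟩ := exists_independent hN (fun q : LevelGroup N ↦ q.out) fun q q' hne h ↦ by
    rw [← QuotientGroup.eq_one_iff, QuotientGroup.mk_mul, QuotientGroup.mk_inv,
      QuotientGroup.out_eq', QuotientGroup.out_eq', mul_inv_eq_one] at h
    exact hne h
  let V (x : Σ w : ℤ, ModularForm (Gamma N) w) : Fin r → ℂ := A *ᵥ translates N x.1 x.2 τ
  have hspan : Submodule.span ℂ (Set.range V) = ⊤ := by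
    by_contra hlt
    obtain ⟨φ, hφ0, hφ⟩ := Submodule.exists_le_ker_of_lt_top _ (lt_top_iff_ne_top.mpr hlt)
    apply hφ0
    set c : Fin r → ℂ := fun i ↦ φ fun j ↦ if i = j then 1 else 0 with hc
    have hφc (x : Fin r → ℂ) : φ x = c ⬝ᵥ x := by
      rw [LinearMap.pi_apply_eq_sum_univ φ x]
      simp [dotProduct, hc, mul_comm]
    have h0 : c ᵥ* A = 0 := hτ _ fun w f ↦ by
      have h1 : φ (V ⟨w, f⟩) = 0 := hφ (Submodule.subset_span ⟨⟨w, f⟩, rfl⟩)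
      rw [hφc, Matrix.dotProduct_mulVec] at h1
      exact h1
    have h2 : c = 0 := by
      rw [← Matrix.vecMul_one c, ← hAB, ← Matrix.vecMul_vecMul, h0, Matrix.zero_vecMul]
    ext x
    simp [hφc, h2]
  obtain ⟨κ, a, -, hκ, hli⟩ := exists_linearIndependent' ℂ V
  let b := Module.Basis.mk hli (by rw [hκ, hspan])
  let e := (Pi.basisFun ℂ (Fin r)).indexEquiv b
  let x (i : Fin r) := a (e i)
  have hli' : LinearIndependent ℂ fun i ↦ V (x i) := hli.comp e e.injective
  refine ⟨fun i ↦ 12 + (x i).1, fun i τ ↦ discriminant τ • (A *ᵥ translates N (x i).1 (x i).2 τ),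
    fun i ↦ (isVForm_translates (x i).2).compress.discriminant_smul, τ, ?_⟩
  have hdet : (Matrix.of fun i ↦ V (x i)).det ≠ 0 := by
    rw [← isUnit_iff_ne_zero, ← Matrix.isUnit_iff_isUnit_det,
      ← Matrix.linearIndependent_rows_iff_isUnit]
    exact hli'
  have : rowMat (fun i τ ↦ discriminant τ • (A *ᵥ translates N (x i).1 (x i).2 τ)) τ =
      discriminant τ • Matrix.of fun i ↦ V (x i) := rfl
  rw [this, Matrix.det_smul]
  exact mul_ne_zero (pow_ne_zero _ (discriminant_ne_zero τ)) hdet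

omit [NeZero N] in
lemma notMem_Gamma_of_zero [Fact (1 < N)] {γ : SL(2, ℤ)} (h : γ 0 0 = 0 ∨ γ 1 1 = 0) :
    γ ∉ Gamma N := by
  intro hγ
  obtain ⟨h1, -, -, h2⟩ := Gamma_mem.mp hγ
  rcases h with h | h
  · rw [h, Int.cast_zero] at h1
    exact zero_ne_one h1
  · rw [h, Int.cast_zero] at h2
    exact zero_ne_one h2

lemma neg_apply_SL (γ : SL(2, ℤ)) (i j : Fin 2) : (-γ) i j = -γ i j := rfl

open ModularGroup in
omit [NeZero N] in
lemma T_pow_notMem_Gamma {t : ℕ} (ht : 0 < t) (htN : t < N) : T ^ t ∉ Gamma N := by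
  intro h
  have h2 := (Gamma_mem.mp h).2.1
  rw [← zpow_natCast, coe_T_zpow] at h2
  replace h2 : ((t : ℤ) : ZMod N) = 0 := h2
  rw [Int.cast_natCast, ZMod.natCast_eq_zero_iff] at h2
  exact absurd (Nat.le_of_dvd ht h2) (by lia)

open ModularGroup in
omit [NeZero N] in
lemma neg_T_pow_notMem_Gamma (hN : 2 < N) (t : ℕ) : -T ^ t ∉ Gamma N := by
  intro h
  have h2 := (Gamma_mem.mp h).1
  rw [← zpow_natCast, neg_apply_SL, coe_T_zpow] at h2
  replace h2 : ((-1 : ℤ) : ZMod N) = 1 := h2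
  have : Fact (2 < N) := ⟨hN⟩
  exact ZMod.neg_one_ne_one (n := N) (by simpa using h2)

open ModularGroup in
/-- The dimension formula in terms of the order of the level group. -/
theorem finrank_cuspForm_card (hN : 2 < N) (hk : 3 ≤ k) :
    (Module.finrank ℂ (CuspForm (Gamma N) k) : ℝ) =
      Nat.card (LevelGroup N) / 2 * (((k : ℝ) - 1) / 12 - 1 / (2 * N)) := by
  obtain ⟨r, B, A, hBA, hAB, hr⟩ := exists_factor_of_idempotent (parityProj_mul_self (N := N) k)
  rw [trace_parityProj hN] at hr
  have hr' : (r : ℝ) = Nat.card (LevelGroup N) / 2 := by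
    rw [Nat.card_eq_fintype_card, ← Complex.ofReal_inj]
    push_cast
    exact hr
  have : Fact (1 < N) := ⟨by lia⟩
  have htr {γ : SL(2, ℤ)} (h1 : γ ∉ Gamma N) (h2 : -γ ∉ Gamma N) :
      (parityRep hAB hBA γ).trace = 0 := by
    rw [trace_compress, hBA, trace_regular_mul_parityProj k h1 h2]
  have htr' {γ : SL(2, ℤ)} (h : γ 0 0 = 0 ∨ γ 1 1 = 0) : (parityRep hAB hBA γ).trace = 0 :=
    htr (notMem_Gamma_of_zero h) (notMem_Gamma_of_zero (by simpa [neg_apply_SL] using h))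
  have hρ (γ : SL(2, ℤ)) (hγ : γ ∈ Gamma N) : parityRep hAB hBA γ = 1 := by
    rw [compress_apply, regular_eq_one hγ, Matrix.mul_one, hAB]
  have hneg : parityRep hAB hBA (-1) = (-1 : ℂ) ^ k • 1 := by
    have h1 : B = parityProj N k * B := by rw [← hBA, Matrix.mul_assoc, hAB, Matrix.mul_one]
    rw [compress_apply, Matrix.mul_assoc, h1, ← Matrix.mul_assoc (regular N _),
      regular_neg_one_mul_parityProj, Matrix.smul_mul, ← h1, Matrix.mul_smul, hAB]
  rw [finrank_cuspForm_eq hAB hBA, finrank_cuspSpace hρ hneg (by simp) hk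
    (fun t ht0 htN ↦ htr (T_pow_notMem_Gamma ht0 htN) (neg_T_pow_notMem_Gamma hN t))
    (htr' (.inl ?_)) (htr' (.inl ?_)) (htr' (.inr ?_)) (exists_isFull hAB hBA hN),
    Fintype.card_fin, hr']
  · simp [coe_S]
  · simp [Matrix.SpecialLinearGroup.coe_mul, coe_S, coe_T]
  · simp [Matrix.SpecialLinearGroup.coe_inv, coe_S, Matrix.adjugate_fin_two]

end

section

open CongruenceSubgroup

/-- The pairs of coprime elements of a ring. -/
abbrev CoprimePairs (R : Type*) [CommRing R] := {x : R × R // IsCoprime x.1 x.2}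

section

variable {R S : Type*} [CommRing R] [CommRing S]

lemma exists_matrix_row (x : CoprimePairs R) :
    ∃ a : R × R, a.1 * x.1.2 - a.2 * x.1.1 = 1 := by
  obtain ⟨u, v, h⟩ := x.2
  exact ⟨(v, -u), by linear_combination h⟩

/-- A matrix of determinant one is determined by its bottom row and a translation parameter. -/
def specialLinearEquiv (R : Type*) [CommRing R] :
    Matrix.SpecialLinearGroup (Fin 2) R ≃ CoprimePairs R × R where
  toFun γ :=
    let x : CoprimePairs R := ⟨(γ 1 0, γ 1 1), ModularGroup.bottom_row_coprime γ⟩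
    (x, γ 0 1 * (exists_matrix_row x).choose.1 - γ 0 0 * (exists_matrix_row x).choose.2)
  invFun y :=
    let s := (exists_matrix_row y.1).choose
    ⟨!![s.1 + y.2 * y.1.1.1, s.2 + y.2 * y.1.1.2; y.1.1.1, y.1.1.2], by
      rw [Matrix.det_fin_two_of]
      linear_combination (exists_matrix_row y.1).choose_spec⟩
  left_inv γ := by
    set x : CoprimePairs R := ⟨(γ 1 0, γ 1 1), ModularGroup.bottom_row_coprime γ⟩ with hx
    have hs := (exists_matrix_row x).choose_spec
    have hdet := γ.det_coe
    rw [Matrix.det_fin_two] at hdet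
    set s := (exists_matrix_row x).choose with hs'
    simp only [hx] at hs
    ext i j
    fin_cases i <;> fin_cases j
    · change s.1 + (γ 0 1 * s.1 - γ 0 0 * s.2) * γ 1 0 = γ 0 0
      linear_combination γ 0 0 * hs - s.1 * hdet
    · change s.2 + (γ 0 1 * s.1 - γ 0 0 * s.2) * γ 1 1 = γ 0 1
      linear_combination γ 0 1 * hs - s.2 * hdet
    · rfl
    · rfl
  right_inv y := by
    obtain ⟨x, b⟩ := y
    refine Prod.ext rfl ?_
    have hs := (exists_matrix_row x).choose_spec
    change ((exists_matrix_row x).choose.2 + b * x.1.2) * (exists_matrix_row x).choose.1 -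
      ((exists_matrix_row x).choose.1 + b * x.1.1) * (exists_matrix_row x).choose.2 = b
    linear_combination b * hs

/-- Coprime pairs in a product ring. -/
def coprimePairsProdEquiv : CoprimePairs (R × S) ≃ CoprimePairs R × CoprimePairs S where
  toFun x := (⟨(x.1.1.1, x.1.2.1), x.2.map (RingHom.fst R S)⟩,
    ⟨(x.1.1.2, x.1.2.2), x.2.map (RingHom.snd R S)⟩)
  invFun y := ⟨((y.1.1.1, y.2.1.1), (y.1.1.2, y.2.1.2)), by
    obtain ⟨a, b, h⟩ := y.1.2
    obtain ⟨c, d, h'⟩ := y.2.2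
    exact ⟨(a, c), (b, d), Prod.ext h h'⟩⟩
  left_inv _ := rfl
  right_inv _ := rfl

/-- Coprime pairs in isomorphic rings. -/
def coprimePairsCongr (e : R ≃+* S) : CoprimePairs R ≃ CoprimePairs S where
  toFun x := ⟨(e x.1.1, e x.1.2), x.2.map e.toRingHom⟩
  invFun y := ⟨(e.symm y.1.1, e.symm y.1.2), y.2.map e.symm.toRingHom⟩
  left_inv x := by simp
  right_inv y := by simp

end

lemma ZMod.isUnit_iff_castHom_ne_zero {p e : ℕ} [Fact p.Prime] (he : 0 < e) (x : ZMod (p ^ e)) :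
    IsUnit x ↔ ZMod.castHom (dvd_pow_self p he.ne') (ZMod p) x ≠ 0 := by
  have : NeZero (p ^ e) := ⟨pow_ne_zero _ (Fact.out : p.Prime).ne_zero⟩
  obtain ⟨n, rfl⟩ := ZMod.natCast_zmod_surjective x
  rw [ZMod.isUnit_iff_coprime, map_natCast, Ne, ZMod.natCast_eq_zero_iff,
    Nat.coprime_pow_right_iff he, Nat.coprime_comm, (Fact.out : p.Prime).coprime_iff_not_dvd]

lemma isCoprime_iff_isUnit_or {p e : ℕ} [Fact p.Prime] (he : 0 < e) (x y : ZMod (p ^ e)) :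
    IsCoprime x y ↔ IsUnit x ∨ IsUnit y := by
  constructor
  · intro h
    have h' := h.map (ZMod.castHom (dvd_pow_self p he.ne') (ZMod p))
    rw [ZMod.isUnit_iff_castHom_ne_zero he, ZMod.isUnit_iff_castHom_ne_zero he]
    by_contra! hc
    rw [hc.1, hc.2] at h'
    exact not_isCoprime_zero_zero h'
  · rintro (⟨u, rfl⟩ | ⟨u, rfl⟩)
    · exact ⟨↑u⁻¹, 0, by simp⟩
    · exact ⟨0, ↑u⁻¹, by simp⟩

open scoped Classical in
lemma card_nonunits {n : ℕ} [NeZero n] :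
    Nat.card {x : ZMod n // ¬ IsUnit x} + n.totient = n := by
  have h1 : Nat.card {x : ZMod n // IsUnit x} = n.totient := by
    rw [← ZMod.card_units_eq_totient, ← Nat.card_eq_fintype_card]
    exact (Nat.card_congr (Equiv.ofBijective
      (fun u : (ZMod n)ˣ ↦ (⟨↑u, u.isUnit⟩ : {x : ZMod n // IsUnit x}))
      ⟨fun u v h ↦ Units.ext (congrArg Subtype.val h), fun ⟨_, u, hu⟩ ↦ ⟨u, Subtype.ext hu⟩⟩)).symm
  rw [← h1, add_comm, ← Nat.card_sum, Nat.card_congr (Equiv.sumCompl fun x : ZMod n ↦ IsUnit x),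
    Nat.card_zmod]

open scoped Classical in
lemma card_coprimePairs_prime_pow {p e : ℕ} (hp : p.Prime) (he : 0 < e) :
    (Nat.card (CoprimePairs (ZMod (p ^ e))) : ℝ) = (p ^ e : ℝ) ^ 2 * (1 - 1 / (p : ℝ) ^ 2) := by
  have := Fact.mk hp
  have : NeZero (p ^ e) := ⟨pow_ne_zero _ hp.ne_zero⟩
  have h1 := card_nonunits (n := p ^ e)
  rw [Nat.totient_prime_pow hp he] at h1
  obtain ⟨e, rfl⟩ : ∃ d, e = d + 1 := ⟨e - 1, by lia⟩
  have h2 : (Nat.card {x : ZMod (p ^ (e + 1)) // ¬ IsUnit x} : ℝ) = p ^ e := by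
    have h1' : (Nat.card {x : ZMod (p ^ (e + 1)) // ¬ IsUnit x} : ℝ) +
        p ^ e * ((p - 1 : ℕ) : ℝ) = p ^ (e + 1) := by exact_mod_cast h1
    rw [Nat.cast_sub hp.one_le, Nat.cast_one, pow_succ (p : ℝ)] at h1'
    linear_combination h1'
  have h3 : Nat.card (CoprimePairs (ZMod (p ^ (e + 1)))) +
      Nat.card {x : ZMod (p ^ (e + 1)) // ¬ IsUnit x} ^ 2 = (p ^ (e + 1)) ^ 2 := by
    have h4 : Nat.card {x : ZMod (p ^ (e + 1)) × ZMod (p ^ (e + 1)) // ¬ IsCoprime x.1 x.2} =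
        Nat.card {x : ZMod (p ^ (e + 1)) // ¬ IsUnit x} ^ 2 := by
      rw [sq, ← Nat.card_prod]
      refine Nat.card_congr ((Equiv.subtypeEquivRight fun x ↦ ?_).trans
        (Equiv.subtypeProdEquivProd (p := fun x ↦ ¬ IsUnit x) (q := fun x ↦ ¬ IsUnit x)))
      rw [isCoprime_iff_isUnit_or he, not_or]
    rw [← h4, ← Nat.card_sum, Nat.card_congr
      (Equiv.sumCompl fun x : ZMod (p ^ (e + 1)) × ZMod (p ^ (e + 1)) ↦ IsCoprime x.1 x.2),
      Nat.card_prod, Nat.card_zmod, sq]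
  have h3' : (Nat.card (CoprimePairs (ZMod (p ^ (e + 1)))) : ℝ) +
      (Nat.card {x : ZMod (p ^ (e + 1)) // ¬ IsUnit x} : ℝ) ^ 2 = ((p : ℝ) ^ (e + 1)) ^ 2 := by
    exact_mod_cast h3
  have hp0 : (p : ℝ) ≠ 0 := by exact_mod_cast hp.ne_zero
  rw [h2] at h3'
  rw [eq_sub_of_add_eq h3']
  field_simp
  ring

/-- The number of coprime pairs modulo `N`. -/
theorem card_coprimePairs {N : ℕ} (hN : N ≠ 0) : (Nat.card (CoprimePairs (ZMod N)) : ℝ) =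
    (N : ℝ) ^ 2 * ∏ p ∈ N.primeFactors, (1 - 1 / (p : ℝ) ^ 2) := by
  induction N using Nat.recOnPosPrimePosCoprime with
  | zero => exact absurd rfl hN
  | one =>
    have : Nat.card (CoprimePairs (ZMod 1)) = 1 := by
      rw [Nat.card_eq_one_iff_unique]
      exact ⟨inferInstance, ⟨⟨(0, 0), 0, 0, Subsingleton.elim _ _⟩⟩⟩
    rw [this]
    simp
  | prime_pow p e hp he =>
    rw [card_coprimePairs_prime_pow hp he, Nat.primeFactors_prime_pow he.ne' hp,
      Finset.prod_singleton, Nat.cast_pow]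
  | coprime a b ha hb hab iha ihb =>
    rw [Nat.card_congr ((coprimePairsCongr (ZMod.chineseRemainder hab)).trans
      coprimePairsProdEquiv), Nat.card_prod, Nat.cast_mul, iha (by lia), ihb (by lia),
      Nat.primeFactors_mul (by lia) (by lia), Finset.prod_union hab.disjoint_primeFactors]
    push_cast
    ring

/-- Coprime residues lift to coprime integers. -/
lemma exists_isCoprime_lift {N : ℕ} [NeZero N] {x y : ZMod N} (h : IsCoprime x y) :
    ∃ c d : ℤ, IsCoprime c d ∧ (c : ZMod N) = x ∧ (d : ZMod N) = y := by
  have hN : 0 < N := NeZero.pos N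
  set c : ℕ := x.val + N with hc
  set g : ℕ := y.val.gcd N with hg
  have hg0 : 0 < g := Nat.gcd_pos_of_pos_right _ hN
  have hcx : ((c : ℕ) : ZMod N) = x := by simp [hc]
  obtain ⟨q, hqc, hq, hqy⟩ := Nat.forall_exists_prime_gt_and_modEq c (q := N / g) (a := y.val / g)
    (Nat.div_pos (Nat.gcd_le_right _ hN) hg0).ne' (Nat.coprime_div_gcd_div_gcd hg0)
  have hd : ((g * q : ℕ) : ZMod N) = y := by
    have h1 := hqy.mul_left' g
    rw [Nat.mul_div_cancel' (Nat.gcd_dvd_right _ _), Nat.mul_div_cancel' (Nat.gcd_dvd_left _ _)]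
      at h1
    rw [(ZMod.natCast_eq_natCast_iff _ _ _).mpr h1, ZMod.natCast_zmod_val]
  refine ⟨c, (g * q : ℕ), ?_, by rw [Int.cast_natCast, hcx], by rw [Int.cast_natCast, hd]⟩
  rw [Nat.isCoprime_iff_coprime]
  refine Nat.Coprime.mul_right ?_ ?_
  · have h2 := h.map (ZMod.castHom ((Nat.gcd_dvd_right c g).trans (Nat.gcd_dvd_right _ N))
      (ZMod (c.gcd g)))
    have hx0 : ZMod.castHom ((Nat.gcd_dvd_right c g).trans (Nat.gcd_dvd_right _ N))
        (ZMod (c.gcd g)) x = 0 := by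
      rw [hcx.symm, map_natCast, ZMod.natCast_eq_zero_iff]
      exact Nat.gcd_dvd_left _ _
    have hy0 : ZMod.castHom ((Nat.gcd_dvd_right c g).trans (Nat.gcd_dvd_right _ N))
        (ZMod (c.gcd g)) (g * q : ℕ) = 0 := by
      rw [map_natCast, ZMod.natCast_eq_zero_iff]
      exact (Nat.gcd_dvd_right _ _).trans (dvd_mul_right _ _)
    rw [hd] at hy0
    rw [hx0, hy0, isCoprime_zero_left, isUnit_zero_iff, eq_comm, ← Nat.cast_one,
      ← Nat.cast_zero, ZMod.natCast_eq_natCast_iff', ← Nat.ModEq] at h2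
    simpa [Nat.coprime_iff_gcd_eq_one] using (Nat.modEq_zero_iff_dvd.mp h2)
  · exact ((Nat.Prime.coprime_iff_not_dvd hq).mpr
      (Nat.not_dvd_of_pos_of_lt (by lia) hqc)).symm

/-- Reduction modulo `N` is surjective on special linear groups. -/
theorem map_castRingHom_surjective (N : ℕ) [NeZero N] : Function.Surjective
    (Matrix.SpecialLinearGroup.map (n := Fin 2) (Int.castRingHom (ZMod N))) := by
  intro A
  obtain ⟨c, d, hcd, hc, hd⟩ := exists_isCoprime_lift (ModularGroup.bottom_row_coprime A)
  obtain ⟨a, ha⟩ := exists_matrix_row ⟨(c, d), hcd⟩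
  have hdet := A.det_coe
  rw [Matrix.det_fin_two, ← hc, ← hd] at hdet
  have ha' : (a.1 : ZMod N) * d - a.2 * c = 1 := by
    exact_mod_cast congrArg (Int.cast (R := ZMod N)) ha
  obtain ⟨b, hb⟩ := ZMod.intCast_surjective ((A 0 1 : ZMod N) * (a.1 : ZMod N) - A 0 0 * (a.2 : ZMod N))
  refine ⟨⟨!![a.1 + b * c, a.2 + b * d; c, d], ?_⟩, ?_⟩
  · rw [Matrix.det_fin_two_of]
    linear_combination ha
  · ext i j
    fin_cases i <;> fin_cases j
    · change ((a.1 + b * c : ℤ) : ZMod N) = A 0 0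
      push_cast
      rw [hb]
      linear_combination A 0 0 * ha' - a.1 * hdet
    · change ((a.2 + b * d : ℤ) : ZMod N) = A 0 1
      push_cast
      rw [hb]
      linear_combination A 0 1 * ha' - a.2 * hdet
    · exact hc
    · exact hd

/-- The order of the level group. -/
theorem card_levelGroup (N : ℕ) [NeZero N] : (Nat.card (LevelGroup N) : ℝ) =
    (N : ℝ) ^ 3 * ∏ p ∈ N.primeFactors, (1 - 1 / (p : ℝ) ^ 2) := by
  have e : LevelGroup N ≃ Matrix.SpecialLinearGroup (Fin 2) (ZMod N) :=
    (QuotientGroup.quotientKerEquivOfSurjective _ (map_castRingHom_surjective N)).toEquiv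
  rw [Nat.card_congr (e.trans (specialLinearEquiv (ZMod N))), Nat.card_prod, Nat.card_zmod,
    Nat.cast_mul, card_coprimePairs (NeZero.ne N)]
  ring

end

end VVForm

end

open CongruenceSubgroup

/-- The dimension formula for cusp forms of weight `k ≥ 3` and level `Γ(N)`, `N > 2`:
`dim S_k(Γ(N)) = ((k-1)/24 - 1/(4N)) · N³ · ∏_{p | N} (1 - 1/p²)`. -/
theorem cuspForm_finrank_gamma (N : ℕ) (hN : 2 < N) (k : ℤ) (hk : 3 ≤ k) :
    (Module.finrank ℂ (CuspForm (Gamma N) k) : ℝ) =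
      (((k : ℝ) - 1) / 24 - 1 / (4 * N)) * N ^ 3 *
        ∏ p ∈ N.primeFactors, (1 - 1 / (p : ℝ) ^ 2) := by
  have : NeZero N := ⟨by lia⟩
  rw [VVForm.finrank_cuspForm_card hN hk, VVForm.card_levelGroup]
  ring
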